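/- (Multiplier lemma.) Let Q_M be a quasianalytic Denjoy–Carleman class, U ⊆ ℝ^n open, X a closed Q_M-subset of U, and Φ ∈ Q_M(U). Let F ∈ C^∞(U) be flat at every point of X∩{Φ=0}, i.e. F and all its iterated partial derivatives of every order vanish at every point of X at which Φ vanishes. Then there exist an open set V with X ⊆ V ⊆ U and a function G ∈ C^∞(V) such that G(x) = F(x)/Φ(x) for every x ∈ X with Φ(x) ≠ 0, and G is flat at every point of X∩{Φ=0}. -/

import Mathlib

namespace QDC

/-- `M` is a sequence defining a quasianalytic Denjoy–Carleman class: positive,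
logarithmically convex, with `sup_k (M_{k+1}/M_k)^{1/k} < ∞` and
`Σ_k M_k/((k+1) M_{k+1}) = ∞`. -/
def IsDCSeq (M : ℕ → ℝ) : Prop :=
  (∀ k, 0 < M k) ∧
  (∀ k, M (k + 1) / M k ≤ M (k + 2) / M (k + 1)) ∧
  (∃ C : ℝ, ∀ k : ℕ, 1 ≤ k → (M (k + 1) / M k) ^ ((1 : ℝ) / k) ≤ C) ∧
  ¬ Summable (fun k => M k / ((k + 1) * M (k + 1)))

variable {σ : Type*} [Fintype σ] [DecidableEq σ]

/-- First-order partial derivative in the `i`-th coordinate direction. -/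
noncomputable def pd (i : σ) (f : (σ → ℝ) → ℝ) : (σ → ℝ) → ℝ :=
  fun x => fderiv ℝ f x (Pi.single i 1)

/-- Iterated partial derivative `∂^{|α|} f / ∂x^α` for a multi-index `α`. -/
noncomputable def mpd (α : σ → ℕ) (f : (σ → ℝ) → ℝ) : (σ → ℝ) → ℝ :=
  (Finset.univ : Finset σ).toList.foldr (fun i g => (pd i)^[α i] g) f

/-- `α! = α_1! ⋯ α_n!`. -/
def mfact (α : σ → ℕ) : ℕ := ∏ i, (α i).factorial

/-- `|α| = α_1 + ⋯ + α_n`. -/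
def mdeg (α : σ → ℕ) : ℕ := ∑ i, α i

/-- `f` belongs to the Denjoy–Carleman class `Q_M(V)`. -/
def MemDC (M : ℕ → ℝ) (V : Set (σ → ℝ)) (f : (σ → ℝ) → ℝ) : Prop :=
  ContDiffOn ℝ (⊤ : ℕ∞) f V ∧
  ∀ K ⊆ V, IsCompact K → ∃ A B : ℝ, 0 < A ∧ 0 < B ∧
    ∀ x ∈ K, ∀ α : σ → ℕ,
      |mpd α f x| ≤ A * B ^ mdeg α * (mfact α : ℝ) * M (mdeg α)

/-- `X` is a closed `Q_M`-subset of the open set `U`: it is closed in `U` and locally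
the common zero set of finitely many functions of class `Q_M`. -/
def IsQMClosed (M : ℕ → ℝ) {n : ℕ} (U X : Set (Fin n → ℝ)) : Prop :=
  X ⊆ U ∧ closure X ∩ U ⊆ X ∧
  ∀ b ∈ X, ∃ V : Set (Fin n → ℝ), IsOpen V ∧ b ∈ V ∧ V ⊆ U ∧
    ∃ (k : ℕ) (g : Fin k → ((Fin n → ℝ) → ℝ)),
      (∀ i, MemDC M V (g i)) ∧ X ∩ V = {x ∈ V | ∀ i, g i x = 0}

/-- `f : X∖Z → ℝ` belongs to `Q_M(X,Z)`: it is a quotient `g/h` of restrictions to `X` of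
functions of class `Q_M` on a neighbourhood of `X`, where `h` vanishes nowhere on `X∖Z`. -/
def MemQXZ (M : ℕ → ℝ) {n : ℕ} (X Z : Set (Fin n → ℝ)) (f : (Fin n → ℝ) → ℝ) : Prop :=
  ∃ (V : Set (Fin n → ℝ)) (g h : (Fin n → ℝ) → ℝ), IsOpen V ∧ X ⊆ V ∧
    MemDC M V g ∧ MemDC M V h ∧ (∀ x ∈ X \ Z, h x ≠ 0) ∧
    ∀ x ∈ X \ Z, f x = g x / h x

/-- `b` is a `Q_M`-smooth point of `X ⊆ ℝ^n`: near `b`, `X` is the graph of a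
`Q_M`-map over some subset `I` of the coordinates. -/
def QMSmoothPt (M : ℕ → ℝ) {n : ℕ} (X : Set (Fin n → ℝ)) (b : Fin n → ℝ) : Prop :=
  ∃ W : Set (Fin n → ℝ), IsOpen W ∧ b ∈ W ∧
    ∃ (I : Finset (Fin n)) (Ω : Set ({ i : Fin n // i ∈ I } → ℝ))
      (ψ : ({ i : Fin n // i ∈ I } → ℝ) → ({ i : Fin n // i ∉ I } → ℝ)),
      IsOpen Ω ∧ (∀ j : { i : Fin n // i ∉ I }, MemDC M Ω (fun u => ψ u j)) ∧
      X ∩ W = {y ∈ W | (fun i : { i : Fin n // i ∈ I } => y i) ∈ Ω ∧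
        ∀ j : { i : Fin n // i ∉ I }, y j = ψ (fun i : { i : Fin n // i ∈ I } => y i) j}

/-- The formal Taylor expansion `T_a f` of `f` at `a`, as a multivariate formal
power series. -/
noncomputable def taylorAt {n : ℕ} (f : (Fin n → ℝ) → ℝ) (a : Fin n → ℝ) :
    MvPowerSeries (Fin n) ℝ :=
  fun α : Fin n →₀ ℕ => mpd (fun i => α i) f a / (mfact fun i => α i : ℕ)

/-- `f` is flat at `x`: all iterated partial derivatives (including order `0`) vanish. -/
def FlatAt {n : ℕ} (f : (Fin n → ℝ) → ℝ) (x : Fin n → ℝ) : Prop :=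
  ∀ α : Fin n → ℕ, mpd α f x = 0

end QDC

/-! ## Part 1 -/

namespace QDC
open Set Filter Topology
open scoped ContDiff Nat

/-- Normalised weights. -/
structure Wt (M : ℕ → ℝ) : Prop where
  one_le : ∀ k, 1 ≤ M k
  zero : M 0 = 1
  mul_le : ∀ a b, M a * M b ≤ M (a + b)
  mul_le' : ∀ a b, M (a + 1) * M (b + 1) ≤ M (a + b + 1)
  der : ∃ C : ℝ, 1 ≤ C ∧ ∀ k, M (k + 1) ≤ C ^ k * M k
  lc : ∀ k, M (k + 1) * M (k + 1) ≤ M k * M (k + 2)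
  ns : ¬ Summable (fun k => M k / ((k + 1) * M (k + 1)))

lemma Wt.pos {M : ℕ → ℝ} (W : Wt M) (k : ℕ) : 0 < M k := lt_of_lt_of_le one_pos (W.one_le k)

section
variable {E F G H : Type} [NormedAddCommGroup E] [NormedSpace ℝ E] [NormedAddCommGroup F]
  [NormedSpace ℝ F] [NormedAddCommGroup G] [NormedSpace ℝ G] [NormedAddCommGroup H] [NormedSpace ℝ H]

lemma cda_nat {f : E → F} {x : E} (hf : ContDiffAt ℝ ∞ f x) (n : ℕ) : ContDiffAt ℝ n f x :=
  hf.of_le (by exact_mod_cast le_top)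

lemma cda_diff {f : E → F} {x : E} (hf : ContDiffAt ℝ ∞ f x) : DifferentiableAt ℝ f x :=
  hf.differentiableAt (by simp)

lemma cda_ev {f : E → F} {x : E} (hf : ContDiffAt ℝ ∞ f x) :
    ∀ᶠ y in 𝓝 x, DifferentiableAt ℝ f y := by
  have := (cda_nat hf 1).eventually (by simp)
  filter_upwards [this] with y hy
  exact hy.differentiableAt (by simp)

lemma cda_fderiv {f : E → F} {x : E} (hf : ContDiffAt ℝ ∞ f x) :
    ContDiffAt ℝ ∞ (fderiv ℝ f) x :=
  hf.fderiv_right (by simp)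

lemma ifd_congr {f g : E → F} {x : E} (h : f =ᶠ[𝓝 x] g) {n : ℕ} :
    iteratedFDeriv ℝ n f x = iteratedFDeriv ℝ n g x :=
  (Filter.EventuallyEq.iteratedFDeriv ℝ h n).eq_of_nhds

lemma bil_bound (B : F →L[ℝ] G →L[ℝ] H) (hB : ‖B‖ ≤ 1) {f : E → F} {g : E → G} {x : E}
    (hf : ContDiffAt ℝ ∞ f x) (hg : ContDiffAt ℝ ∞ g x) (n : ℕ) :
    ‖iteratedFDeriv ℝ n (fun y => B (f y) (g y)) x‖ ≤
      ∑ i ∈ Finset.range (n + 1), (n.choose i : ℝ) * ‖iteratedFDeriv ℝ i f x‖ *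
        ‖iteratedFDeriv ℝ (n - i) g x‖ := by
  have h1 := ((cda_nat hf n).eventually (by simp)).and ((cda_nat hg n).eventually (by simp))
  obtain ⟨s, hs, hso, hxs⟩ := eventually_nhds_iff.1 h1
  have := B.norm_iteratedFDerivWithin_le_of_bilinear_of_le_one (s := s) (x := x) (f := f) (g := g)
    (N := n) (fun y hy => (hs y hy).1.contDiffWithinAt) (fun y hy => (hs y hy).2.contDiffWithinAt)
    hso.uniqueDiffOn hxs (n := n) le_rfl hB
  simpa [iteratedFDerivWithin_of_isOpen _ hso hxs] using this

/-- combinatorial inequality -/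
lemma comb1 (k i p : ℕ) (hi : i ≤ k) :
    ((k.choose i : ℝ)) * (i + p)! * (k - i)! ≤ (k + p)! := by
  have h1 : k.choose i * i ! * (k - i)! = k ! := Nat.choose_mul_factorial_mul_factorial hi
  have h2 : (i + p)! = i ! * (i + 1).ascFactorial p := (Nat.factorial_mul_ascFactorial i p).symm
  have h3 : (k + p)! = k ! * (k + 1).ascFactorial p := (Nat.factorial_mul_ascFactorial k p).symm
  have h4 : (i + 1).ascFactorial p ≤ (k + 1).ascFactorial p := by
    clear h1 h2 h3
    induction p with
    | zero => simp
    | succ p ih => rw [Nat.ascFactorial_succ, Nat.ascFactorial_succ]; gcongr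
  have : k.choose i * (i + p)! * (k - i)! ≤ (k + p)! := by
    rw [h2, h3, ← h1]
    calc _ = (k.choose i * i ! * (k - i)!) * (i + 1).ascFactorial p := by ring
      _ ≤ _ := by gcongr
  exact_mod_cast this

lemma geo2 (k : ℕ) : ∑ i ∈ Finset.range (k + 1), ((1:ℝ)/2) ^ (k - i) ≤ 2 := by
  rw [Finset.sum_range_succ_comm, ]
  have : ∀ k : ℕ, ∑ i ∈ Finset.range (k + 1), ((1:ℝ)/2) ^ (k - i) = 2 - (1/2)^k := by
    intro k
    induction k with
    | zero => norm_num
    | succ k ih =>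
      rw [Finset.sum_range_succ]
      have : ∑ x ∈ Finset.range (k + 1), ((1:ℝ) / 2) ^ (k + 1 - x) =
          (∑ x ∈ Finset.range (k + 1), ((1:ℝ) / 2) ^ (k - x)) * (1/2) := by
        rw [Finset.sum_mul]
        refine Finset.sum_congr rfl fun i hi => ?_
        rw [Nat.succ_sub (by simpa [Nat.lt_succ_iff] using hi), pow_succ]
      rw [this, ih]; simp; ring
  have h := this k
  rw [Finset.sum_range_succ_comm] at h
  rw [h]; have : (0:ℝ) < (1/2)^k := by positivity
  linarith

lemma geo4 (k : ℕ) : ∑ i ∈ Finset.range (k + 1), ((k - i : ℕ) + 1 : ℝ) * ((1:ℝ)/2) ^ (k - i) ≤ 4 := by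
  have : ∀ k : ℕ, ∑ i ∈ Finset.range (k + 1), ((i : ℝ) + 1) * ((1:ℝ)/2) ^ i = 4 - (k + 3) * (1/2)^k := by
    intro k
    induction k with
    | zero => norm_num
    | succ k ih => rw [Finset.sum_range_succ, ih, pow_succ]; push_cast; ring
  have h := Finset.sum_range_reflect (fun i : ℕ => ((i : ℝ) + 1) * ((1:ℝ)/2) ^ i) (k + 1)
  simp only [Nat.add_sub_cancel] at h
  have h' : ∑ i ∈ Finset.range (k + 1), ((k - i : ℕ) + 1 : ℝ) * ((1:ℝ)/2) ^ (k - i) =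
     ∑ i ∈ Finset.range (k + 1), ((i : ℝ) + 1) * ((1:ℝ)/2) ^ i := by
    rw [← h]
    try rfl
  rw [h', this]
  have : (0:ℝ) ≤ (k + 3) * (1/2)^k := by positivity
  linarith

/-- Composition bound at a point. -/
lemma comp_bound {M : ℕ → ℝ} (W : Wt M) {B C D Q : ℝ} (hB : 0 ≤ B) (hC : 0 ≤ C) (hD : 0 ≤ D)
    (hQ : 0 < Q) (h1 : 2 * D ≤ Q) (h2 : 4 * B * C * D ≤ Q)
    {g : E → G} {x : E} (hg : ContDiffAt ℝ ∞ g x)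
    (hgb : ∀ j, ‖iteratedFDeriv ℝ (j + 1) g x‖ ≤ C * D ^ (j + 1) * (j + 1)! * M (j + 1)) (k : ℕ) :
    ∀ {F : Type} [NormedAddCommGroup F] [NormedSpace ℝ F] (f : G → F) (p : ℕ) (A : ℝ), 0 ≤ A →
      ContDiffAt ℝ ∞ f (g x) →
      (∀ j, ‖iteratedFDeriv ℝ j f (g x)‖ ≤ A * B ^ j * (j + p)! * M (j + p)) →
      ‖iteratedFDeriv ℝ k (f ∘ g) x‖ ≤ A * Q ^ k * (k + p)! * M (k + p) := by
  induction k using Nat.strong_induction_on with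
  | _ k ih =>
    intro F _ _ f p A hA hf hfb
    rcases k with _ | k
    · have := hfb 0
      simpa using this
    · have e1 : fderiv ℝ (f ∘ g) =ᶠ[𝓝 x]
          fun y => ContinuousLinearMap.compL ℝ E G F ((fderiv ℝ f ∘ g) y) (fderiv ℝ g y) := by
        filter_upwards [cda_ev hg, hg.continuousAt.eventually (cda_ev hf)] with y hy1 hy2
        rw [fderiv_comp y hy2 hy1]; rfl
      rw [← norm_iteratedFDeriv_fderiv, ifd_congr e1]
      refine (bil_bound _ (ContinuousLinearMap.norm_compL_le ℝ E G F)
        ((cda_fderiv hf).comp x hg) (cda_fderiv hg) k).trans ?_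
      have key : ∀ i ∈ Finset.range (k + 1), (k.choose i : ℝ) *
          ‖iteratedFDeriv ℝ i (fderiv ℝ f ∘ g) x‖ * ‖iteratedFDeriv ℝ (k - i) (fderiv ℝ g) x‖ ≤
          (A * Q ^ k * (k + 1 + p)! * M (k + 1 + p) * (B * C * D)) *
            (((k - i : ℕ) + 1 : ℝ) * ((1:ℝ)/2) ^ (k - i)) := by
        intro i hi
        have hik : i ≤ k := by simpa [Nat.lt_succ_iff] using hi
        have b1 := ih i (by omega) (fderiv ℝ f) (p + 1) (A * B) (by positivity) (cda_fderiv hf)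
          (fun j => by
            rw [norm_iteratedFDeriv_fderiv]
            refine (hfb (j + 1)).trans (le_of_eq ?_)
            rw [show j + 1 + p = j + (p + 1) by ring]; ring)
        have b2 : ‖iteratedFDeriv ℝ (k - i) (fderiv ℝ g) x‖ ≤
            C * D ^ (k - i + 1) * (k - i + 1)! * M (k - i + 1) := by
          rw [norm_iteratedFDeriv_fderiv]; exact hgb _
        have hM : M (i + (p + 1)) * M (k - i + 1) ≤ M (k + 1 + p) := by
          have := W.mul_le' (i + p) (k - i)
          rwa [show i + p + (k - i) + 1 = k + 1 + p by omega] at this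
        have hc : (k.choose i : ℝ) * (i + (p + 1))! * (k - i)! ≤ (k + 1 + p)! := by
          have := comb1 k i (p + 1) hik
          rwa [show k + (p + 1) = k + 1 + p by ring] at this
        have hD' : D ^ (k - i) ≤ Q ^ (k - i) * (1 / 2) ^ (k - i) := by
          rw [← mul_pow]; gcongr; linarith
        have hQk : Q ^ i * Q ^ (k - i) = Q ^ k := by rw [← pow_add]; congr 1; omega
        have p1 := W.pos (i + (p + 1))
        have p2 := W.pos (k - i + 1)
        have p3 := W.pos (k + 1 + p)
        calc _ ≤ (k.choose i : ℝ) * (A * B * Q ^ i * (i + (p + 1))! * M (i + (p + 1))) *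
              (C * D ^ (k - i + 1) * (k - i + 1)! * M (k - i + 1)) := by gcongr
          _ = (A * B * C * D) * ((k.choose i : ℝ) * (i + (p + 1))! * (k - i)!) *
              (M (i + (p + 1)) * M (k - i + 1)) * (Q ^ i * D ^ (k - i)) * ((k - i : ℕ) + 1) := by
                rw [Nat.factorial_succ, pow_succ]; push_cast; ring
          _ ≤ (A * B * C * D) * ((k + 1 + p)! : ℝ) * (M (k + 1 + p)) *
              (Q ^ i * (Q ^ (k - i) * (1 / 2) ^ (k - i))) * ((k - i : ℕ) + 1) := by gcongr
          _ = _ := by rw [← mul_assoc (Q ^ i), hQk]; ring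
      refine (Finset.sum_le_sum key).trans ?_
      rw [← Finset.mul_sum]
      have p3 := W.pos (k + 1 + p)
      calc _ ≤ (A * Q ^ k * (k + 1 + p)! * M (k + 1 + p) * (B * C * D)) * 4 := by
            gcongr; exact geo4 k
        _ = (A * Q ^ k * (k + 1 + p)! * M (k + 1 + p)) * (4 * B * C * D) := by ring
        _ ≤ (A * Q ^ k * (k + 1 + p)! * M (k + 1 + p)) * Q := by gcongr
        _ = _ := by ring

end
end QDC

/-! ## Part 2 -/

namespace QDC
open Set Filter Topology
open scoped ContDiff Nat

section
variable {E F G H : Type} [NormedAddCommGroup E] [NormedSpace ℝ E] [NormedAddCommGroup F]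
  [NormedSpace ℝ F] [NormedAddCommGroup G] [NormedSpace ℝ G] [NormedAddCommGroup H] [NormedSpace ℝ H]

/-- Bound for solutions of `Dγ = V ∘ γ`. -/
lemma flow_bound {M : ℕ → ℝ} (W : Wt M) {a b : ℝ} (ha : 0 ≤ a) (hb : 0 < b)
    {γ : E → G} {x : E} (hγ : ContDiffAt ℝ ∞ γ x) {V : G → E →L[ℝ] G}
    (hV : ContDiffAt ℝ ∞ V (γ x)) (e : fderiv ℝ γ =ᶠ[𝓝 x] V ∘ γ)
    (hVb : ∀ j, ‖iteratedFDeriv ℝ j V (γ x)‖ ≤ a * b ^ j * j ! * M j) (k : ℕ) :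
    ∀ {F : Type} [NormedAddCommGroup F] [NormedSpace ℝ F] (f : G → F) (p : ℕ) (A : ℝ), 0 ≤ A →
      ContDiffAt ℝ ∞ f (γ x) →
      (∀ j, ‖iteratedFDeriv ℝ j f (γ x)‖ ≤ A * (2 * b) ^ j * (j + p)! * M (j + p)) →
      ‖iteratedFDeriv ℝ k (f ∘ γ) x‖ ≤ A * (4 * a * b) ^ k * (k + p)! * M (k + p) := by
  induction k with
  | zero =>
    intro F _ _ f p A hA hf hfb
    have := hfb 0
    simpa using this
  | succ k ih =>
    intro F _ _ f p A hA hf hfb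
    have e1 : fderiv ℝ (f ∘ γ) =ᶠ[𝓝 x]
        (fun y => ContinuousLinearMap.compL ℝ E G F (fderiv ℝ f y) (V y)) ∘ γ := by
      filter_upwards [cda_ev hγ, hγ.continuousAt.eventually (cda_ev hf), e] with y hy1 hy2 hy3
      rw [fderiv_comp y hy2 hy1, hy3]; rfl
    rw [← norm_iteratedFDeriv_fderiv, ifd_congr e1]
    have hsm : ContDiffAt ℝ ∞ (fun y => ContinuousLinearMap.compL ℝ E G F (fderiv ℝ f y) (V y)) (γ x) :=
      (ContinuousLinearMap.compL ℝ E G F).isBoundedBilinearMap.contDiff.contDiffAt.comp (γ x)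
        ((cda_fderiv hf).prodMk hV)
    have := ih _ (p + 1) (A * (4 * a * b)) (by positivity) hsm (fun j => ?_)
    · refine this.trans (le_of_eq ?_)
      rw [show k + (p + 1) = k + 1 + p by ring]; ring
    · refine (bil_bound _ (ContinuousLinearMap.norm_compL_le ℝ E G F) (cda_fderiv hf) hV j).trans ?_
      have key : ∀ i ∈ Finset.range (j + 1), (j.choose i : ℝ) *
          ‖iteratedFDeriv ℝ i (fderiv ℝ f) (γ x)‖ * ‖iteratedFDeriv ℝ (j - i) V (γ x)‖ ≤
          (A * (2 * b) ^ (j + 1) * a * (j + (p + 1))! * M (j + (p + 1))) * ((1:ℝ)/2) ^ (j - i) := by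
        intro i hi
        have hik : i ≤ j := by simpa [Nat.lt_succ_iff] using hi
        have b1 := hfb (i + 1)
        rw [← norm_iteratedFDeriv_fderiv] at b1
        have b2 := hVb (j - i)
        have hM : M (i + 1 + p) * M (j - i) ≤ M (j + (p + 1)) := by
          have := W.mul_le (i + 1 + p) (j - i)
          rwa [show i + 1 + p + (j - i) = j + (p + 1) by omega] at this
        have hc : (j.choose i : ℝ) * (i + 1 + p)! * (j - i)! ≤ (j + (p + 1))! := by
          have := comb1 j i (p + 1) hik
          rwa [show i + (p + 1) = i + 1 + p by ring] at this
        have hQk : (2 * b) ^ (j + 1) * (1 / 2) ^ (j - i) = (2 * b) ^ (i + 1) * b ^ (j - i) := by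
          rw [show j + 1 = (i + 1) + (j - i) by omega, pow_add, mul_assoc, ← mul_pow]
          congr 2; ring
        have p1 := W.pos (i + 1 + p)
        have p2 := W.pos (j - i)
        have p3 := W.pos (j + (p + 1))
        calc _ ≤ (j.choose i : ℝ) * (A * (2 * b) ^ (i + 1) * (i + 1 + p)! * M (i + 1 + p)) *
              (a * b ^ (j - i) * (j - i)! * M (j - i)) := by gcongr
          _ = (A * a) * ((j.choose i : ℝ) * (i + 1 + p)! * (j - i)!) *
              (M (i + 1 + p) * M (j - i)) * ((2 * b) ^ (i + 1) * b ^ (j - i)) := by ring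
          _ ≤ (A * a) * ((j + (p + 1))! : ℝ) * (M (j + (p + 1))) *
              ((2 * b) ^ (i + 1) * b ^ (j - i)) := by gcongr
          _ = _ := by rw [← hQk]; ring
      refine (Finset.sum_le_sum key).trans ?_
      rw [← Finset.mul_sum]
      have p3 := W.pos (j + (p + 1))
      calc _ ≤ (A * (2 * b) ^ (j + 1) * a * (j + (p + 1))! * M (j + (p + 1))) * 2 := by
            gcongr; exact geo2 j
        _ = _ := by ring

/-- `f` is a Denjoy-Carleman germ at `x`. -/
def DCAt (M : ℕ → ℝ) (f : E → F) (x : E) : Prop :=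
  ∃ A B : ℝ, 0 ≤ A ∧ 1 ≤ B ∧ ∀ᶠ y in 𝓝 x, ContDiffAt ℝ ∞ f y ∧
    ∀ k, ‖iteratedFDeriv ℝ k f y‖ ≤ A * B ^ k * k ! * M k

variable {M : ℕ → ℝ}

lemma DCAt.cda {f : E → F} {x : E} (h : DCAt M f x) : ContDiffAt ℝ ∞ f x := by
  obtain ⟨A, B, _, _, h⟩ := h
  exact h.self_of_nhds.1

lemma DCAt.cont {f : E → F} {x : E} (h : DCAt M f x) : ContinuousAt f x := h.cda.continuousAt

lemma DCAt.ev {f : E → F} {x : E} (h : DCAt M f x) : ∀ᶠ y in 𝓝 x, DCAt M f y := by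
  obtain ⟨A, B, hA, hB, h⟩ := h
  exact h.eventually_nhds.mono fun y hy => ⟨A, B, hA, hB, hy⟩

lemma DCAt.congr {f g : E → F} {x : E} (h : DCAt M f x) (e : f =ᶠ[𝓝 x] g) : DCAt M g x := by
  obtain ⟨A, B, hA, hB, h⟩ := h
  refine ⟨A, B, hA, hB, ?_⟩
  filter_upwards [h, e.eventually_nhds] with y hy he
  refine ⟨hy.1.congr_of_eventuallyEq (EventuallyEq.symm he), fun k => ?_⟩
  rw [← ifd_congr he]; exact hy.2 k

lemma DCAt.comp (W : Wt M) {f : G → F} {g : E → G} {x : E} (hf : DCAt M f (g x)) (hg : DCAt M g x) :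
    DCAt M (f ∘ g) x := by
  have hc := hg.cont
  obtain ⟨A, B, hA, hB, hf⟩ := hf
  obtain ⟨C, D, hC, hD, hg⟩ := hg
  refine ⟨A, max 1 (max (2 * D) (4 * B * C * D)), hA, le_max_left _ _, ?_⟩
  filter_upwards [hg, hc.eventually hf] with y hy1 hy2
  refine ⟨hy2.1.comp y hy1.1, fun k => ?_⟩
  exact comp_bound W (B := B) (C := C) (D := D) (by linarith) hC (by linarith) (by positivity)
    ((le_max_left _ _).trans (le_max_right _ _)) ((le_max_right _ _).trans (le_max_right _ _))
    hy1.1 (fun j => hy1.2 (j + 1)) k f 0 A hA hy2.1 hy2.2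

lemma DCAt.bil (W : Wt M) (L : F →L[ℝ] G →L[ℝ] H) (hL : ‖L‖ ≤ 1) {f : E → F} {g : E → G} {x : E}
    (hf : DCAt M f x) (hg : DCAt M g x) : DCAt M (fun y => L (f y) (g y)) x := by
  obtain ⟨A, B, hA, hB, hf⟩ := hf
  obtain ⟨C, D, hC, hD, hg⟩ := hg
  refine ⟨A * C, 2 * max B D, by positivity, by linarith [le_max_left B D], ?_⟩
  filter_upwards [hf, hg] with y hy1 hy2
  refine ⟨L.isBoundedBilinearMap.contDiff.contDiffAt.comp y (hy1.1.prodMk hy2.1), fun k => ?_⟩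
  refine (bil_bound L hL hy1.1 hy2.1 k).trans ?_
  have hBD : 0 < max B D := by linarith [le_max_left B D]
  have key : ∀ i ∈ Finset.range (k + 1), (k.choose i : ℝ) *
      ‖iteratedFDeriv ℝ i f y‖ * ‖iteratedFDeriv ℝ (k - i) g y‖ ≤
      A * C * (max B D) ^ k * k ! * M k := by
    intro i hi
    have hik : i ≤ k := by simpa [Nat.lt_succ_iff] using hi
    have hM : M i * M (k - i) ≤ M k := by
      have := W.mul_le i (k - i)
      rwa [show i + (k - i) = k by omega] at this
    have hc : (k.choose i : ℝ) * i ! * (k - i)! ≤ k ! := comb1 k i 0 hik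
    have p1 := W.pos i
    have p2 := W.pos (k - i)
    have p3 := W.pos k
    calc _ ≤ (k.choose i : ℝ) * (A * (max B D) ^ i * i ! * M i) *
          (C * (max B D) ^ (k - i) * (k - i)! * M (k - i)) := by
          have h1 := hy1.2 i
          have h2 := hy2.2 (k - i)
          have h3 : B ≤ max B D := le_max_left _ _
          have h4 : D ≤ max B D := le_max_right _ _
          gcongr
          · exact h1.trans (by gcongr)
          · exact h2.trans (by gcongr)
      _ = (A * C) * ((k.choose i : ℝ) * i ! * (k - i)!) * (M i * M (k - i)) *
          ((max B D) ^ i * (max B D) ^ (k - i)) := by ring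
      _ ≤ (A * C) * (k ! : ℝ) * (M k) * ((max B D) ^ i * (max B D) ^ (k - i)) := by gcongr
      _ = _ := by rw [← pow_add, show i + (k - i) = k by omega]; ring
  refine (Finset.sum_le_sum key).trans ?_
  rw [Finset.sum_const, Finset.card_range, nsmul_eq_mul, mul_pow]
  have p3 := W.pos k
  have : ((k + 1 : ℕ) : ℝ) ≤ 2 ^ k := by exact_mod_cast Nat.lt_two_pow_self
  calc _ ≤ (2 ^ k : ℝ) * (A * C * max B D ^ k * ↑k ! * M k) := by gcongr
    _ = _ := by ring

lemma DCAt.clm_comp (_W : Wt M) (L : F →L[ℝ] G) {f : E → F} {x : E} (hf : DCAt M f x) :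
    DCAt M (fun y => L (f y)) x := by
  obtain ⟨A, B, hA, hB, hf⟩ := hf
  refine ⟨‖L‖ * A, B, by positivity, hB, ?_⟩
  filter_upwards [hf] with y hy
  refine ⟨L.contDiff.contDiffAt.comp y hy.1, fun k => ?_⟩
  refine (L.norm_iteratedFDeriv_comp_left (n := k) (hy.1) (by exact_mod_cast le_top)).trans ?_
  calc _ ≤ ‖L‖ * (A * B ^ k * k ! * M k) := by gcongr; exact hy.2 k
    _ = _ := by ring

lemma DCAt.add (W : Wt M) {f g : E → F} {x : E} (hf : DCAt M f x) (hg : DCAt M g x) :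
    DCAt M (fun y => f y + g y) x := by
  obtain ⟨A, B, hA, hB, hf⟩ := hf
  obtain ⟨C, D, hC, hD, hg⟩ := hg
  refine ⟨A + C, max B D, by positivity, by linarith [le_max_left B D], ?_⟩
  filter_upwards [hf, hg] with y hy1 hy2
  refine ⟨hy1.1.add hy2.1, fun k => ?_⟩
  have : iteratedFDeriv ℝ k (fun y => f y + g y) y = _ :=
    iteratedFDeriv_add_apply (cda_nat hy1.1 k) (cda_nat hy2.1 k)
  rw [this]
  refine (norm_add_le _ _).trans ((add_le_add (hy1.2 k) (hy2.2 k)).trans ?_)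
  have h3 : B ≤ max B D := le_max_left _ _
  have h4 : D ≤ max B D := le_max_right _ _
  have p3 := W.pos k
  calc _ ≤ A * max B D ^ k * k ! * M k + C * max B D ^ k * k ! * M k := by gcongr
    _ = _ := by ring

lemma dc_const (W : Wt M) (c : F) (x : E) : DCAt M (fun _ => c) x := by
  refine ⟨‖c‖, 1, by positivity, le_rfl, Eventually.of_forall fun y => ⟨contDiffAt_const, fun k => ?_⟩⟩
  have p3 := W.pos k
  rcases k with _ | k
  · simp [W.zero]
  · rw [iteratedFDeriv_const_of_ne (by omega)]; simp; positivity

lemma DCAt.of_fderiv (W : Wt M) {f : E → F} {x : E} (hf : ∀ᶠ y in 𝓝 x, ContDiffAt ℝ ∞ f y)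
    (h : DCAt M (fderiv ℝ f) x) : DCAt M f x := by
  obtain ⟨A, B, hA, hB, h⟩ := h
  have hb : ∀ᶠ y in 𝓝 x, ‖f y‖ ≤ ‖f x‖ + 1 := by
    have := hf.self_of_nhds.continuousAt.norm
    exact (this.eventually_lt_const (lt_add_one _)).mono fun _ h => h.le
  refine ⟨max A (‖f x‖ + 1), B, by positivity, hB, ?_⟩
  filter_upwards [hf, h, hb] with y hy1 hy2 hy3
  refine ⟨hy1, fun k => ?_⟩
  rcases k with _ | k
  · simp [W.zero, hy3]
  · rw [← norm_iteratedFDeriv_fderiv]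
    refine (hy2.2 k).trans ?_
    have p3 := W.pos k
    have p4 := W.pos (k + 1)
    have hM : M k ≤ M (k + 1) := by
      have := W.mul_le k 1
      nlinarith [W.one_le 1]
    have hf : ((k ! : ℕ) : ℝ) ≤ (k + 1)! := by exact_mod_cast Nat.factorial_le (by omega)
    gcongr
    · exact le_max_left _ _
    · omega

lemma dc_clm (W : Wt M) (L : E →L[ℝ] F) (x : E) : DCAt M (fun y => L y) x := by
  apply DCAt.of_fderiv W (Eventually.of_forall fun y => L.contDiff.contDiffAt)
  have : fderiv ℝ (fun y => L y) = fun _ => L := by ext1 y; exact L.fderiv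
  rw [this]
  exact dc_const W L x

lemma DCAt.fderiv (W : Wt M) {f : E → F} {x : E} (hf : DCAt M f x) : DCAt M (fderiv ℝ f) x := by
  obtain ⟨A, B, hA, hB, hf⟩ := hf
  obtain ⟨C, hC, hder⟩ := W.der
  refine ⟨A * B, B * C * 2, by positivity, by nlinarith, ?_⟩
  filter_upwards [hf] with y hy
  refine ⟨cda_fderiv hy.1, fun k => ?_⟩
  rw [norm_iteratedFDeriv_fderiv]
  refine (hy.2 (k + 1)).trans ?_
  have : ((k + 1 : ℕ) : ℝ) ≤ 2 ^ k := by exact_mod_cast Nat.lt_two_pow_self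
  have p3 := W.pos k
  have p4 := W.pos (k + 1)
  rw [Nat.factorial_succ]; push_cast at this ⊢
  calc _ ≤ A * B ^ (k + 1) * (2 ^ k * k !) * (C ^ k * M k) := by
        gcongr; exact hder k
    _ = _ := by ring

lemma DCAt.neg (W : Wt M) {f : E → F} {x : E} (hf : DCAt M f x) : DCAt M (fun y => - f y) x := by
  have := hf.clm_comp W (-ContinuousLinearMap.id ℝ F)
  simpa using this

lemma DCAt.sub (W : Wt M) {f g : E → F} {x : E} (hf : DCAt M f x) (hg : DCAt M g x) :
    DCAt M (fun y => f y - g y) x := by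
  simpa [sub_eq_add_neg] using hf.add W (hg.neg W)

lemma DCAt.smul (W : Wt M) {f : E → ℝ} {g : E → F} {x : E} (hf : DCAt M f x) (hg : DCAt M g x) :
    DCAt M (fun y => f y • g y) x :=
  hf.bil W (ContinuousLinearMap.lsmul ℝ ℝ) ContinuousLinearMap.opNorm_lsmul_le hg

lemma DCAt.mul (W : Wt M) {f g : E → ℝ} {x : E} (hf : DCAt M f x) (hg : DCAt M g x) :
    DCAt M (fun y => f y * g y) x := hf.smul W hg

lemma DCAt.pow (W : Wt M) {f : E → ℝ} {x : E} (hf : DCAt M f x) (k : ℕ) :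
    DCAt M (fun y => f y ^ k) x := by
  induction k with
  | zero => simpa using dc_const W (1:ℝ) x
  | succ k ih => simpa [pow_succ] using ih.mul W hf

lemma DCAt.sum (W : Wt M) {ι : Type*} {f : ι → E → F} {x : E} (s : Finset ι)
    (h : ∀ i ∈ s, DCAt M (f i) x) : DCAt M (fun y => ∑ i ∈ s, f i y) x := by
  classical
  induction s using Finset.induction_on with
  | empty => simpa using dc_const W (0:F) x
  | insert a s ha ih =>
    simp only [Finset.sum_insert ha]
    exact (h a (by simp)).add W (ih fun i hi => h i (by simp [hi]))

lemma DCAt.prod (W : Wt M) {ι : Type*} {f : ι → E → ℝ} {x : E} (s : Finset ι)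
    (h : ∀ i ∈ s, DCAt M (f i) x) : DCAt M (fun y => ∏ i ∈ s, f i y) x := by
  classical
  induction s using Finset.induction_on with
  | empty => simpa using dc_const W (1:ℝ) x
  | insert a s ha ih =>
    simp only [Finset.prod_insert ha]
    exact (h a (by simp)).mul W (ih fun i hi => h i (by simp [hi]))

lemma dc_pi (W : Wt M) {n : ℕ} {f : E → Fin n → ℝ} {x : E} (h : ∀ i, DCAt M (fun y => f y i) x) :
    DCAt M f x := by
  have : f = fun y => ∑ i, f y i • (Pi.single i (1:ℝ) : Fin n → ℝ) := by
    ext y j; simp [Finset.sum_apply, Pi.single_apply]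
  rw [this]
  exact DCAt.sum W _ fun i _ => (h i).smul W (dc_const W _ x)

lemma dc_coord (W : Wt M) {n : ℕ} (i : Fin n) (x : Fin n → ℝ) : DCAt M (fun y => y i) x :=
  dc_clm W (ContinuousLinearMap.proj i : (Fin n → ℝ) →L[ℝ] ℝ) x

lemma dc_inv (W : Wt M) {s : ℝ} (hs : s ≠ 0) : DCAt M (fun t : ℝ => t⁻¹) s := by
  have hs' : 0 < |s| / 2 := by positivity
  have hev : ∀ᶠ t in 𝓝 s, |s| / 2 < |t| :=
    continuous_abs.continuousAt.eventually_const_lt (by linarith)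
  refine ⟨(|s|/2)⁻¹, max 1 (|s|/2)⁻¹, by positivity, le_max_left _ _, ?_⟩
  filter_upwards [hev] with t ht
  have ht0 : t ≠ 0 := by rintro rfl; simp at ht; linarith
  refine ⟨contDiffAt_inv ℝ ht0, fun k => ?_⟩
  rw [norm_iteratedFDeriv_eq_norm_iteratedDeriv, iteratedDeriv_eq_iterate]
  have := iter_deriv_inv (𝕜 := ℝ) k t
  rw [show (fun t : ℝ => t⁻¹) = Inv.inv from rfl, this]
  have p := W.one_le k
  have e : ‖(-1 : ℝ) ^ k * (k ! : ℝ) * t ^ (-1 - k : ℤ)‖ = (k ! : ℝ) * (|t|⁻¹) ^ (k + 1) := by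
    rw [norm_mul, norm_mul]
    simp only [norm_pow, norm_neg, norm_one, one_pow, one_mul, RCLike.norm_natCast, norm_zpow]
    congr 1
    rw [show (-1 - k : ℤ) = -((k + 1 : ℕ) : ℤ) by push_cast; ring, zpow_neg, zpow_natCast, inv_pow]
    rfl
  rw [e]
  have h1 : |t|⁻¹ ≤ (|s|/2)⁻¹ := by gcongr
  have h2 : (|s|/2)⁻¹ ≤ max 1 (|s|/2)⁻¹ := le_max_right _ _
  calc (k ! : ℝ) * (|t|⁻¹) ^ (k + 1) ≤ k ! * (((|s|/2)⁻¹) * (max 1 (|s|/2)⁻¹) ^ k) := by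
        rw [pow_succ']; gcongr; exact h1.trans h2
    _ = (|s|/2)⁻¹ * (max 1 (|s|/2)⁻¹) ^ k * k ! * 1 := by ring
    _ ≤ _ := by gcongr

lemma DCAt.inv (W : Wt M) {f : E → ℝ} {x : E} (hf : DCAt M f x) (h0 : f x ≠ 0) :
    DCAt M (fun y => (f y)⁻¹) x := (dc_inv W h0).comp W hf

lemma dc_flow (W : Wt M) {γ : E → G} {x : E} (hγ : ∀ᶠ y in 𝓝 x, ContDiffAt ℝ ∞ γ y)
    {V : G → E →L[ℝ] G} (hV : DCAt M V (γ x)) (e : fderiv ℝ γ =ᶠ[𝓝 x] V ∘ γ) : DCAt M γ x := by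
  have hc := hγ.self_of_nhds.continuousAt
  obtain ⟨a, b, ha, hb, hV⟩ := hV
  obtain ⟨A, B, hA, hB, hi⟩ := dc_clm W (ContinuousLinearMap.id ℝ G) (γ x)
  have hm : 0 < max b B := by linarith [le_max_left b B]
  refine ⟨A, max 1 (4 * a * max b B), hA, le_max_left _ _, ?_⟩
  filter_upwards [hγ, hc.eventually hV, hc.eventually hi, e.eventually_nhds] with y h1 h2 h3 h4
  refine ⟨h1, fun k => ?_⟩
  have := flow_bound W (b := max b B) ha hm h1 h2.1 h4 (fun j => (h2.2 j).trans (by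
      have := W.pos j
      have : b ≤ max b B := le_max_left _ _
      gcongr)) k _ 0 A hA h3.1 (fun j => (h3.2 j).trans (by
      have := W.pos j
      have : B ≤ 2 * max b B := by linarith [le_max_right b B]
      simp only [Nat.add_zero]
      gcongr))
  refine le_trans (le_of_eq rfl) (this.trans ?_)
  simp only [Nat.add_zero]
  have := W.pos k
  have : 4 * a * max b B ≤ max 1 (4 * a * max b B) := le_max_right _ _
  gcongr

end
end QDC

/-! ## Part 3 -/

namespace QDC
open Set Filter Topology
open scoped ContDiff

/-- One-dimensional Denjoy-Carleman theorem (Bang's proof). -/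
lemma bang {a : ℝ} {φ : ℕ → ℝ → ℝ} {m : ℕ → ℝ} (hm : ∀ k, 0 < m k)
    (hlc : ∀ k, m (k+1) / m k ≤ m (k+2) / m (k+1))
    (hns : ¬ Summable fun k => m k / m (k+1))
    (hd : ∀ k, ∀ t ∈ Icc 0 a, HasDerivAt (φ k) (φ (k+1) t) t)
    (hb : ∀ k, ∀ t ∈ Icc 0 a, |φ k t| ≤ m k) (h0 : ∀ k, φ k 0 = 0) :
    ∀ t ∈ Icc 0 a, φ 0 t = 0 := by
  set μ : ℕ → ℝ := fun k => m (k+1) / m k with hμ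
  have hμm : Monotone μ := monotone_nat_of_le_succ hlc
  have hμp : ∀ k, 0 < μ k := fun k => div_pos (hm _) (hm _)
  have hms : ∀ j k, j ≤ k → m (j+1) ≤ m j * μ k := by
    intro j k hjk
    have : m (j+1) = m j * μ j := by simp only [hμ]; field_simp [(hm j).ne']
    rw [this]
    have := hμm hjk
    have := hm j
    gcongr
  have key : ∀ N d k, k + d = N → ∀ y ∈ Icc 0 a,
      y ≤ ∑ i ∈ Finset.Ico k N, (Real.exp 1 * μ i)⁻¹ →
      ∀ j ≤ k, |φ j y| ≤ Real.exp ((j:ℝ) - k) * m j := by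
    intro N d
    induction d with
    | zero =>
      intro k hk y hy hyS j hj
      simp only [add_zero] at hk
      subst hk
      simp at hyS
      have : y = 0 := le_antisymm hyS hy.1
      rw [this, h0]; simp only [abs_zero]
      have := hm j
      positivity
    | succ d ih =>
      intro k hk y hy hyS
      have hkN : k < N := by omega
      rw [Finset.sum_eq_sum_Ico_succ_bot hkN] at hyS
      set h := (Real.exp 1 * μ k)⁻¹ with hh
      have hhp : 0 < h := by have := hμp k; positivity
      set y' := max 0 (y - h) with hy'
      have hy'0 : 0 ≤ y' := le_max_left _ _
      have hy'y : y' ≤ y := max_le hy.1 (by linarith)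
      have hyy : y - y' ≤ h := by linarith [le_max_right 0 (y - h)]
      have hS : y' ≤ ∑ i ∈ Finset.Ico (k+1) N, (Real.exp 1 * μ i)⁻¹ := by
        apply max_le
        · exact Finset.sum_nonneg fun i _ => by have := hμp i; positivity
        · linarith
      have I := ih (k+1) (by omega) y' ⟨hy'0, hy'y.trans hy.2⟩ hS
      have key2 : ∀ e j, j + e = k + 1 → ∀ t ∈ Icc y' y,
          ‖φ j t‖ ≤ Real.exp ((j:ℝ) - (k + 1 : ℕ)) * m j * Real.exp (Real.exp 1 * μ k * (t - y')) := by
        intro e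
        induction e with
        | zero =>
          intro j hj t ht
          simp only [add_zero] at hj
          subst hj
          have hp := hm (k+1)
          have := hb (k+1) t ⟨hy'0.trans ht.1, ht.2.trans hy.2⟩
          have h1 : 1 ≤ Real.exp (Real.exp 1 * μ k * (t - y')) := by
            apply Real.one_le_exp
            have := hμp k
            have : 0 ≤ t - y' := by linarith [ht.1]
            positivity
          rw [Real.norm_eq_abs]
          simp only [sub_self, Real.exp_zero, one_mul]
          nlinarith
        | succ e ihe =>
          intro j hj
          apply image_norm_le_of_norm_deriv_right_le_deriv_boundary
            (f := φ j) (f' := φ (j+1))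
            (B := fun t => Real.exp ((j:ℝ) - (k + 1 : ℕ)) * m j * Real.exp (Real.exp 1 * μ k * (t - y')))
            (B' := fun t => Real.exp ((j:ℝ) - (k + 1 : ℕ)) * m j * (Real.exp (Real.exp 1 * μ k * (t - y')) * (Real.exp 1 * μ k)))
          · intro t ht
            exact (hd j t ⟨hy'0.trans ht.1, ht.2.trans hy.2⟩).continuousAt.continuousWithinAt
          · intro t ht
            exact (hd j t ⟨hy'0.trans ht.1, ht.2.le.trans hy.2⟩).hasDerivWithinAt
          · have := I j (by omega)
            simpa using this
          · intro t
            apply HasDerivAt.const_mul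
            apply HasDerivAt.exp
            have := ((hasDerivAt_id t).sub_const y').const_mul (Real.exp 1 * μ k)
            simpa using this
          · intro t ht
            refine (ihe (j+1) (by omega) t ⟨ht.1, ht.2.le⟩).trans ?_
            have h2 := hms j k (by omega)
            have hp := hm j
            calc _ ≤ Real.exp (((j+1 : ℕ):ℝ) - (k + 1 : ℕ)) * (m j * μ k) * Real.exp (Real.exp 1 * μ k * (t - y')) := by gcongr
              _ = _ := by
                rw [show (((j+1 : ℕ):ℝ) - (k + 1 : ℕ)) = ((j:ℝ) - (k+1:ℕ)) + 1 by push_cast; ring, Real.exp_add]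
                ring
      intro j hj
      have := key2 (k + 1 - j) j (by omega) y ⟨hy'y, le_rfl⟩
      rw [Real.norm_eq_abs] at this
      refine this.trans ?_
      have h3 : Real.exp 1 * μ k * (y - y') ≤ 1 := by
        have hp : 0 < Real.exp 1 * μ k := by have := hμp k; positivity
        calc _ ≤ Real.exp 1 * μ k * h := by gcongr
          _ = 1 := mul_inv_cancel₀ hp.ne'
      have hp := hm j
      calc _ ≤ Real.exp ((j:ℝ) - (k + 1 : ℕ)) * m j * Real.exp 1 := by gcongr
        _ = _ := by
          rw [show ((j:ℝ) - k) = ((j:ℝ) - (k+1:ℕ)) + 1 by push_cast; ring, Real.exp_add]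
          ring
  intro y hy
  have hk : ∀ k : ℕ, |φ 0 y| ≤ Real.exp (-(k:ℝ)) * m 0 := by
    intro k
    have hns' : ¬ Summable (fun i => (Real.exp 1 * μ (i + k))⁻¹) := by
      intro hs
      apply hns
      rw [← summable_nat_add_iff k]
      have := hs.mul_left (Real.exp 1)
      refine this.congr fun i => ?_
      simp only [hμ]
      have := (hm (i+k)).ne'
      have := (hm (i+k+1)).ne'
      field_simp
    have ht := (not_summable_iff_tendsto_nat_atTop_of_nonneg (fun i => by have := hμp (i+k); positivity)).1 hns'
    obtain ⟨d, hd⟩ := (ht.eventually_ge_atTop y).exists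
    have := key (k + d) d k rfl y hy (by
      rw [Finset.sum_Ico_eq_sum_range]
      simpa [add_comm] using hd) 0 (by omega)
    simpa using this
  have hl : Tendsto (fun k : ℕ => Real.exp (-(k:ℝ)) * m 0) atTop (𝓝 (0 * m 0)) := by
    apply Tendsto.mul_const
    exact Real.tendsto_exp_neg_atTop_nhds_zero.comp tendsto_natCast_atTop_atTop
  rw [zero_mul] at hl
  have := ge_of_tendsto' hl hk
  simpa using this


lemma fam_littleO {δ : ℝ} (hδ : 0 < δ) (k : ℕ) : ∀ φ : ℕ → ℝ → ℝ,
    (∀ k, ∀ t, |t| < δ → HasDerivAt (φ k) (φ (k+1) t) t) → (∀ i < k, φ i 0 = 0) →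
    (fun s => φ 0 s - φ k 0 * s ^ k / (k.factorial : ℝ)) =o[𝓝 0] fun s : ℝ => s ^ k := by
  induction k with
  | zero =>
    intro φ hd _
    simp only [pow_zero, Nat.factorial_zero, Nat.cast_one, mul_one, div_one]
    rw [Asymptotics.isLittleO_one_iff]
    have := (hd 0 0 (by simpa using hδ)).continuousAt
    simpa using Tendsto.sub_const this (φ 0 0)
  | succ k ih =>
    intro φ hd h0
    have h1 := ih (fun i => φ (i+1)) (fun k t ht => hd (k+1) t ht) (fun i hi => h0 (i+1) (by omega))
    rw [Asymptotics.isLittleO_iff] at h1 ⊢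
    intro c hc
    obtain ⟨ε, hε, hb⟩ := Metric.eventually_nhds_iff.1 (h1 hc)
    rw [Metric.eventually_nhds_iff]
    refine ⟨min ε δ, lt_min hε hδ, fun s hs => ?_⟩
    simp only [dist_zero_right, Real.norm_eq_abs, lt_min_iff] at hs
    have hder : ∀ t ∈ Metric.closedBall (0:ℝ) |s|, HasDerivWithinAt
        (fun s => φ 0 s - φ (k+1) 0 * s ^ (k+1) / ((k+1).factorial : ℝ))
        (φ 1 t - φ (k+1) 0 * t ^ k / (k.factorial : ℝ)) (Metric.closedBall (0:ℝ) |s|) t := by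
      intro t ht
      have ht' : |t| ≤ |s| := by simpa using ht
      apply HasDerivAt.hasDerivWithinAt
      apply (hd 0 t (by linarith)).sub
      have := ((hasDerivAt_pow (k+1) t).const_mul (φ (k+1) 0)).div_const ((k+1).factorial : ℝ)
      refine this.congr_deriv ?_
      rw [Nat.factorial_succ]
      have : ((k:ℝ) + 1) ≠ 0 := by positivity
      push_cast
      field_simp
    have hbd : ∀ t ∈ Metric.closedBall (0:ℝ) |s|, ‖φ 1 t - φ (k+1) 0 * t ^ k / (k.factorial : ℝ)‖ ≤ c * |s| ^ k := by
      intro t ht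
      have ht' : |t| ≤ |s| := by simpa using ht
      have := hb (y := t) (by simp; linarith)
      refine this.trans ?_
      rw [norm_pow, Real.norm_eq_abs]
      gcongr
    have := (convex_closedBall (0:ℝ) |s|).norm_image_sub_le_of_norm_hasDerivWithin_le hder hbd
      (Metric.mem_closedBall_self (abs_nonneg s)) (y := s) (by simp)
    simp only [h0 0 (by omega), ne_eq, Nat.add_eq_zero_iff, one_ne_zero, and_false, not_false_eq_true, zero_pow, mul_zero, zero_div, sub_zero] at this
    refine this.trans (le_of_eq ?_)
    rw [norm_pow, Real.norm_eq_abs, pow_succ]; ring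

lemma fam_order {δ : ℝ} (hδ : 0 < δ) {φ : ℕ → ℝ → ℝ}
    (hd : ∀ k, ∀ t, |t| < δ → HasDerivAt (φ k) (φ (k+1) t) t)
    (hO : ∀ d : ℕ, φ 0 =O[𝓝 0] fun s : ℝ => s ^ (d+1)) (k : ℕ) : φ k 0 = 0 := by
  induction k using Nat.strong_induction_on with
  | _ k ih =>
    have h1 := fam_littleO hδ k φ hd ih
    have h2 : (fun s : ℝ => s ^ (k+1)) =o[𝓝 0] fun s : ℝ => s ^ k :=
      Asymptotics.isLittleO_pow_pow (by omega)
    have h3 := ((hO k).trans_isLittleO h2).sub h1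
    have h4 : (fun s : ℝ => (φ k 0 / k.factorial) * s ^ k) =o[𝓝 0] fun s : ℝ => s ^ k := by
      refine h3.congr_left fun s => ?_
      ring
    by_contra hne
    have hc : φ k 0 / k.factorial ≠ 0 := by positivity
    rw [Asymptotics.isLittleO_const_mul_left_iff hc] at h4
    have h5 : (fun s : ℝ => s ^ k) =o[𝓝[≠] 0] fun s : ℝ => s ^ k := h4.mono nhdsWithin_le_nhds
    have := (Asymptotics.isLittleO_irrefl' (f' := fun s : ℝ => s ^ k) (l := 𝓝[≠] (0:ℝ)) ?_)
    · exact this (h5)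
    · apply Filter.Eventually.frequently
      filter_upwards [self_mem_nhdsWithin] with s hs
      have : s ≠ 0 := hs
      exact norm_ne_zero_iff.2 (pow_ne_zero _ this)

section
variable {E : Type} [NormedAddCommGroup E] [NormedSpace ℝ E] {M : ℕ → ℝ}

lemma line_hasDeriv {f : E → ℝ} {p v : E} {t : ℝ} (h : ContDiffAt ℝ ∞ f (p + t • v)) (k : ℕ) :
    HasDerivAt (fun t : ℝ => iteratedFDeriv ℝ k f (p + t • v) (fun _ => v))
      (iteratedFDeriv ℝ (k+1) f (p + t • v) (fun _ => v)) t := by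
  have h1 : DifferentiableAt ℝ (iteratedFDeriv ℝ k f) (p + t • v) := by
    have : ContDiffAt ℝ 1 (iteratedFDeriv ℝ k f) (p + t • v) :=
      h.iteratedFDeriv_right (by
        have : ((1 + k : ℕ) : WithTop ℕ∞) ≤ ∞ := by exact_mod_cast le_top
        simpa using this)
    exact this.differentiableAt (by simp)
  have h2 : HasDerivAt (fun t : ℝ => p + t • v) v t := by
    have := ((hasDerivAt_id t).smul_const v).const_add p
    simpa using this
  have h3 := h1.hasFDerivAt.comp_hasDerivAt t h2
  have h4 := ((ContinuousMultilinearMap.apply ℝ (fun _ : Fin k => E) ℝ (fun _ => v)).hasFDerivAt).comp_hasDerivAt t h3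
  refine h4.congr_deriv ?_
  rw [iteratedFDeriv_succ_apply_left]
  rfl

lemma line_zero (W : Wt M) {f : E → ℝ} {p v : E} {A B : ℝ} (hA : 0 ≤ A) (hB : 1 ≤ B)
    (h : ∀ t ∈ Icc (0:ℝ) 1, ContDiffAt ℝ ∞ f (p + t • v) ∧
      ∀ k, ‖iteratedFDeriv ℝ k f (p + t • v)‖ ≤ A * B ^ k * k.factorial * M k)
    (h0 : ∀ k, iteratedFDeriv ℝ k f p (fun _ => v) = 0) : f (p + v) = 0 := by
  set D := B * (1 + ‖v‖) with hD
  have hDp : 0 < D := by positivity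
  have hp := fun k => W.pos k
  have := bang (a := 1) (φ := fun k t => iteratedFDeriv ℝ k f (p + t • v) (fun _ => v))
    (m := fun k => (A + 1) * D ^ k * k.factorial * M k) (fun k => by have := hp k; positivity)
    (fun k => ?_) ?_ (fun k t ht => line_hasDeriv (h t ht).1 k) (fun k t ht => ?_) (fun k => ?_) 1 (by simp)
  · simpa using this
  · rw [div_le_div_iff₀ (by have := hp k; positivity) (by have := hp (k+1); positivity)]
    have hl := W.lc k
    have := hp k
    have := hp (k+1)
    have := hp (k+2)
    have e1 : ((k+1).factorial : ℝ) = (k+1) * k.factorial := by rw [Nat.factorial_succ]; push_cast; ring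
    have e2 : ((k+2).factorial : ℝ) = (k+2) * ((k+1) * k.factorial) := by
      rw [Nat.factorial_succ, Nat.factorial_succ]; push_cast; ring
    rw [e1, e2]
    calc _ = ((A+1)^2 * D^(2*k+2) * (k.factorial:ℝ)^2 * (k+1)) * (((k:ℝ)+1) * (M (k+1) * M (k+1))) := by ring
      _ ≤ ((A+1)^2 * D^(2*k+2) * (k.factorial:ℝ)^2 * (k+1)) * (((k:ℝ)+2) * (M k * M (k+2))) := by
        gcongr; norm_num
      _ = _ := by ring
  · intro hs
    apply W.ns
    refine (hs.mul_left D).congr fun k => ?_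
    have := hp k
    have := hp (k+1)
    have e1 : ((k+1).factorial : ℝ) = (k+1) * k.factorial := by rw [Nat.factorial_succ]; push_cast; ring
    rw [e1]
    field_simp
    ring
  · refine ((iteratedFDeriv ℝ k f (p + t • v)).le_opNorm (fun _ => v)).trans ?_
    simp only [Finset.prod_const, Finset.card_univ, Fintype.card_fin]
    have h1 := (h t ht).2 k
    have := hp k
    calc _ ≤ (A * B ^ k * k.factorial * M k) * (1 + ‖v‖) ^ k := by gcongr; linarith
      _ = A * D ^ k * k.factorial * M k := by rw [hD, mul_pow]; ring
      _ ≤ _ := by gcongr; linarith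
  · simpa using h0 k

/-- quasianalyticity: near `x`, a DC function which vanishes near a close point vanishes near `x` -/
lemma DCAt.qa (W : Wt M) {f : E → ℝ} {x : E} (hf : DCAt M f x)
    (h : ∃ᶠ p in 𝓝 x, f =ᶠ[𝓝 p] 0) : f =ᶠ[𝓝 x] 0 := by
  obtain ⟨A, B, hA, hB, hf⟩ := hf
  obtain ⟨r, hr, hb⟩ := Metric.eventually_nhds_iff_ball.1 hf
  obtain ⟨p, hp, hpx⟩ := (h.and_eventually (Metric.ball_mem_nhds x hr)).exists
  filter_upwards [Metric.ball_mem_nhds x hr] with y hy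
  have := line_zero W (p := p) (v := y - p) hA hB (fun t ht => hb _ ?_) (fun k => ?_)
  · simpa using this
  · exact (convex_ball x r).add_smul_sub_mem hpx hy ht
  · rw [ifd_congr hp]
    have : iteratedFDeriv ℝ k (0 : E → ℝ) p = 0 := by
      have := iteratedFDeriv_fun_zero (𝕜 := ℝ) (E := E) (F := ℝ) (n := k)
      exact congrFun this p
    rw [this]; rfl

lemma DCAt.mul_ne (W : Wt M) {f g : E → ℝ} {x : E} (hf : DCAt M f x) (hg : DCAt M g x)
    (hf0 : ¬ f =ᶠ[𝓝 x] 0) (hg0 : ¬ g =ᶠ[𝓝 x] 0) : ¬ (fun y => f y * g y) =ᶠ[𝓝 x] 0 := by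
  intro h
  apply hf0
  apply hf.qa W
  have h1 : ∃ᶠ y in 𝓝 x, g y ≠ 0 := fun h => hg0 (h.mono fun y hy => not_not.1 hy)
  refine (h1.and_eventually (h.eventually_nhds.and hg.ev)).mono ?_
  rintro y ⟨hy, h2, h3⟩
  filter_upwards [h2, h3.cont.eventually_ne hy] with z hz1 hz2
  have : f z * g z = 0 := hz1
  simpa [hz2] using this

lemma DCAt.prod_ne (W : Wt M) {ι : Type*} {f : ι → E → ℝ} {x : E} (s : Finset ι)
    (h : ∀ i ∈ s, DCAt M (f i) x) (h0 : ∀ i ∈ s, ¬ f i =ᶠ[𝓝 x] 0) :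
    ¬ (fun y => ∏ i ∈ s, f i y) =ᶠ[𝓝 x] 0 := by
  classical
  induction s using Finset.induction_on with
  | empty =>
    intro h
    have := h.self_of_nhds
    simp at this
  | insert a s ha ih =>
    simp only [Finset.prod_insert ha]
    exact (h a (by simp)).mul_ne W (DCAt.prod W s fun i hi => h i (by simp [hi])) (h0 a (by simp))
      (ih (fun i hi => h i (by simp [hi])) (fun i hi => h0 i (by simp [hi])))

/-- there is a radius on which rays of infinite order vanishing force zeros -/
lemma DCAt.ray (W : Wt M) {f : E → ℝ} (hf : DCAt M f 0) :
    ∀ᶠ x in 𝓝 (0:E), (∀ d : ℕ, (fun s : ℝ => f (s • x)) =O[𝓝 0] fun s : ℝ => s ^ (d+1)) → f x = 0 := by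
  obtain ⟨A, B, hA, hB, hf⟩ := hf
  obtain ⟨r, hr, hb⟩ := Metric.eventually_nhds_iff_ball.1 hf
  filter_upwards [Metric.ball_mem_nhds 0 hr] with x hx hO
  have hx' : ‖x‖ < r := by simpa using hx
  have := line_zero W (p := 0) (v := x) hA hB (fun t ht => hb _ ?_) (fun k => ?_)
  · simpa using this
  · simp only [zero_add, Metric.mem_ball, dist_zero_right, norm_smul, Real.norm_eq_abs, abs_of_nonneg ht.1]
    nlinarith [norm_nonneg x, ht.2]
  · have h0 := hb 0 (Metric.mem_ball_self hr)
    have hc : Tendsto (fun t : ℝ => (0:E) + t • x) (𝓝 0) (𝓝 0) := by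
      have : Continuous (fun t : ℝ => (0:E) + t • x) := by fun_prop
      simpa using this.tendsto 0
    obtain ⟨δ, hδ, hd⟩ := Metric.eventually_nhds_iff.1 (hc.eventually hf)
    have := fam_order hδ (φ := fun k t => iteratedFDeriv ℝ k f (0 + t • x) (fun _ => x))
      (fun k t ht => line_hasDeriv (hd (by simpa using ht)).1 k) (fun d => by simpa using hO d) k
    simpa using this
end
end QDC

/-! ## Part 4 -/

namespace QDC
open Set Filter Topology
open scoped ContDiff

section
variable {E F G : Type} [NormedAddCommGroup E] [NormedSpace ℝ E] [NormedAddCommGroup F]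
  [NormedSpace ℝ F] [NormedAddCommGroup G] [NormedSpace ℝ G]

noncomputable def avg (L : ℝ → E →L[ℝ] E) (K : ℝ → F →L[ℝ] G) (f : E → F) (x : E) : G :=
  ∫ t in (0:ℝ)..1, K t (f (L t x))

noncomputable def avgK (L : ℝ → E →L[ℝ] E) (K : ℝ → F →L[ℝ] G) (t : ℝ) : (E →L[ℝ] F) →L[ℝ] (E →L[ℝ] G) :=
  (ContinuousLinearMap.compL ℝ E F G (K t)).comp ((ContinuousLinearMap.compL ℝ E E F).flip (L t))

lemma avgK_cont {L : ℝ → E →L[ℝ] E} {K : ℝ → F →L[ℝ] G} (hL : Continuous L) (hK : Continuous K) :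
    Continuous (avgK L K) := by
  unfold avgK
  fun_prop

lemma avgK_norm {L : ℝ → E →L[ℝ] E} {K : ℝ → F →L[ℝ] G} {t : ℝ} (hL : ‖L t‖ ≤ 1) (hK : ‖K t‖ ≤ 1) :
    ‖avgK L K t‖ ≤ 1 := by
  apply ContinuousLinearMap.opNorm_le_bound _ zero_le_one
  intro A
  show ‖(K t).comp (A.comp (L t))‖ ≤ 1 * ‖A‖
  calc _ ≤ ‖K t‖ * (‖A‖ * ‖L t‖) := by
        refine (ContinuousLinearMap.opNorm_comp_le _ _).trans ?_
        gcongr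
        exact ContinuousLinearMap.opNorm_comp_le _ _
    _ ≤ 1 * (‖A‖ * 1) := by gcongr
    _ = _ := by ring

lemma avg_mem {L : ℝ → E →L[ℝ] E} (hL1 : ∀ t ∈ Icc (0:ℝ) 1, ‖L t‖ ≤ 1) {r : ℝ}
    {x : E} (hx : x ∈ Metric.ball (0:E) r) {t : ℝ} (ht : t ∈ Icc (0:ℝ) 1) :
    L t x ∈ Metric.ball (0:E) r := by
  simp only [Metric.mem_ball, dist_zero_right] at hx ⊢
  calc _ ≤ ‖L t‖ * ‖x‖ := (L t).le_opNorm x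
    _ ≤ 1 * ‖x‖ := by gcongr; exact hL1 t ht
    _ < r := by simpa using hx

lemma avg_contOn {L : ℝ → E →L[ℝ] E} (hL : Continuous L) (hL1 : ∀ t ∈ Icc (0:ℝ) 1, ‖L t‖ ≤ 1)
    {K : ℝ → F →L[ℝ] G} (hK : Continuous K) {r : ℝ} {f : E → F}
    (hf : ∀ y ∈ Metric.ball (0:E) r, ContDiffAt ℝ ∞ f y) {x : E} (hx : x ∈ Metric.ball (0:E) r) :
    ContinuousOn (fun t => K t (f (L t x))) (Icc 0 1) := by
  have h1 : ContinuousOn (fun t => f (L t x)) (Icc 0 1) := by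
    intro t ht
    have h2 := (hf _ (avg_mem hL1 hx ht)).continuousAt
    have h3 : ContinuousAt (fun t => L t x) t := by fun_prop
    exact (ContinuousAt.comp (f := fun t => L t x) h2 h3).continuousWithinAt
  exact hK.continuousOn.clm_apply h1

lemma avg_deriv [CompleteSpace G] {L : ℝ → E →L[ℝ] E} (hL : Continuous L) (hL1 : ∀ t ∈ Icc (0:ℝ) 1, ‖L t‖ ≤ 1)
    {K : ℝ → F →L[ℝ] G} (hK : Continuous K) (hK1 : ∀ t ∈ Icc (0:ℝ) 1, ‖K t‖ ≤ 1) {r C : ℝ} {f : E → F}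
    (hf : ∀ y ∈ Metric.ball (0:E) r, ContDiffAt ℝ ∞ f y)
    (hb : ∀ y ∈ Metric.ball (0:E) r, ‖fderiv ℝ f y‖ ≤ C) {x : E} (hx : x ∈ Metric.ball (0:E) r) :
    HasFDerivAt (avg L K f) (avg L (avgK L K) (fderiv ℝ f) x) x := by
  have hI : uIoc (0:ℝ) 1 ⊆ Icc 0 1 := by rw [uIoc_of_le zero_le_one]; exact Ioc_subset_Icc_self
  have hs := Metric.isOpen_ball.mem_nhds hx
  have hf' : ∀ y ∈ Metric.ball (0:E) r, ContDiffAt ℝ ∞ (fderiv ℝ f) y := fun y hy => cda_fderiv (hf y hy)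
  apply intervalIntegral.hasFDerivAt_integral_of_dominated_of_fderiv_le (bound := fun _ => C) hs
    (F' := fun x t => avgK L K t (fderiv ℝ f (L t x)))
  · filter_upwards [hs] with y hy
    exact ((avg_contOn hL hL1 hK hf hy).mono hI).aestronglyMeasurable measurableSet_uIoc
  · apply ContinuousOn.intervalIntegrable
    rw [uIcc_of_le zero_le_one]
    exact avg_contOn hL hL1 hK hf hx
  · exact ((avg_contOn hL hL1 (avgK_cont hL hK) hf' hx).mono hI).aestronglyMeasurable measurableSet_uIoc
  · refine Eventually.of_forall fun t ht y hy => ?_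
    refine ((avgK L K t).le_opNorm _).trans ?_
    calc _ ≤ 1 * C := by
          gcongr
          · exact avgK_norm (hL1 t (hI ht)) (hK1 t (hI ht))
          · exact hb _ (avg_mem hL1 hy (hI ht))
      _ = C := one_mul C
  · exact intervalIntegrable_const
  · refine Eventually.of_forall fun t ht y hy => ?_
    have h1 := (cda_diff (hf _ (avg_mem hL1 hy (hI ht)))).hasFDerivAt
    exact (K t).hasFDerivAt.comp y (h1.comp y (L t).hasFDerivAt)

lemma avg_bound {L : ℝ → E →L[ℝ] E} (hL : Continuous L) (hL1 : ∀ t ∈ Icc (0:ℝ) 1, ‖L t‖ ≤ 1) {r : ℝ} (k : ℕ) :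
    ∀ {F G : Type} [NormedAddCommGroup F] [NormedSpace ℝ F] [NormedAddCommGroup G] [NormedSpace ℝ G]
    [CompleteSpace G]
    {K : ℝ → F →L[ℝ] G} (_ : Continuous K) (_ : ∀ t ∈ Icc (0:ℝ) 1, ‖K t‖ ≤ 1) {C : ℕ → ℝ} {f : E → F}
    (_ : ∀ y ∈ Metric.ball (0:E) r, ContDiffAt ℝ ∞ f y)
    (_ : ∀ j, ∀ y ∈ Metric.ball (0:E) r, ‖iteratedFDeriv ℝ j f y‖ ≤ C j),
    (∀ x ∈ Metric.ball (0:E) r, ContDiffAt ℝ k (avg L K f) x ∧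
    ‖iteratedFDeriv ℝ k (avg L K f) x‖ ≤ C k) := by
  induction k with
  | zero =>
    intro F G _ _ _ _ _ K hK hK1 C f hf hb x hx
    have hb1 : ∀ y ∈ Metric.ball (0:E) r, ‖fderiv ℝ f y‖ ≤ C 1 := fun y hy => by
      have := hb 1 y hy
      rwa [← norm_iteratedFDeriv_fderiv, norm_iteratedFDeriv_zero] at this
    constructor
    · rw [Nat.cast_zero, contDiffAt_zero]
      refine ⟨_, Metric.isOpen_ball.mem_nhds hx, fun y hy => ?_⟩
      exact (avg_deriv hL hL1 hK hK1 hf hb1 hy).continuousAt.continuousWithinAt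
    · rw [norm_iteratedFDeriv_zero]
      have := intervalIntegral.norm_integral_le_of_norm_le_const (a := (0:ℝ)) (b := 1) (C := C 0)
        (f := fun t => K t (f (L t x))) (fun t ht => ?_)
      · simpa [avg] using this
      · have ht' : t ∈ Icc (0:ℝ) 1 := by
          rw [uIoc_of_le zero_le_one] at ht; exact Ioc_subset_Icc_self ht
        refine ((K t).le_opNorm _).trans ?_
        have h1 := hb 0 _ (avg_mem hL1 hx ht')
        rw [norm_iteratedFDeriv_zero] at h1
        calc _ ≤ 1 * C 0 := by gcongr; exact hK1 t ht'
          _ = _ := one_mul _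
  | succ k ih =>
    intro F G _ _ _ _ _ K hK hK1 C f hf hb x hx
    have hb1 : ∀ y ∈ Metric.ball (0:E) r, ‖fderiv ℝ f y‖ ≤ C 1 := fun y hy => by
      have := hb 1 y hy
      rwa [← norm_iteratedFDeriv_fderiv, norm_iteratedFDeriv_zero] at this
    have hd := fun y (hy : y ∈ Metric.ball (0:E) r) => avg_deriv hL hL1 hK hK1 hf hb1 hy
    have I := ih (avgK_cont hL hK) (fun t ht => avgK_norm (hL1 t ht) (hK1 t ht)) (C := fun j => C (j+1))
      (f := fderiv ℝ f) (fun y hy => cda_fderiv (hf y hy))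
      (fun j y hy => by rw [norm_iteratedFDeriv_fderiv]; exact hb (j+1) y hy) x hx
    constructor
    · have : ((k + 1 : ℕ) : WithTop ℕ∞) = (k : WithTop ℕ∞) + 1 := by norm_cast
      rw [this, contDiffAt_succ_iff_hasFDerivAt]
      exact ⟨_, ⟨_, Metric.isOpen_ball.mem_nhds hx, hd⟩, I.1⟩
    · have e : fderiv ℝ (avg L K f) =ᶠ[𝓝 x] avg L (avgK L K) (fderiv ℝ f) := by
        filter_upwards [Metric.isOpen_ball.mem_nhds hx] with y hy
        exact (hd y hy).fderiv
      rw [← norm_iteratedFDeriv_fderiv, ifd_congr e]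
      exact I.2

lemma DCAt.avg {M : ℕ → ℝ} [CompleteSpace F] {L : ℝ → E →L[ℝ] E} (hL : Continuous L) (hL1 : ∀ t ∈ Icc (0:ℝ) 1, ‖L t‖ ≤ 1)
    {f : E → F} (hf : DCAt M f 0) : DCAt M (fun x => ∫ t in (0:ℝ)..1, f (L t x)) 0 := by
  obtain ⟨A, B, hA, hB, hf⟩ := hf
  obtain ⟨r, hr, hb⟩ := Metric.eventually_nhds_iff_ball.1 hf
  refine ⟨A, B, hA, hB, ?_⟩
  filter_upwards [Metric.ball_mem_nhds 0 hr] with y hy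
  have := fun k => avg_bound hL hL1 (r := r) k (K := fun _ => ContinuousLinearMap.id ℝ F) continuous_const
    (fun t _ => ContinuousLinearMap.norm_id_le) (C := fun k => A * B ^ k * k.factorial * M k) (f := f)
    (fun y hy => (hb y hy).1) (fun j y hy => (hb y hy).2 j) y hy
  refine ⟨contDiffAt_infty.2 fun k => (this k).1, fun k => (this k).2⟩
end

section
variable {n : ℕ} {M : ℕ → ℝ}

/-- scaling the `j`-th coordinate by `t` -/
noncomputable def scl (j : Fin n) (t : ℝ) : (Fin n → ℝ) →L[ℝ] (Fin n → ℝ) :=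
  ContinuousLinearMap.id ℝ _ + (t - 1) • (ContinuousLinearMap.proj j : (Fin n → ℝ) →L[ℝ] ℝ).smulRight (Pi.single j (1:ℝ) : Fin n → ℝ)

lemma scl_apply (j : Fin n) (t : ℝ) (x : Fin n → ℝ) : scl j t x = Function.update x j (t * x j) := by
  ext i
  by_cases h : i = j
  · subst h; simp [scl]; ring
  · simp [scl, h]

lemma scl_cont (j : Fin n) : Continuous (scl j) := by unfold scl; fun_prop

lemma scl_norm (j : Fin n) {t : ℝ} (ht : t ∈ Icc (0:ℝ) 1) : ‖scl j t‖ ≤ 1 := by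
  apply ContinuousLinearMap.opNorm_le_bound _ zero_le_one
  intro x
  rw [one_mul, scl_apply, pi_norm_le_iff_of_nonneg (norm_nonneg x)]
  intro i
  by_cases h : i = j
  · subst h
    simp only [Function.update_self, norm_mul, Real.norm_eq_abs, abs_of_nonneg ht.1]
    have := norm_le_pi_norm x i
    rw [Real.norm_eq_abs] at this
    nlinarith [abs_nonneg (x i), ht.2]
  · simp only [ne_eq, h, not_false_eq_true, Function.update_of_ne]
    exact norm_le_pi_norm x i

/-- Division by a coordinate. -/
lemma dc_divide (W : Wt M) {f : (Fin n → ℝ) → ℝ} (hf : DCAt M f 0) (j : Fin n)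
    (h0 : ∀ᶠ x in 𝓝 0, x j = 0 → f x = 0) :
    ∃ g : (Fin n → ℝ) → ℝ, DCAt M g 0 ∧ f =ᶠ[𝓝 0] fun x => x j * g x := by
  have hd : DCAt M (fun x => fderiv ℝ f x (Pi.single j 1)) 0 :=
    (hf.fderiv W).clm_comp W (ContinuousLinearMap.apply ℝ ℝ (Pi.single j (1:ℝ) : Fin n → ℝ))
  refine ⟨_, hd.avg (scl_cont j) (fun t ht => scl_norm j ht), ?_⟩
  obtain ⟨r, hr, hb⟩ := Metric.eventually_nhds_iff_ball.1 (hf.ev.and h0)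
  filter_upwards [Metric.ball_mem_nhds 0 hr] with x hx
  have hm : ∀ t ∈ Icc (0:ℝ) 1, scl j t x ∈ Metric.ball (0:Fin n → ℝ) r :=
    fun t ht => avg_mem (fun t ht => scl_norm j ht) hx ht
  have key := intervalIntegral.integral_eq_sub_of_hasDerivAt (a := (0:ℝ)) (b := 1)
    (f := fun t => f (scl j t x)) (f' := fun t => x j * fderiv ℝ f (scl j t x) (Pi.single j 1)) ?_ ?_
  · rw [intervalIntegral.integral_const_mul] at key
    rw [key]
    have h1 : f (scl j 0 x) = 0 := (hb _ (hm 0 (by simp))).2 (by simp [scl_apply])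
    rw [h1]
    simp [scl_apply]
  · intro t ht
    rw [uIcc_of_le zero_le_one] at ht
    have h2 : HasDerivAt (fun t => scl j t x) (x j • (Pi.single j 1 : Fin n → ℝ)) t := by
      have : (fun t => scl j t x) = fun t : ℝ => x + (t - 1) • (x j • (Pi.single j 1 : Fin n → ℝ)) := by
        ext1 t; simp [scl]
      rw [this]
      have := (((hasDerivAt_id t).sub_const 1).smul_const (x j • (Pi.single j 1 : Fin n → ℝ))).const_add x
      simpa using this
    have h3 := ((cda_diff (hb _ (hm t ht)).1.cda).hasFDerivAt).comp_hasDerivAt t h2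
    exact h3.congr_deriv (by simp)
  · apply ContinuousOn.intervalIntegrable
    rw [uIcc_of_le zero_le_one]
    have := avg_contOn (scl_cont j) (fun t ht => scl_norm j ht) (K := fun _ => ContinuousLinearMap.id ℝ ℝ) continuous_const
      (f := fun x => fderiv ℝ f x (Pi.single j 1)) (r := r) (fun y hy =>
        ((cda_fderiv (hb y hy).1.cda).clm_apply contDiffAt_const)) hx
    exact continuousOn_const.mul this

end
end QDC

/-! ## Part 5 -/

namespace QDC
open Set Filter Topology
open scoped ContDiff

section
variable {E G : Type} [NormedAddCommGroup E] [NormedSpace ℝ E] [NormedAddCommGroup G] [NormedSpace ℝ G]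
  {M : ℕ → ℝ}

lemma flow_smooth {γ : E → G} {x : E} (hγ : ∀ᶠ y in 𝓝 x, DifferentiableAt ℝ γ y)
    {V : G → E →L[ℝ] G} (hV : ∀ᶠ y in 𝓝 (γ x), ContDiffAt ℝ ∞ V y) (e : fderiv ℝ γ =ᶠ[𝓝 x] V ∘ γ) :
    ∀ᶠ y in 𝓝 x, ContDiffAt ℝ ∞ γ y := by
  have hc := hγ.self_of_nhds.continuousAt
  obtain ⟨O, hO, hOo, hxO⟩ := eventually_nhds_iff.1 ((hγ.and (hc.eventually hV)).and e)
  have key : ∀ k : ℕ, ContDiffOn ℝ k γ O := by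
    intro k
    induction k with
    | zero =>
      rw [Nat.cast_zero, contDiffOn_zero]
      exact fun y hy => (hO y hy).1.1.continuousAt.continuousWithinAt
    | succ k ih =>
      have : ((k + 1 : ℕ) : WithTop ℕ∞) = (k : WithTop ℕ∞) + 1 := by norm_cast
      rw [this, contDiffOn_succ_iff_fderiv_of_isOpen hOo]
      refine ⟨fun y hy => (hO y hy).1.1.differentiableWithinAt, by simp, ?_⟩
      have h1 : ContDiffOn ℝ k (V ∘ γ) O := fun y hy =>
        ((cda_nat (hO y hy).1.2 k).comp_contDiffWithinAt y (ih y hy))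
      exact h1.congr fun y hy => (hO y hy).2
  filter_upwards [hOo.mem_nhds hxO] with y hy
  exact contDiffAt_infty.2 fun k => (key k).contDiffAt (hOo.mem_nhds hy)
end

section
variable {n : ℕ} {M : ℕ → ℝ}

/-- Implicit function theorem for one equation. -/
lemma dc_ift (W : Wt M) {g : (Fin n → ℝ) → ℝ} (hg : DCAt M g 0) (hg0 : g 0 = 0) (j : Fin n)
    (hd : fderiv ℝ g 0 (Pi.single j 1) ≠ 0) :
    ∃ ψ : (Fin n → ℝ) → ℝ, DCAt M ψ 0 ∧ ψ 0 = 0 ∧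
      ∀ᶠ x in 𝓝 0, x j = 0 → g (Function.update x j (ψ x)) = 0 := by
  set e : Fin n → ℝ := Pi.single j 1 with he
  set pr : (Fin n → ℝ) →L[ℝ] ℝ := ContinuousLinearMap.proj j with hpr
  have pre : pr e = 1 := by simp [hpr, he]
  set Θ : (Fin n → ℝ) → (Fin n → ℝ) := fun x => x + (g x - pr x) • e with hΘ
  set A : (Fin n → ℝ) → (Fin n → ℝ) →L[ℝ] (Fin n → ℝ) := fun x =>
    ContinuousLinearMap.id ℝ _ + (fderiv ℝ g x - pr).smulRight e with hA
  set V : (Fin n → ℝ) → (Fin n → ℝ) →L[ℝ] (Fin n → ℝ) := fun x =>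
    ContinuousLinearMap.id ℝ _ + (fderiv ℝ g x e)⁻¹ • (pr - fderiv ℝ g x).smulRight e with hV
  have hVA : ∀ x, fderiv ℝ g x e ≠ 0 → (V x).comp (A x) = ContinuousLinearMap.id ℝ _ := by
    intro x hx
    ext1 v
    simp only [hV, hA, ContinuousLinearMap.comp_apply, add_apply,
      ContinuousLinearMap.id_apply, ContinuousLinearMap.smulRight_apply, smul_apply,
      map_add, map_smul, sub_apply, pre]
    ext i
    simp only [Pi.add_apply, Pi.smul_apply, smul_eq_mul]
    field_simp
    ring
  have hAV : ∀ x, fderiv ℝ g x e ≠ 0 → (A x).comp (V x) = ContinuousLinearMap.id ℝ _ := by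
    intro x hx
    ext1 v
    simp only [hV, hA, ContinuousLinearMap.comp_apply, add_apply,
      ContinuousLinearMap.id_apply, ContinuousLinearMap.smulRight_apply, smul_apply,
      map_add, map_smul, sub_apply, pre]
    ext i
    simp only [Pi.add_apply, Pi.smul_apply, smul_eq_mul]
    field_simp
    ring
  have hVdc : DCAt M V 0 := by
    have h1 : DCAt M (fun x => fderiv ℝ g x e) 0 :=
      (hg.fderiv W).clm_comp W (ContinuousLinearMap.apply ℝ ℝ e)
    have h2 : DCAt M (fun x => (pr - fderiv ℝ g x).smulRight e) 0 := by
      have := ((dc_const W pr 0).sub W (hg.fderiv W)).clm_comp W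
        ((ContinuousLinearMap.smulRightL ℝ (Fin n → ℝ) (Fin n → ℝ)).flip e)
      exact this
    exact (dc_const W _ 0).add W ((h1.inv W hd).smul W h2)
  have hΘd : ∀ x, DifferentiableAt ℝ g x → HasFDerivAt Θ (A x) x := by
    intro x hx
    exact (hasFDerivAt_id x).add ((hx.hasFDerivAt.sub pr.hasFDerivAt).smul_const e)
  have hΘdc : DCAt M Θ 0 := (dc_clm W (ContinuousLinearMap.id ℝ _) 0).add W
    ((hg.sub W (dc_clm W pr 0)).smul W (dc_const W e 0))
  have hΘ0 : Θ 0 = 0 := by simp [hΘ, hg0]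
  set A' := ContinuousLinearEquiv.equivOfInverse (A 0) (V 0)
    (fun v => DFunLike.congr_fun (hVA 0 hd) v) (fun v => DFunLike.congr_fun (hAV 0 hd) v) with hA'
  have hst : HasStrictFDerivAt Θ (A' : (Fin n → ℝ) →L[ℝ] (Fin n → ℝ)) 0 := by
    apply hΘdc.cda.hasStrictFDerivAt' (hΘd 0 (cda_diff hg.cda)) (by simp)
  have hri := hst.eventually_right_inverse
  have hγ := hΘdc.cda.to_localInverse (f' := A') (hΘd 0 (cda_diff hg.cda)) (by simp)
  have hγ0 := hst.localInverse_apply_image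
  change ContDiffAt ℝ ∞ (hst.localInverse Θ A' 0) (Θ 0) at hγ
  rw [hΘ0] at hri hγ hγ0
  set γ := hst.localInverse Θ A' 0 with hγd
  have hc : Tendsto γ (𝓝 0) (𝓝 0) := by simpa [hγ0] using hγ.continuousAt.tendsto
  have hne : ∀ᶠ y in 𝓝 (0 : Fin n → ℝ), fderiv ℝ g y e ≠ 0 := by
    have : ContinuousAt (fun y => fderiv ℝ g y e) 0 :=
      ((hg.fderiv W).clm_comp W (ContinuousLinearMap.apply ℝ ℝ e)).cont
    exact this.eventually_ne hd
  have heq : fderiv ℝ γ =ᶠ[𝓝 0] V ∘ γ := by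
    filter_upwards [hri.eventually_nhds, cda_ev hγ, hc.eventually (cda_ev hg.cda), hc.eventually hne] with y h1 h2 h3 h4
    have h5 := (hΘd _ h3).comp y h2.hasFDerivAt
    have h6 : HasFDerivAt (Θ ∘ γ) (ContinuousLinearMap.id ℝ _) y :=
      (hasFDerivAt_id y).congr_of_eventuallyEq h1
    have h7 := h5.unique h6
    calc fderiv ℝ γ y = ((V (γ y)).comp (A (γ y))).comp (fderiv ℝ γ y) := by
          rw [hVA _ h4]; simp
      _ = (V (γ y)).comp ((A (γ y)).comp (fderiv ℝ γ y)) := by rw [ContinuousLinearMap.comp_assoc]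
      _ = _ := by rw [h7]; simp
  have hγs : ∀ᶠ y in 𝓝 0, ContDiffAt ℝ ∞ γ y := flow_smooth (cda_ev hγ) (by
    rw [hγ0]; exact hVdc.ev.mono fun y hy => hy.cda) heq
  have hγdc : DCAt M γ 0 := dc_flow W hγs (by rw [hγ0]; exact hVdc) heq
  refine ⟨fun x => γ x j, hγdc.clm_comp W pr, by simp [hγ0], ?_⟩
  filter_upwards [hri] with x hx hxj
  have h8 : Function.update x j (γ x j) = γ x := by
    ext i
    by_cases hi : i = j
    · subst hi; simp
    · have := congrFun hx i
      simp [hΘ, he, hi] at this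
      simp [hi, this]
  rw [h8]
  have := congrFun hx j
  simp only [hΘ, he, hpr] at this
  simp at this
  rw [this, hxj]

end
end QDC

/-! ## Part 6 -/

namespace QDC
open Set Filter Topology
open scoped ContDiff

section
variable {n : ℕ} {M : ℕ → ℝ}

/-- projection zeroing the coordinates outside `S` -/
def PS (S : Finset (Fin n)) (x : Fin n → ℝ) : Fin n → ℝ := fun i => if i ∈ S then x i else 0

lemma PS_mem {S : Finset (Fin n)} {i : Fin n} (h : i ∈ S) (x : Fin n → ℝ) : PS S x i = x i := by simp [PS, h]
lemma PS_not {S : Finset (Fin n)} {i : Fin n} (h : i ∉ S) (x : Fin n → ℝ) : PS S x i = 0 := by simp [PS, h]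
@[simp] lemma PS_zero (S : Finset (Fin n)) : PS S (0 : Fin n → ℝ) = 0 := by ext i; simp [PS]
lemma PS_PS {S T : Finset (Fin n)} (h : S ⊆ T) (x : Fin n → ℝ) : PS S (PS T x) = PS S x := by
  ext i; by_cases hi : i ∈ S
  · simp [PS, hi, h hi]
  · simp [PS, hi]
lemma PS_PS' {S T : Finset (Fin n)} (h : S ⊆ T) (x : Fin n → ℝ) : PS T (PS S x) = PS S x := by
  ext i; by_cases hi : i ∈ S
  · simp [PS, hi, h hi]
  · simp [PS, hi]
lemma PS_update {S : Finset (Fin n)} {j : Fin n} (h : j ∉ S) (x : Fin n → ℝ) (c : ℝ) :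
    PS S (Function.update x j c) = PS S x := by
  ext i; by_cases hi : i ∈ S
  · have : i ≠ j := by rintro rfl; exact h hi
    simp [PS, hi, this]
  · simp [PS, hi]

lemma dc_PS (W : Wt M) (S : Finset (Fin n)) (x : Fin n → ℝ) : DCAt M (PS S) x := by
  apply dc_pi W
  intro i
  by_cases h : i ∈ S
  · simpa [PS, h] using dc_coord W i x
  · simpa [PS, h] using dc_const W (0:ℝ) x

def DCS (M : ℕ → ℝ) (S : Finset (Fin n)) (f : (Fin n → ℝ) → ℝ) : Prop :=
  DCAt M f 0 ∧ ∀ x, f x = f (PS S x)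

lemma DCS.mk' (W : Wt M) {S : Finset (Fin n)} {f : (Fin n → ℝ) → ℝ} (h : DCAt M f 0) :
    DCS M S (fun x => f (PS S x)) := by
  refine ⟨?_, fun x => by beta_reduce; rw [PS_PS subset_rfl]⟩
  have h' : DCAt M f (PS S 0) := by simpa using h
  exact h'.comp W (dc_PS W S 0)

lemma DCS.mono {S T : Finset (Fin n)} (hST : S ⊆ T) {f : (Fin n → ℝ) → ℝ} (h : DCS M S f) : DCS M T f :=
  ⟨h.1, fun x => by rw [h.2 x, h.2 (PS T x), PS_PS hST]⟩

lemma DCS.update {S : Finset (Fin n)} {f : (Fin n → ℝ) → ℝ} (h : DCS M S f) {j : Fin n} (hj : j ∉ S)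
    (x : Fin n → ℝ) (c : ℝ) : f (Function.update x j c) = f x := by
  rw [h.2, PS_update hj, ← h.2]

lemma dcs_const (W : Wt M) (S : Finset (Fin n)) (c : ℝ) : DCS M S (fun _ => c) :=
  ⟨dc_const W c 0, fun _ => rfl⟩
lemma dcs_coord (W : Wt M) {S : Finset (Fin n)} {i : Fin n} (h : i ∈ S) : DCS M S (fun x => x i) :=
  ⟨dc_coord W i 0, fun x => (PS_mem h x).symm⟩
lemma DCS.add (W : Wt M) {S : Finset (Fin n)} {f g : (Fin n → ℝ) → ℝ} (hf : DCS M S f) (hg : DCS M S g) :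
    DCS M S (fun x => f x + g x) := ⟨hf.1.add W hg.1, fun x => by beta_reduce; rw [← hf.2 x, ← hg.2 x]⟩
lemma DCS.sub (W : Wt M) {S : Finset (Fin n)} {f g : (Fin n → ℝ) → ℝ} (hf : DCS M S f) (hg : DCS M S g) :
    DCS M S (fun x => f x - g x) := ⟨hf.1.sub W hg.1, fun x => by beta_reduce; rw [← hf.2 x, ← hg.2 x]⟩
lemma DCS.mul (W : Wt M) {S : Finset (Fin n)} {f g : (Fin n → ℝ) → ℝ} (hf : DCS M S f) (hg : DCS M S g) :
    DCS M S (fun x => f x * g x) := ⟨hf.1.mul W hg.1, fun x => by beta_reduce; rw [← hf.2 x, ← hg.2 x]⟩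
lemma DCS.pow (W : Wt M) {S : Finset (Fin n)} {f : (Fin n → ℝ) → ℝ} (hf : DCS M S f) (k : ℕ) :
    DCS M S (fun x => f x ^ k) := ⟨hf.1.pow W k, fun x => by beta_reduce; rw [← hf.2 x]⟩
lemma DCS.sum (W : Wt M) {S : Finset (Fin n)} {ι : Type*} {f : ι → (Fin n → ℝ) → ℝ} (s : Finset ι)
    (hf : ∀ i ∈ s, DCS M S (f i)) : DCS M S (fun x => ∑ i ∈ s, f i x) :=
  ⟨DCAt.sum W s fun i hi => (hf i hi).1, fun x => Finset.sum_congr rfl fun i hi => (hf i hi).2 x⟩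
lemma DCS.prod (W : Wt M) {S : Finset (Fin n)} {ι : Type*} {f : ι → (Fin n → ℝ) → ℝ} (s : Finset ι)
    (hf : ∀ i ∈ s, DCS M S (f i)) : DCS M S (fun x => ∏ i ∈ s, f i x) :=
  ⟨DCAt.prod W s fun i hi => (hf i hi).1, fun x => Finset.prod_congr rfl fun i hi => (hf i hi).2 x⟩
lemma DCS.inv (W : Wt M) {S : Finset (Fin n)} {f : (Fin n → ℝ) → ℝ} (hf : DCS M S f) (h0 : f 0 ≠ 0) :
    DCS M S (fun x => (f x)⁻¹) := ⟨hf.1.inv W h0, fun x => by beta_reduce; rw [← hf.2 x]⟩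

/-- monomials -/
def mon (α : Fin n → ℕ) (x : Fin n → ℝ) : ℝ := ∏ i, x i ^ α i

lemma dcs_mon (W : Wt M) {S : Finset (Fin n)} {α : Fin n → ℕ} (hα : ∀ i ∉ S, α i = 0) : DCS M S (mon α) := by
  apply DCS.prod W
  intro i _
  by_cases h : i ∈ S
  · exact (dcs_coord W h).pow W _
  · simpa [hα i h] using dcs_const W S 1

lemma mon_add (α β : Fin n → ℕ) (x : Fin n → ℝ) : mon (α + β) x = mon α x * mon β x := by
  simp [mon, pow_add, Finset.prod_mul_distrib]
lemma mon_smul (k : ℕ) (α : Fin n → ℕ) (x : Fin n → ℝ) : mon (k • α) x = mon α x ^ k := by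
  rw [mon, mon, ← Finset.prod_pow]
  exact Finset.prod_congr rfl fun i _ => by
    rw [← pow_mul, Pi.smul_apply, smul_eq_mul, mul_comm]
@[simp] lemma mon_zero (x : Fin n → ℝ) : mon 0 x = 1 := by simp [mon]
lemma mon_single (i : Fin n) (x : Fin n → ℝ) (k : ℕ) : mon (Pi.single i k) x = x i ^ k := by
  rw [mon, Finset.prod_eq_single i]
  · simp
  · intro b _ hb; simp [hb]
  · simp
lemma mon_ne_zero {α : Fin n → ℕ} {x : Fin n → ℝ} (h : ∀ i, x i ≠ 0) : mon α x ≠ 0 :=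
  Finset.prod_ne_zero_iff.2 fun i _ => pow_ne_zero _ (h i)
lemma mon_update {j : Fin n} {α : Fin n → ℕ} (hα : α j = 0) (x : Fin n → ℝ) (c : ℝ) :
    mon α (Function.update x j c) = mon α x := by
  apply Finset.prod_congr rfl
  intro i _
  by_cases h : i = j
  · subst h; simp [hα]
  · simp [h]

structure Adm (M : ℕ → ℝ) (S : Finset (Fin n)) (p : (Fin n → ℝ) → (Fin n → ℝ)) : Prop where
  dc : DCAt M p 0
  zero : p 0 = 0
  out : ∀ x, ∀ i ∉ S, p x i = x i
  dep : ∀ x, PS S (p x) = PS S (p (PS S x))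

lemma Adm.tendsto {S : Finset (Fin n)} {p : (Fin n → ℝ) → (Fin n → ℝ)} (h : Adm M S p) :
    Tendsto p (𝓝 0) (𝓝 0) := by simpa [h.zero] using h.dc.cont.tendsto

lemma Adm.mono {S T : Finset (Fin n)} (hST : S ⊆ T) {p : (Fin n → ℝ) → (Fin n → ℝ)} (h : Adm M S p) :
    Adm M T p := by
  refine ⟨h.dc, h.zero, fun x i hi => h.out x i fun hi' => hi (hST hi'), fun x => ?_⟩
  ext i
  by_cases hi : i ∈ T
  · rw [PS_mem hi, PS_mem hi]
    by_cases hi' : i ∈ S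
    · have h1 := congrFun (h.dep x) i
      have h2 := congrFun (h.dep (PS T x)) i
      rw [PS_mem hi', PS_mem hi'] at h1 h2
      rw [h1, h2, PS_PS hST]
    · rw [h.out _ _ hi', h.out _ _ hi', PS_mem hi]
  · rw [PS_not hi, PS_not hi]

lemma DCS.comp (W : Wt M) {S : Finset (Fin n)} {p : (Fin n → ℝ) → (Fin n → ℝ)} (h : Adm M S p)
    {f : (Fin n → ℝ) → ℝ} (hf : DCS M S f) : DCS M S (f ∘ p) := by
  refine ⟨DCAt.comp W (by rw [h.zero]; exact hf.1) h.dc, fun x => ?_⟩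
  simp only [Function.comp]
  rw [hf.2, h.dep, ← hf.2]

def Cover {ι : Type} (p : ι → (Fin n → ℝ) → (Fin n → ℝ)) : Prop :=
  ∀ N : ι → Set (Fin n → ℝ), (∀ i, N i ∈ 𝓝 0) → ∃ t : Finset ι, (⋃ i ∈ t, p i '' N i) ∈ 𝓝 0

inductive Good (M : ℕ → ℝ) (S : Finset (Fin n)) : ((Fin n → ℝ) → ℝ) → Prop
  | mono (f : (Fin n → ℝ) → ℝ) (α : Fin n → ℕ) (hα : ∀ i ∉ S, α i = 0) (u : (Fin n → ℝ) → ℝ)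
      (hu : DCS M S u) (hu0 : u 0 ≠ 0) (e : f =ᶠ[𝓝 0] fun x => mon α x * u x) : Good M S f
  | step (f : (Fin n → ℝ) → ℝ) (ι : Type) (p : ι → (Fin n → ℝ) → (Fin n → ℝ)) (hp : ∀ i, Adm M S (p i))
      (hc : Cover p) (h : ∀ i, Good M S (f ∘ p i)) : Good M S f

lemma ev_comp {S : Finset (Fin n)} {p : (Fin n → ℝ) → (Fin n → ℝ)} (h : Adm M S p)
    {f g : (Fin n → ℝ) → ℝ} (e : f =ᶠ[𝓝 0] g) : f ∘ p =ᶠ[𝓝 0] g ∘ p := h.tendsto.eventually e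

lemma Good.congr {S : Finset (Fin n)} {f g : (Fin n → ℝ) → ℝ} (h : Good M S f) (e : f =ᶠ[𝓝 0] g) :
    Good M S g := by
  induction h generalizing g with
  | mono f α hα u hu hu0 e' => exact .mono g α hα u hu hu0 (e.symm.trans e')
  | step f ι p hp hc h ih => exact .step g ι p hp hc fun i => ih i (ev_comp (hp i) e)

/-! covers -/

lemma cover_inv {p q : (Fin n → ℝ) → (Fin n → ℝ)} (hq : ContinuousAt q 0) (hq0 : q 0 = 0)
    (h : ∀ x, p (q x) = x) : Cover (fun _ : Unit => p) := by
  intro N hN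
  refine ⟨{()}, ?_⟩
  have : Tendsto q (𝓝 0) (𝓝 0) := by simpa [hq0] using hq.tendsto
  filter_upwards [this.eventually (hN ())] with x hx
  simp only [Finset.mem_singleton, mem_iUnion, exists_prop]
  exact ⟨(), by simp, q x, hx, h x⟩

/-- blow-up charts -/
noncomputable def bl (l j : Fin n) : Option ℝ → (Fin n → ℝ) → (Fin n → ℝ)
  | some t => fun x => Function.update x j (x l * (t + x j))
  | none => fun x => Function.update x l (x l * x j)

lemma dc_update (W : Wt M) {f : (Fin n → ℝ) → ℝ} (hf : DCAt M f 0) (j : Fin n) :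
    DCAt M (fun x => Function.update x j (f x)) 0 := by
  apply dc_pi W
  intro i
  by_cases h : i = j
  · subst h; simpa using hf
  · simpa [h] using dc_coord W i 0

lemma adm_update (W : Wt M) {S : Finset (Fin n)} {f : (Fin n → ℝ) → ℝ} (hf : DCS M S f) (hf0 : f 0 = 0)
    {j : Fin n} (hj : j ∈ S) : Adm M S (fun x => Function.update x j (f x)) := by
  refine ⟨dc_update W hf.1 j, by simp [hf0], fun x i hi => ?_, fun x => ?_⟩
  · have : i ≠ j := by rintro rfl; exact hi hj
    simp [this]
  · ext i
    by_cases hi : i ∈ S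
    · rw [PS_mem hi, PS_mem hi]
      by_cases h : i = j
      · subst h; simp [← hf.2]
      · simp [h, PS_mem hi]
    · rw [PS_not hi, PS_not hi]

lemma bl_adm (W : Wt M) {S : Finset (Fin n)} {l j : Fin n} (hl : l ∈ S) (hj : j ∈ S) (t : Option ℝ) :
    Adm M S (bl l j t) := by
  cases t with
  | some t =>
    exact adm_update W ((dcs_coord W hl).mul W ((dcs_const W S t).add W (dcs_coord W hj))) (by simp) hj
  | none =>
    exact adm_update W ((dcs_coord W hl).mul W (dcs_coord W hj)) (by simp) hl

lemma bl_cover {l j : Fin n} (hlj : l ≠ j) : Cover (bl l j) := by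
  intro N hN
  have : ∀ t, ∃ r > 0, Metric.ball 0 r ⊆ N t := fun t => Metric.mem_nhds_iff.1 (hN t)
  choose r hr hrN using this
  set T : ℝ := 2 / r none with hT
  have hTp : 0 < T := div_pos two_pos (hr none)
  obtain ⟨F, hF⟩ := (isCompact_Icc (a := -T) (b := T)).elim_nhds_subcover
    (fun t => Metric.ball t (r (some t))) (fun t _ => Metric.ball_mem_nhds t (hr _))
  classical
  refine ⟨insert none (F.image some), ?_⟩
  have h1 : ∀ᶠ x in 𝓝 (0 : Fin n → ℝ), ∀ t ∈ insert none (F.image some), ‖x‖ < r t := by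
    rw [Filter.eventually_all_finset]
    intro t _
    filter_upwards [Metric.ball_mem_nhds 0 (hr t)] with x hx
    simpa using hx
  filter_upwards [h1] with x hx
  rw [mem_iUnion₂]
  by_cases hc : |x j| ≤ T * |x l|
  · have hq : x j / x l ∈ Icc (-T) T := by
      rw [mem_Icc, ← abs_le, abs_div]
      exact div_le_of_le_mul₀ (abs_nonneg _) hTp.le hc
    obtain ⟨t, ht, htq⟩ := mem_iUnion₂.1 (hF.2 hq)
    refine ⟨some t, by simp [ht], Function.update x j (x j / x l - t), hrN _ ?_, ?_⟩
    · have hxt := hx (some t) (by simp [ht])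
      rw [Metric.mem_ball, dist_zero_right, pi_norm_lt_iff (hr _)]
      intro i
      by_cases hi : i = j
      · subst hi
        simpa [Real.dist_eq] using htq
      · simp only [ne_eq, hi, not_false_eq_true, Function.update_of_ne]
        exact (norm_le_pi_norm x i).trans_lt hxt
    · simp only [bl, Function.update_idem, Function.update_self, ne_eq, hlj, not_false_eq_true, Function.update_of_ne]
      rw [add_sub_cancel]
      by_cases h0 : x l = 0
      · have : x j = 0 := by simpa [h0] using hc
        ext i; by_cases hi : i = j
        · subst hi; simp [h0, this]
        · simp [hi]
      · rw [mul_div_cancel₀ _ h0]; simp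
  · push Not at hc
    have hxj : 0 < |x j| := lt_of_le_of_lt (by positivity) hc
    have hxj0 : x j ≠ 0 := abs_pos.1 hxj
    refine ⟨none, by simp, Function.update x l (x l / x j), hrN _ ?_, ?_⟩
    · have hxt := hx none (by simp)
      rw [Metric.mem_ball, dist_zero_right, pi_norm_lt_iff (hr _)]
      intro i
      by_cases hi : i = l
      · subst hi
        simp only [Function.update_self, norm_div, Real.norm_eq_abs]
        rw [div_lt_iff₀ hxj]
        have hr0 := hr none
        have : T * r none = 2 := by rw [hT]; field_simp
        nlinarith [abs_nonneg (x i)]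
      · simp only [ne_eq, hi, not_false_eq_true, Function.update_of_ne]
        exact (norm_le_pi_norm x i).trans_lt hxt
    · simp only [bl, Function.update_idem, Function.update_self, ne_eq, hlj.symm, not_false_eq_true, Function.update_of_ne]
      rw [div_mul_cancel₀ _ hxj0]; simp

/-- power charts -/
noncomputable def pw (S : Finset (Fin n)) (D : ℕ) (ε : Fin n → Bool) (x : Fin n → ℝ) : Fin n → ℝ :=
  fun i => if i ∈ S then (if ε i then 1 else -1) * x i ^ D else x i

lemma pw_adm (W : Wt M) (S : Finset (Fin n)) {D : ℕ} (hD : D ≠ 0) (ε : Fin n → Bool) : Adm M S (pw S D ε) := by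
  refine ⟨?_, ?_, fun x i hi => by simp [pw, hi], fun x => ?_⟩
  · apply dc_pi W
    intro i
    by_cases h : i ∈ S
    · simp only [pw, h, if_true]
      exact (dc_const W _ 0).mul W ((dc_coord W i 0).pow W D)
    · simpa [pw, h] using dc_coord W i 0
  · ext i; simp [pw, hD]
  · ext i
    by_cases hi : i ∈ S
    · simp [PS, pw, hi]
    · simp [PS, hi]

lemma pw_cover (S : Finset (Fin n)) {D : ℕ} (hD : D ≠ 0) : Cover (pw (n := n) S D) := by
  intro N hN
  refine ⟨Finset.univ, ?_⟩
  have h1 : ∀ᶠ x in 𝓝 (0 : Fin n → ℝ), ∀ ε, x ∈ N ε := Filter.eventually_all.2 hN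
  obtain ⟨r, hr, hb⟩ := Metric.eventually_nhds_iff_ball.1 h1
  have hrD : 0 < min r (r ^ D) := by positivity
  filter_upwards [Metric.ball_mem_nhds 0 hrD] with x hx
  rw [Metric.mem_ball, dist_zero_right, lt_min_iff] at hx
  rw [mem_iUnion₂]
  refine ⟨fun i => decide (0 ≤ x i), Finset.mem_univ _,
    fun i => if i ∈ S then |x i| ^ ((D:ℝ)⁻¹) else x i, hb _ ?_ _, ?_⟩
  · rw [Metric.mem_ball, dist_zero_right, pi_norm_lt_iff hr]
    intro i
    by_cases hi : i ∈ S
    · simp only [hi, if_true]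
      rw [Real.norm_eq_abs, abs_of_nonneg (by positivity)]
      have : |x i| < r ^ D := lt_of_le_of_lt (norm_le_pi_norm x i) hx.2
      calc |x i| ^ ((D:ℝ)⁻¹) < (r ^ D) ^ ((D:ℝ)⁻¹) :=
            Real.rpow_lt_rpow (abs_nonneg _) this (by positivity)
        _ = r := Real.pow_rpow_inv_natCast hr.le hD
    · simp only [hi, if_false]
      exact (norm_le_pi_norm x i).trans_lt hx.1
  · ext i
    by_cases hi : i ∈ S
    · simp only [pw, hi, if_true]
      rw [Real.rpow_inv_natCast_pow (abs_nonneg _) hD]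
      by_cases h0 : 0 ≤ x i
      · simp [h0, abs_of_nonneg h0]
      · simp [h0, abs_of_neg (not_le.1 h0)]
    · simp [pw, hi]

end
end QDC

/-! ## Part 7 -/

namespace QDC
open Set Filter Topology
open scoped ContDiff

section
variable {n : ℕ} {M : ℕ → ℝ}

lemma dc_cancel (W : Wt M) {f g g' : (Fin n → ℝ) → ℝ} (hf : DCAt M f 0) (hg : DCAt M g 0) (hg' : DCAt M g' 0)
    (hf0 : ¬ f =ᶠ[𝓝 0] 0) (h : (fun x => f x * g x) =ᶠ[𝓝 0] fun x => f x * g' x) : g =ᶠ[𝓝 0] g' := by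
  by_contra hc
  have h1 : ¬ (fun x => g x - g' x) =ᶠ[𝓝 0] 0 := by
    intro h2; apply hc
    filter_upwards [h2] with x hx
    exact sub_eq_zero.1 hx
  refine hf.mul_ne W (hg.sub W hg') hf0 h1 ?_
  filter_upwards [h] with x hx
  simp only [Pi.zero_apply]
  linarith

lemma coord_ne (j : Fin n) : ¬ (fun x : Fin n → ℝ => x j) =ᶠ[𝓝 0] 0 := by
  intro h
  have h1 : Tendsto (fun s : ℝ => (Pi.single j s : Fin n → ℝ)) (𝓝[≠] 0) (𝓝 0) := by
    have : Continuous (fun s : ℝ => (Pi.single j s : Fin n → ℝ)) := continuous_pi fun i => by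
      by_cases h : i = j
      · subst h; simpa using continuous_id'
      · simpa [h] using continuous_const
    have := this.tendsto 0
    rw [Pi.single_zero] at this
    exact this.mono_left nhdsWithin_le_nhds
  obtain ⟨s, hs, hs'⟩ := ((h1.eventually h).and self_mem_nhdsWithin).exists
  simp at hs
  exact hs' hs

lemma dcs_divide (W : Wt M) {S : Finset (Fin n)} {f : (Fin n → ℝ) → ℝ} (hf : DCS M S f) {j : Fin n} (hj : j ∈ S)
    (h0 : ∀ᶠ x in 𝓝 0, x j = 0 → f x = 0) :
    ∃ g, DCS M S g ∧ f =ᶠ[𝓝 0] fun x => x j * g x := by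
  obtain ⟨g, hg, e⟩ := dc_divide W hf.1 j h0
  refine ⟨_, DCS.mk' W (S := S) hg, ?_⟩
  have : Tendsto (PS S) (𝓝 0) (𝓝 0) := by simpa using (dc_PS W S 0).cont.tendsto
  filter_upwards [this.eventually e] with x hx
  rw [hf.2, hx, PS_mem hj]

lemma PS_erase {S : Finset (Fin n)} {j : Fin n} {x : Fin n → ℝ} (hx : x j = 0) :
    PS (S.erase j) x = PS S x := by
  ext i
  by_cases h : i = j
  · subst h; simp [PS, hx]
  · simp [PS, h]

lemma upd_tendsto (j : Fin n) : Tendsto (fun x : Fin n → ℝ => Function.update x j 0) (𝓝 0) (𝓝 0) := by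
  have : Continuous (fun x : Fin n → ℝ => Function.update x j 0) := continuous_id.update j continuous_const
  simpa using this.tendsto 0

lemma dcs_restr (W : Wt M) {S : Finset (Fin n)} {f : (Fin n → ℝ) → ℝ} (hf : DCS M S f) (j : Fin n) :
    DCAt M (fun x => f (Function.update x j 0)) 0 := by
  exact DCAt.comp W (by simpa using hf.1) (dc_update W (dc_const W 0 0) j)

lemma dcs_divide' (W : Wt M) {S : Finset (Fin n)} {f : (Fin n → ℝ) → ℝ} (hf : DCS M S f) {j : Fin n} (hj : j ∈ S)
    (h0 : (fun x => f (Function.update x j 0)) =ᶠ[𝓝 0] 0) :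
    ∃ g, DCS M S g ∧ f =ᶠ[𝓝 0] fun x => x j * g x := by
  apply dcs_divide W hf hj
  filter_upwards [h0] with x hx h
  have : Function.update x j 0 = x := by rw [← h]; simp
  rw [this] at hx; exact hx

/-- expansion in powers of `x j` -/
lemma dcs_expand (W : Wt M) {S : Finset (Fin n)} {j : Fin n} {g : (Fin n → ℝ) → ℝ} (hj : j ∉ S)
    (hg : DCS M (insert j S) g) (k : ℕ) : ∃ (c : ℕ → (Fin n → ℝ) → ℝ) (u : (Fin n → ℝ) → ℝ),
      (∀ i, DCS M S (c i)) ∧ DCS M (insert j S) u ∧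
      g =ᶠ[𝓝 0] fun x => ∑ i ∈ Finset.range k, c i x * x j ^ i + u x * x j ^ k := by
  induction k with
  | zero => exact ⟨fun _ _ => 0, g, fun _ => dcs_const W _ _, hg, by simp⟩
  | succ k ih =>
    obtain ⟨c, u, hc, hu, e⟩ := ih
    have h1 : DCS M S (fun x => u (PS S x)) := DCS.mk' W hu.1
    obtain ⟨v, hv, e'⟩ := dcs_divide W (hu.sub W (h1.mono (Finset.subset_insert j S))) (Finset.mem_insert_self j S)
      (Eventually.of_forall fun x hx => by
        rw [hu.2 x, ← PS_erase hx, Finset.erase_insert hj, sub_self])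
    refine ⟨fun i => if i = k then (fun x => u (PS S x)) else c i, v, fun i => ?_, hv, ?_⟩
    · by_cases h : i = k
      · simpa [h] using h1
      · simpa [h] using hc i
    · filter_upwards [e, e'] with x hx hx'
      rw [hx, Finset.sum_range_succ]
      have : ∑ i ∈ Finset.range k, (if i = k then (fun x => u (PS S x)) else c i) x * x j ^ i
          = ∑ i ∈ Finset.range k, c i x * x j ^ i := by
        apply Finset.sum_congr rfl
        intro i hi
        rw [if_neg (Finset.mem_range.1 hi).ne]
      rw [this, if_pos rfl]
      have : u x = u (PS S x) + x j * v x := by linarith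
      rw [this]; ring

/-- divisors of monomials -/
lemma mono_div (W : Wt M) {S : Finset (Fin n)} (N : ℕ) : ∀ {a q v : (Fin n → ℝ) → ℝ} {α : Fin n → ℕ},
    ∑ i, α i = N → DCS M S a → DCS M S q → DCS M S v → v 0 ≠ 0 → (∀ i ∉ S, α i = 0) →
    ((fun x => mon α x * v x) =ᶠ[𝓝 0] fun x => a x * q x) →
    ∃ (β : Fin n → ℕ) (w : (Fin n → ℝ) → ℝ), (∀ i ∉ S, β i = 0) ∧ DCS M S w ∧ w 0 ≠ 0 ∧
      a =ᶠ[𝓝 0] fun x => mon β x * w x := by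
  induction N with
  | zero =>
    intro a q v α hN ha hq hv hv0 hα e
    have : α = 0 := by ext i; simpa using (Finset.sum_eq_zero_iff.1 hN) i (Finset.mem_univ i)
    subst this
    have := e.self_of_nhds
    simp only [mon_zero, one_mul] at this
    refine ⟨0, a, by simp, ha, fun h => hv0 (by rw [this, h, zero_mul]), by simp⟩
  | succ N ih =>
    intro a q v α hN ha hq hv hv0 hα e
    obtain ⟨l, hl⟩ : ∃ l, α l ≠ 0 := by
      by_contra hc; push Not at hc; simp [hc] at hN
    have hlS : l ∈ S := by by_contra h; exact hl (hα l h)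
    obtain ⟨α', rfl⟩ : ∃ α' : Fin n → ℕ, α = α' + Pi.single l 1 := by
      refine ⟨α - Pi.single l 1, funext fun i => ?_⟩
      by_cases h : i = l
      · subst h; simp only [Pi.add_apply, Pi.sub_apply, Pi.single_eq_same]; omega
      · simp [h]
    have hN' : ∑ i, α' i = N := by
      simp [Finset.sum_add_distrib] at hN; exact hN
    have hα' : ∀ i ∉ S, α' i = 0 := fun i hi => by
      have := hα i hi; simp at this; exact this.1
    have hm : ∀ x, mon (α' + Pi.single l 1) x = x l * mon α' x := fun x => by
      rw [mon_add, mon_single, pow_one, mul_comm]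
    have hz : (fun x => a (Function.update x l 0) * q (Function.update x l 0)) =ᶠ[𝓝 0] 0 := by
      filter_upwards [(upd_tendsto l).eventually e] with x hx
      rw [← hx, hm]; simp
    by_cases ha0 : (fun x => a (Function.update x l 0)) =ᶠ[𝓝 0] 0
    · obtain ⟨a', ha', ea⟩ := dcs_divide' W ha hlS ha0
      obtain ⟨β, w, hβ, hw, hw0, ew⟩ := ih hN' ha' hq hv hv0 hα' (by
        refine dc_cancel W (dc_coord W l 0) ((dcs_mon W hα').mul W hv).1 (ha'.mul W hq).1 (coord_ne l) ?_
        filter_upwards [e, ea] with x hx hxa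
        rw [hm, hxa] at hx
        linarith)
      refine ⟨β + Pi.single l 1, w, ?_, hw, hw0, ?_⟩
      · intro i hi
        have : i ≠ l := by rintro rfl; exact hi hlS
        simp [hβ i hi, this]
      · filter_upwards [ea, ew] with x hx hx'
        rw [hx, hx', mon_add, mon_single]; ring
    · have hq0 : (fun x => q (Function.update x l 0)) =ᶠ[𝓝 0] 0 := by
        by_contra hq0
        exact (dcs_restr W ha l).mul_ne W (dcs_restr W hq l) ha0 hq0 hz
      obtain ⟨q', hq', eq⟩ := dcs_divide' W hq hlS hq0
      exact ih hN' ha hq' hv hv0 hα' (by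
        refine dc_cancel W (dc_coord W l 0) ((dcs_mon W hα').mul W hv).1 (ha.mul W hq').1 (coord_ne l) ?_
        filter_upwards [e, eq] with x hx hxa
        rw [hm, hxa] at hx
        linarith)

/-- comparison of exponents along curves -/
lemma curve_tendsto (w : Fin n → ℕ) (hw : ∀ i, 1 ≤ w i) :
    Tendsto (fun s : ℝ => fun i => s ^ w i) (𝓝[>] 0) (𝓝 (0 : Fin n → ℝ)) := by
  rw [tendsto_pi_nhds]
  intro i
  have : Continuous fun s : ℝ => s ^ w i := continuous_pow _
  have h := this.tendsto 0
  rw [zero_pow (by have := hw i; omega)] at h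
  exact h.mono_left nhdsWithin_le_nhds

lemma mon_curve (w : Fin n → ℕ) (a : Fin n → ℕ) (s : ℝ) :
    mon a (fun i => s ^ w i) = s ^ (∑ i, w i * a i) := by
  simp [mon, ← pow_mul, Finset.prod_pow_eq_pow_sum]

lemma pow_tendsto_zero {k : ℕ} (hk : 0 < k) : Tendsto (fun s : ℝ => s ^ k) (𝓝[>] 0) (𝓝 0) := by
  have : Continuous fun s : ℝ => s ^ k := continuous_pow _
  have h := this.tendsto 0
  rw [zero_pow (by omega)] at h
  exact h.mono_left nhdsWithin_le_nhds

lemma curve_le {u v z : (Fin n → ℝ) → ℝ} (hu : ContinuousAt u 0) (hv : ContinuousAt v 0) (hz : ContinuousAt z 0)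
    (hu0 : u 0 ≠ 0) {a b δ : Fin n → ℕ}
    (e : ∀ᶠ x in 𝓝 0, mon a x * u x - mon b x * v x = mon δ x * z x)
    (w : Fin n → ℕ) (hw : ∀ i, 1 ≤ w i) (hab : ∑ i, w i * a i < ∑ i, w i * b i) :
    ∑ i, w i * δ i ≤ ∑ i, w i * a i := by
  set A := ∑ i, w i * a i
  set B := ∑ i, w i * b i
  set D := ∑ i, w i * δ i
  have hc := curve_tendsto w hw
  have e1 := hc.eventually e
  simp only [mon_curve] at e1
  have tu := hu.tendsto.comp hc
  have tv := hv.tendsto.comp hc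
  have tz := hz.tendsto.comp hc
  by_contra! h
  have t1 := ((pow_tendsto_zero (Nat.sub_pos_of_lt h)).mul tz).add
    ((pow_tendsto_zero (Nat.sub_pos_of_lt hab)).mul tv)
  have : Tendsto (u ∘ fun s : ℝ => fun i => s ^ w i) (𝓝[>] 0) (𝓝 (0 * z 0 + 0 * v 0)) := by
    refine t1.congr' ?_
    filter_upwards [e1, self_mem_nhdsWithin] with s hs hs0
    have hs0' : s ≠ 0 := ne_of_gt hs0
    apply mul_left_cancel₀ (pow_ne_zero A hs0')
    simp only [Function.comp]
    rw [mul_add, ← mul_assoc, ← mul_assoc, ← pow_add, ← pow_add, Nat.add_sub_cancel' h.le,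
      Nat.add_sub_cancel' hab.le]
    linarith
  have := tendsto_nhds_unique this tu
  simp at this
  exact hu0 this.symm

lemma curve_order {u v z : (Fin n → ℝ) → ℝ} (hu : ContinuousAt u 0) (hv : ContinuousAt v 0) (hz : ContinuousAt z 0)
    (hu0 : u 0 ≠ 0) {a b δ : Fin n → ℕ}
    (e : ∀ᶠ x in 𝓝 0, mon a x * u x - mon b x * v x = mon δ x * z x)
    (w : Fin n → ℕ) (hw : ∀ i, 1 ≤ w i) (hab : ∑ i, w i * a i < ∑ i, w i * b i) (hz0 : z 0 ≠ 0) :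
    ∑ i, w i * δ i = ∑ i, w i * a i := by
  set A := ∑ i, w i * a i
  set B := ∑ i, w i * b i
  set D := ∑ i, w i * δ i
  have hc := curve_tendsto w hw
  have e1 := hc.eventually e
  simp only [mon_curve] at e1
  have tu := hu.tendsto.comp hc
  have tv := hv.tendsto.comp hc
  have tz := hz.tendsto.comp hc
  rcases lt_trichotomy D A with h | h | h
  · exfalso
    have t1 := ((pow_tendsto_zero (Nat.sub_pos_of_lt h)).mul tu).sub
      ((pow_tendsto_zero (Nat.sub_pos_of_lt (h.trans hab))).mul tv)
    have : Tendsto (z ∘ fun s : ℝ => fun i => s ^ w i) (𝓝[>] 0) (𝓝 (0 * u 0 - 0 * v 0)) := by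
      refine t1.congr' ?_
      filter_upwards [e1, self_mem_nhdsWithin] with s hs hs0
      have hs0' : s ≠ 0 := ne_of_gt hs0
      apply mul_left_cancel₀ (pow_ne_zero D hs0')
      simp only [Function.comp]
      rw [← hs, mul_sub, ← mul_assoc, ← mul_assoc, ← pow_add, ← pow_add, Nat.add_sub_cancel' h.le,
        Nat.add_sub_cancel' (h.trans hab).le]
    have := tendsto_nhds_unique this tz
    simp at this
    exact hz0 this.symm
  · exact h
  · exact absurd (curve_le hu hv hz hu0 e w hw hab) (not_le.2 h)

lemma curve_zero {u v : (Fin n → ℝ) → ℝ} (hu : ContinuousAt u 0) (hv : ContinuousAt v 0)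
    (hu0 : u 0 ≠ 0) {a b : Fin n → ℕ}
    (e : ∀ᶠ x in 𝓝 0, mon a x * u x - mon b x * v x = 0)
    (w : Fin n → ℕ) (hw : ∀ i, 1 ≤ w i) (hab : ∑ i, w i * a i < ∑ i, w i * b i) : False := by
  have h1 := curve_le (δ := b) (z := fun _ => 0) hu hv continuousAt_const hu0 (e.mono fun x hx => by simpa using hx)
    w hw hab
  omega

/-- weights emphasising coordinate `i` -/
lemma wt_sum (a : Fin n → ℕ) (i : Fin n) (N : ℕ) :
    ∑ k, (1 + Pi.single (M := fun _ => ℕ) i N k) * a k = (∑ k, a k) + N * a i := by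
  simp [add_mul, Finset.sum_add_distrib, Pi.single_apply]

lemma wt_sum2 (a : Fin n → ℕ) (i l : Fin n) (N : ℕ) :
    ∑ k, (1 + Pi.single (M := fun _ => ℕ) i N k + Pi.single (M := fun _ => ℕ) l 1 k) * a k
      = (∑ k, a k) + N * a i + a l := by
  simp [add_mul, Finset.sum_add_distrib, Pi.single_apply]

lemma mon_cmp {u v : (Fin n → ℝ) → ℝ} (hu : ContinuousAt u 0) (hv : ContinuousAt v 0)
    (hu0 : u 0 ≠ 0) (hv0 : v 0 ≠ 0) {a b : Fin n → ℕ}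
    (e : (∀ᶠ x in 𝓝 0, mon a x * u x - mon b x * v x = 0) ∨ ∃ (δ : Fin n → ℕ) (z : (Fin n → ℝ) → ℝ),
      ContinuousAt z 0 ∧ z 0 ≠ 0 ∧ ∀ᶠ x in 𝓝 0, mon a x * u x - mon b x * v x = mon δ x * z x) :
    a ≤ b ∨ b ≤ a := by
  by_contra hc
  push Not at hc
  simp only [Pi.le_def, not_forall, not_le] at hc
  obtain ⟨⟨k, hk⟩, ⟨i, hi⟩⟩ := hc
  set N := (∑ k, a k) + (∑ k, b k) + a k + b k + a i + b i + 1 with hN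
  have hab : ∀ c : ℕ, c ≤ a k → ∑ k, a k + N * a i + c < ∑ k, b k + N * b i := by
    intro c hc
    have : N * (a i + 1) ≤ N * b i := Nat.mul_le_mul_left N hi
    rw [mul_add] at this
    omega
  have hba : ∑ k, b k + N * b k < ∑ k, a k + N * a k := by
    have : N * (b k + 1) ≤ N * a k := Nat.mul_le_mul_left N hk
    rw [mul_add] at this
    omega
  rcases e with e | ⟨δ, z, hz, hz0, e⟩
  · refine curve_zero hu hv hu0 e (fun l => 1 + Pi.single (M := fun _ => ℕ) i N l) (fun l => by simp) ?_
    rw [wt_sum, wt_sum]; exact hab 0 (Nat.zero_le _)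
  · have h1 := curve_order hu hv hz hu0 e (fun l => 1 + Pi.single (M := fun _ => ℕ) i N l) (fun l => by simp)
      (by rw [wt_sum, wt_sum]; exact hab 0 (Nat.zero_le _)) hz0
    have h2 := curve_order hu hv hz hu0 e (fun l => 1 + Pi.single (M := fun _ => ℕ) i N l + Pi.single (M := fun _ => ℕ) k 1 l)
      (fun l => by omega)
      (by rw [wt_sum2, wt_sum2]; exact lt_of_lt_of_le (hab (a k) le_rfl) (Nat.le_add_right _ _)) hz0
    have e' : ∀ᶠ x in 𝓝 0, mon b x * v x - mon a x * u x = mon δ x * (fun x => - z x) x := by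
      filter_upwards [e] with x hx
      linarith
    have hba' : ∀ N', N ≤ N' → ∑ k, b k + N' * b k < ∑ k, a k + N' * a k := by
      intro N' hN'
      have : N' * (b k + 1) ≤ N' * a k := Nat.mul_le_mul_left N' hk
      rw [mul_add] at this
      omega
    have h3 := curve_order hv hu hz.neg hv0 e' (fun l => 1 + Pi.single (M := fun _ => ℕ) k N l) (fun l => by simp)
      (by rw [wt_sum, wt_sum]; exact hba' N le_rfl) (by simpa using hz0)
    have h4 := curve_order hv hu hz.neg hv0 e' (fun l => 1 + Pi.single (M := fun _ => ℕ) k (N+1) l) (fun l => by simp)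
      (by rw [wt_sum, wt_sum]; exact hba' (N+1) (by omega)) (by simpa using hz0)
    rw [wt_sum, wt_sum] at h1 h3 h4
    rw [wt_sum2, wt_sum2] at h2
    clear_value N
    simp only [Nat.add_one_mul] at h4
    omega

end
end QDC

/-! ## Part 8 -/

namespace QDC
open Set Filter Topology
open scoped ContDiff

section
variable {n : ℕ} {M : ℕ → ℝ}

lemma poly_aux (d : ℕ) : ∀ (p : Polynomial ℝ), ((fun s : ℝ => p.eval s) =O[𝓝[≠] 0] fun s : ℝ => s ^ d) →
    ∀ i < d, p.coeff i = 0 := by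
  induction d with
  | zero => intro p _ i hi; omega
  | succ d ih =>
    intro p h i hi
    have hp0 : p.coeff 0 = 0 := by
      have h1 : Tendsto (fun s : ℝ => s ^ (d+1)) (𝓝[≠] 0) (𝓝 0) := by
        have : Continuous fun s : ℝ => s ^ (d+1) := continuous_pow _
        have h := this.tendsto 0
        rw [zero_pow (by omega)] at h
        exact h.mono_left nhdsWithin_le_nhds
      have h2 := h.trans_tendsto h1
      have h3 : Tendsto (fun s : ℝ => p.eval s) (𝓝[≠] 0) (𝓝 (p.eval 0)) :=
        (p.continuous.tendsto 0).mono_left nhdsWithin_le_nhds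
      rw [Polynomial.coeff_zero_eq_eval_zero]
      exact tendsto_nhds_unique h3 h2
    obtain ⟨q, rfl⟩ := Polynomial.X_dvd_iff.2 hp0
    rcases i with _ | i
    · exact hp0
    · rw [Polynomial.coeff_X_mul]
      refine ih q ?_ i (by omega)
      obtain ⟨C, hC⟩ := h.bound
      refine Asymptotics.IsBigO.of_bound C ?_
      filter_upwards [hC, self_mem_nhdsWithin] with s hs hs0
      have hs0' : 0 < ‖s‖ := norm_pos_iff.2 hs0
      simp only [Polynomial.eval_mul, Polynomial.eval_X, norm_mul, pow_succ] at hs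
      refine le_of_mul_le_mul_left ?_ hs0'
      linarith

lemma poly_ord {d : ℕ} {p : Polynomial ℝ} (h : (fun s : ℝ => p.eval s) =O[𝓝 0] fun s : ℝ => s ^ d) :
    ∀ i < d, p.coeff i = 0 := poly_aux d p (h.mono nhdsWithin_le_nhds)

lemma sum_ord {d e : ℕ} (he : e ≤ d) {κ : ℕ → ℝ}
    (h : (fun s : ℝ => ∑ i ∈ Finset.range e, κ i * s ^ i) =O[𝓝 0] fun s : ℝ => s ^ d) :
    ∀ i < e, κ i = 0 := by
  intro i hi
  have := poly_ord (p := ∑ i ∈ Finset.range e, Polynomial.C (κ i) * Polynomial.X ^ i) (d := d)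
    (by simpa [Polynomial.eval_finsetSum] using h) i (by omega)
  rw [Polynomial.finsetSum_coeff] at this
  simpa [Polynomial.coeff_X_pow, hi] using this

lemma tsch_ord {e : ℕ} {κ : ℕ → ℝ} {c t : ℝ} (hc : c ≠ 0) (ht : t ≠ 0)
    (h : (fun s : ℝ => ∑ i ∈ Finset.range e, κ i * (t + s) ^ i + c * (t + s) ^ (e+1)) =O[𝓝 0] fun s : ℝ => s ^ (e+1)) :
    False := by
  have := poly_ord (p := ∑ i ∈ Finset.range e, Polynomial.C (κ i) * (Polynomial.X + Polynomial.C t) ^ i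
      + Polynomial.C c * (Polynomial.X + Polynomial.C t) ^ (e+1)) (d := e+1)
    (by simpa [Polynomial.eval_finsetSum, add_comm t] using h) e (by omega)
  rw [Polynomial.coeff_add, Polynomial.finsetSum_coeff, Finset.sum_eq_zero] at this
  · rw [Polynomial.coeff_C_mul, Polynomial.coeff_X_add_C_pow] at this
    simp [hc, ht] at this
    norm_cast at this
  · intro i hi
    rw [Polynomial.coeff_C_mul, Polynomial.coeff_X_add_C_pow, Nat.choose_eq_zero_of_lt (Finset.mem_range.1 hi)]
    simp

lemma single_upd (j : Fin n) (s : ℝ) : (Pi.single j s : Fin n → ℝ) = Function.update (0 : Fin n → ℝ) j s := rfl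

lemma DCS.line {S : Finset (Fin n)} {f : (Fin n → ℝ) → ℝ} (h : DCS M S f) {j : Fin n} (hj : j ∉ S)
    (s : ℝ) : f (Pi.single j s) = f 0 := by rw [single_upd, h.update hj]

lemma single_tendsto (j : Fin n) : Tendsto (fun s : ℝ => (Pi.single j s : Fin n → ℝ)) (𝓝 0) (𝓝 0) := by
  have : Continuous (fun s : ℝ => (Pi.single j s : Fin n → ℝ)) := continuous_pi fun i => by
      by_cases h : i = j
      · subst h; simpa using continuous_id'
      · simpa [h] using continuous_const
  have := this.tendsto 0
  rwa [Pi.single_zero] at this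

lemma mon_unit_ne {w : (Fin n → ℝ) → ℝ} (hw : ContinuousAt w 0) (hw0 : w 0 ≠ 0) (γ : Fin n → ℕ) :
    ¬ (fun x => mon γ x * w x) =ᶠ[𝓝 0] 0 := by
  intro h
  have hc := curve_tendsto (n := n) (fun _ => 1) (fun _ => le_rfl)
  obtain ⟨s, ⟨hs, hs1⟩, hs0⟩ := (((hc.eventually h).and (hc.eventually (hw.eventually_ne hw0))).and
    self_mem_nhdsWithin).exists
  beta_reduce at hs
  rw [mon_curve] at hs
  have : s ≠ 0 := ne_of_gt hs0
  simp [this] at hs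
  simp at hs1
  exact hs1 hs

def KK (M : ℕ → ℝ) (S : Finset (Fin n)) (j : Fin n) (d : ℕ) : Prop :=
  ∀ h g : (Fin n → ℝ) → ℝ, DCS M S h → ¬ h =ᶠ[𝓝 0] 0 → DCS M (insert j S) g →
    ¬ ((fun s : ℝ => g (Pi.single j s)) =O[𝓝 0] fun s : ℝ => s ^ (d+1)) →
    Good M (insert j S) (fun x => h x * g x)

lemma core_alg (e : ℕ) (A l B : ℝ) (a : ℕ → ℝ) (c : ℝ) :
    ∑ i ∈ Finset.range e, (A * l) ^ (e+1-i) * a i * (l * B) ^ i + c * (l * B) ^ (e+1)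
      = l ^ (e+1) * (∑ i ∈ Finset.range e, A ^ (e+1-i) * a i * B ^ i + c * B ^ (e+1)) := by
  rw [mul_add, Finset.mul_sum]
  congr 1
  · apply Finset.sum_congr rfl
    intro i hi
    have hi := Finset.mem_range.1 hi
    rw [mul_pow, mul_pow]
    have : l ^ (e+1) = l ^ (e+1-i) * l ^ i := by rw [← pow_add]; congr 1; omega
    rw [this]; ring
  · rw [mul_pow]; ring

lemma core (W : Wt M) {S : Finset (Fin n)} {j : Fin n} (hj : j ∉ S) {e : ℕ} (hK : KK M S j e) (N : ℕ) :
    ∀ (β γ : Fin n → ℕ) (w u : (Fin n → ℝ) → ℝ) (a : ℕ → (Fin n → ℝ) → ℝ),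
      ∑ i, β i = N → (∀ i ∉ S, β i = 0) → (∀ i ∉ S, γ i = 0) → DCS M S w → w 0 ≠ 0 →
      DCS M (insert j S) u → u 0 ≠ 0 → (∀ i, DCS M S (a i)) → (∃ i < e, a i 0 ≠ 0) →
      Good M (insert j S) (fun x => (mon γ x * w x) *
        (∑ i ∈ Finset.range e, mon β x ^ (e+1-i) * a i x * x j ^ i + u x * x j ^ (e+1))) := by
  have hjS : j ∈ insert j S := Finset.mem_insert_self j S
  have hss : S ⊆ insert j S := Finset.subset_insert j S
  induction N with
  | zero =>
    intro β γ w u a hN hβ hγ hw hw0 hu hu0 ha hex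
    have : β = 0 := by ext i; simpa using (Finset.sum_eq_zero_iff.1 hN) i (Finset.mem_univ i)
    subst this
    simp only [mon_zero, one_pow, one_mul]
    refine hK _ _ ((dcs_mon W hγ).mul W hw) (mon_unit_ne hw.1.cont hw0 γ)
      ((DCS.sum W _ fun i _ => ((ha i).mono hss).mul W ((dcs_coord W hjS).pow W _)).add W
        (hu.mul W ((dcs_coord W hjS).pow W _))) ?_
    intro hO
    obtain ⟨i0, hi0, h0⟩ := hex
    refine h0 (sum_ord (d := e+1) (Nat.le_succ e) (κ := fun i => a i 0) ?_ i0 hi0)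
    have hO2 : (fun s : ℝ => u (Pi.single j s) * s ^ (e+1)) =O[𝓝 0] fun s : ℝ => s ^ (e+1) := by
      have h1 : (fun s : ℝ => u (Pi.single j s)) =O[𝓝 0] fun _ : ℝ => (1:ℝ) :=
        (hu.1.cont.tendsto.comp (single_tendsto j)).isBigO_one ℝ
      simpa using h1.mul (Asymptotics.isBigO_refl (fun s : ℝ => s ^ (e+1)) (𝓝 0))
    refine (hO.sub hO2).congr_left fun s => ?_
    simp [(ha _).line hj]
  | succ N ih =>
    intro β γ w u a hN hβ hγ hw hw0 hu hu0 ha hex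
    obtain ⟨l, hl⟩ : ∃ l, β l ≠ 0 := by
      by_contra hc; push Not at hc; simp [hc] at hN
    have hlS : l ∈ S := by by_contra h; exact hl (hβ l h)
    have hlj : l ≠ j := by rintro rfl; exact hj hlS
    have hlS' := hss hlS
    obtain ⟨β', rfl⟩ : ∃ β' : Fin n → ℕ, β = β' + Pi.single l 1 := by
      refine ⟨β - Pi.single l 1, funext fun i => ?_⟩
      by_cases h : i = l
      · subst h; simp only [Pi.add_apply, Pi.sub_apply, Pi.single_eq_same]; omega
      · simp [h]
    have hN' : ∑ i, β' i = N := by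
      simp [Finset.sum_add_distrib] at hN; exact hN
    have hβ' : ∀ i ∉ S, β' i = 0 := fun i hi => by
      have := hβ i hi; simp at this; exact this.1
    have hm : ∀ x, mon (β' + Pi.single l 1) x = mon β' x * x l := fun x => by
      rw [mon_add, mon_single, pow_one]
    have hγ' : ∀ i ∉ S, (γ + Pi.single (M := fun _ => ℕ) l (e+1)) i = 0 := fun i hi => by
      have : i ≠ l := by rintro rfl; exact hi hlS
      simp [hγ i hi, this]
    refine Good.step _ (Option ℝ) (bl l j) (bl_adm W hlS' hjS) (bl_cover hlj) fun t => ?_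
    cases t with
    | some t =>
      have hua := hu.comp W (bl_adm W hlS' hjS (some t))
      have hua0 : (u ∘ bl l j (some t)) 0 = u 0 := by simp [bl]
      have key : ((fun x => (mon γ x * w x) *
        (∑ i ∈ Finset.range e, mon (β' + Pi.single l 1) x ^ (e+1-i) * a i x * x j ^ i + u x * x j ^ (e+1))) ∘ bl l j (some t))
        = fun x => (mon (γ + Pi.single l (e+1)) x * w x) *
          (∑ i ∈ Finset.range e, mon β' x ^ (e+1-i) * a i x * (t + x j) ^ i +
            (u ∘ bl l j (some t)) x * (t + x j) ^ (e+1)) := by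
        funext x
        simp only [Function.comp, bl, hm, mon_update (hγ j hj), mon_update (hβ' j hj), hw.update hj, (ha _).update hj,
          Function.update_self, Function.update_of_ne hlj, core_alg, mon_add, mon_single]
        ring
      rw [key]
      by_cases ht : t = 0
      · subst ht
        simp only [zero_add]
        exact ih β' _ w _ a hN' hβ' hγ' hw hw0 hua (by rw [hua0]; exact hu0) ha hex
      · refine hK _ _ ((dcs_mon W hγ').mul W hw) (mon_unit_ne hw.1.cont hw0 _)
          ((DCS.sum W _ fun i _ => ((((dcs_mon W hβ').pow W _).mul W (ha i)).mono hss).mul W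
            (((dcs_const W _ t).add W (dcs_coord W hjS)).pow W _)).add W
          (hua.mul W (((dcs_const W _ t).add W (dcs_coord W hjS)).pow W _))) ?_
        intro hO
        refine tsch_ord (e := e) (κ := fun i => mon β' (0 : Fin n → ℝ) ^ (e+1-i) * a i 0) hu0 ht (hO.congr_left fun s => ?_)
        have : (u ∘ bl l j (some t)) (Pi.single j s) = u 0 := by
          simp only [Function.comp, bl, Pi.single_eq_same, Pi.single_eq_of_ne hlj, zero_mul]
          rw [single_upd]; simp
        simp only [this, (ha _).line hj, (dcs_mon (M := M) W hβ').line hj, Pi.single_eq_same]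
    | none =>
      have hp := bl_adm W hlS' hjS none (M := M)
      set π := bl l j none with hπ
      have hmm : ∀ (α : Fin n → ℕ) (x : Fin n → ℝ), mon α (π x) = mon α x * x j ^ α l := by
        intro α x
        simp only [hπ, bl, mon]
        rw [← Finset.mul_prod_erase _ _ (Finset.mem_univ l), ← Finset.mul_prod_erase _ (fun i => x i ^ α i) (Finset.mem_univ l)]
        rw [Finset.prod_congr rfl (g := fun i => x i ^ α i) (fun i hi => by
          rw [Function.update_of_ne (Finset.ne_of_mem_erase hi)])]
        simp only [Function.update_self, mul_pow]; ring
      have hπj : ∀ x, π x j = x j := fun x => by simp [hπ, bl, hlj.symm]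
      set V : (Fin n → ℝ) → ℝ := fun x => ∑ i ∈ Finset.range e, mon (β' + Pi.single l 1) x ^ (e+1-i) *
          (x j ^ (β' l)) ^ (e+1-i) * (a i ∘ π) x + (u ∘ π) x with hV
      have hVd : DCS M (insert j S) V :=
        (DCS.sum W _ fun i _ => ((((dcs_mon W hβ).pow W _).mono hss).mul W
          (((dcs_coord W hjS).pow W _).pow W _)).mul W (((ha i).mono hss).comp W hp)).add W (hu.comp W hp)
      have hm0 : mon (β' + Pi.single l 1) (0 : Fin n → ℝ) = 0 := by rw [hm]; simp
      refine Good.mono _ (γ + Pi.single j (γ l + (e+1))) ?_ (fun x => (w ∘ π) x * V x) (((hw.mono hss).comp W hp).mul W hVd) ?_ ?_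
      · intro i hi
        simp only [Finset.mem_insert, not_or] at hi
        simp [hγ i hi.2, hi.1]
      · simp only [Function.comp, hp.zero, hV]
        rw [Finset.sum_eq_zero]
        · simpa using ⟨hw0, hu0⟩
        · intro i hi
          rw [hm0, zero_pow (by have := Finset.mem_range.1 hi; omega)]; simp
      · refine Eventually.of_forall fun x => ?_
        simp only [Function.comp, hmm, hπj, hV, mon_add, mon_single, Pi.add_apply, Pi.single_eq_same]
        have : ∑ i ∈ Finset.range e, (mon β' x * x l ^ 1 * x j ^ (β' l + 1)) ^ (e+1-i) * a i (π x) * x j ^ i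
            = x j ^ (e+1) * ∑ i ∈ Finset.range e, (mon β' x * x l ^ 1) ^ (e+1-i) * (x j ^ β' l) ^ (e+1-i) * a i (π x) := by
          rw [Finset.mul_sum]
          apply Finset.sum_congr rfl
          intro i hi
          have hi := Finset.mem_range.1 hi
          have : x j ^ (e+1) = x j ^ (e+1-i) * x j ^ i := by rw [← pow_add]; congr 1; omega
          rw [this, pow_succ (x j) (β' l), mul_pow, mul_pow (x j ^ β' l)]; ring
        rw [this]; ring

end
end QDC

/-! ## Part 9 -/

namespace QDC
open Set Filter Topology
open scoped ContDiff

section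
variable {n : ℕ} {M : ℕ → ℝ}

def Dv (M : ℕ → ℝ) (S : Finset (Fin n)) (H a : (Fin n → ℝ) → ℝ) : Prop :=
  a =ᶠ[𝓝 0] 0 ∨ ∃ q, DCS M S q ∧ H =ᶠ[𝓝 0] fun x => a x * q x

lemma Dv.comp (W : Wt M) {S : Finset (Fin n)} {H a : (Fin n → ℝ) → ℝ} (h : Dv M S H a)
    {p : (Fin n → ℝ) → (Fin n → ℝ)} (hp : Adm M S p) : Dv M S (H ∘ p) (a ∘ p) := by
  rcases h with h | ⟨q, hq, e⟩
  · exact .inl (ev_comp hp h)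
  · exact .inr ⟨q ∘ p, hq.comp W hp, ev_comp hp e⟩

lemma Dv.mono (W : Wt M) {S : Finset (Fin n)} {H a v : (Fin n → ℝ) → ℝ} (h : Dv M S H a) (ha : DCS M S a)
    {α : Fin n → ℕ} (hα : ∀ i ∉ S, α i = 0) (hv : DCS M S v) (hv0 : v 0 ≠ 0)
    (e : H =ᶠ[𝓝 0] fun x => mon α x * v x) :
    a =ᶠ[𝓝 0] 0 ∨ ∃ (β : Fin n → ℕ) (w : (Fin n → ℝ) → ℝ), (∀ i ∉ S, β i = 0) ∧ DCS M S w ∧ w 0 ≠ 0 ∧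
      a =ᶠ[𝓝 0] fun x => mon β x * w x := by
  rcases h with h | ⟨q, hq, e'⟩
  · exact .inl h
  · exact .inr (mono_div W _ rfl ha hq hv hv0 hα (e.symm.trans e'))

def sg (ε : Fin n → Bool) (α : Fin n → ℕ) : ℝ := ∏ i, (if ε i then (1:ℝ) else -1) ^ α i

lemma sg_ne (ε : Fin n → Bool) (α : Fin n → ℕ) : sg ε α ≠ 0 := by
  refine Finset.prod_ne_zero_iff.2 fun i _ => pow_ne_zero _ ?_
  split_ifs <;> norm_num

lemma mon_pw {S : Finset (Fin n)} {α : Fin n → ℕ} (hα : ∀ i ∉ S, α i = 0) (D : ℕ) (ε : Fin n → Bool)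
    (x : Fin n → ℝ) : mon α (pw S D ε x) = sg ε α * mon (D • α) x := by
  rw [mon, sg, mon, ← Finset.prod_mul_distrib]
  apply Finset.prod_congr rfl
  intro i _
  by_cases h : i ∈ S
  · simp only [pw, h, if_true, mul_pow, ← pow_mul, Pi.smul_apply, smul_eq_mul]
  · simp [hα i h]

def exq (e i : ℕ) : ℕ := (e+1).factorial / (e+1-i)

lemma exq_mul {e i : ℕ} (hi : i < e) : (e+1-i) * exq e i = (e+1).factorial :=
  Nat.mul_div_cancel' (Nat.dvd_factorial (by omega) (by omega))

lemma lift_mono (W : Wt M) {S : Finset (Fin n)} {j : Fin n} (hj : j ∉ S) {e : ℕ} (hK : KK M S j e)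
    {h u : (Fin n → ℝ) → ℝ} {c : ℕ → (Fin n → ℝ) → ℝ} (hc : ∀ i, DCS M S (c i)) (hu : DCS M (insert j S) u)
    (hu0 : u 0 ≠ 0)
    (hh' : ∃ (β : Fin n → ℕ) (w : (Fin n → ℝ) → ℝ), (∀ i ∉ S, β i = 0) ∧ DCS M S w ∧ w 0 ≠ 0 ∧
      h =ᶠ[𝓝 0] fun x => mon β x * w x)
    (hc' : ∀ i < e, c i =ᶠ[𝓝 0] 0 ∨ ∃ (β : Fin n → ℕ) (w : (Fin n → ℝ) → ℝ), (∀ i ∉ S, β i = 0) ∧ DCS M S w ∧ w 0 ≠ 0 ∧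
      c i =ᶠ[𝓝 0] fun x => mon β x * w x)
    (hd : ∀ i < e, ∀ k < e, (fun x => c i x ^ exq e i - c k x ^ exq e k) =ᶠ[𝓝 0] 0 ∨
      ∃ (β : Fin n → ℕ) (w : (Fin n → ℝ) → ℝ), (∀ i ∉ S, β i = 0) ∧ DCS M S w ∧ w 0 ≠ 0 ∧
      (fun x => c i x ^ exq e i - c k x ^ exq e k) =ᶠ[𝓝 0] fun x => mon β x * w x) :
    Good M (insert j S) (fun x => h x * (∑ i ∈ Finset.range e, c i x * x j ^ i + u x * x j ^ (e+1))) := by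
  classical
  have hjS : j ∈ insert j S := Finset.mem_insert_self j S
  have hss : S ⊆ insert j S := Finset.subset_insert j S
  obtain ⟨γ, w, hγ, hw, hw0, eh⟩ := hh'
  set I := (Finset.range e).filter (fun i => ¬ c i =ᶠ[𝓝 0] 0) with hI
  have hch : ∀ i, ∃ (β : Fin n → ℕ) (w : (Fin n → ℝ) → ℝ), i ∈ I → ((∀ i ∉ S, β i = 0) ∧ DCS M S w ∧ w 0 ≠ 0 ∧
      c i =ᶠ[𝓝 0] fun x => mon β x * w x) := by
    intro i
    by_cases hi : i ∈ I
    · simp only [hI, Finset.mem_filter, Finset.mem_range] at hi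
      obtain ⟨β, w, h⟩ := (hc' i hi.1).resolve_left hi.2
      exact ⟨β, w, fun _ => h⟩
    · exact ⟨0, 0, fun h => absurd h hi⟩
  choose α v hαv using hch
  have hIz : ∀ i ∈ Finset.range e, i ∉ I → c i =ᶠ[𝓝 0] 0 := by
    intro i hi hiI
    by_contra hc0
    exact hiI (Finset.mem_filter.2 ⟨hi, hc0⟩)
  have hIe : ∀ i ∈ I, i < e := fun i hi => Finset.mem_range.1 (Finset.mem_filter.1 hi).1
  rcases I.eq_empty_or_nonempty with hIe0 | hIn
  · refine Good.mono _ (γ + Pi.single j (e+1)) ?_ (fun x => w x * u x) ((hw.mono hss).mul W hu) (mul_ne_zero hw0 hu0) ?_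
    · intro i hi
      simp only [Finset.mem_insert, not_or] at hi
      simp [hγ i hi.2, hi.1]
    · have hz : ∀ᶠ x in 𝓝 0, ∀ i ∈ Finset.range e, c i x = 0 := by
        rw [Filter.eventually_all_finset]
        intro i hi
        exact hIz i hi (by simp [hIe0])
      filter_upwards [eh, hz] with x hx hx'
      rw [Finset.sum_eq_zero fun i hi => by rw [hx' i hi, zero_mul], hx, mon_add, mon_single]
      ring
  · obtain ⟨i0, hi0, hmin⟩ := Finset.exists_min_image I (fun i => ∑ k, (exq e i • α i) k) hIn
    set β := exq e i0 • α i0 with hβ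
    have hle : ∀ i ∈ I, β ≤ exq e i • α i := by
      intro i hi
      obtain ⟨-, hv0d, hv00, ev0⟩ := hαv i0 hi0
      obtain ⟨-, hvd, hvi0, evi⟩ := hαv i hi
      have hcmp : β ≤ exq e i • α i ∨ exq e i • α i ≤ β := by
        refine mon_cmp (u := fun x => v i0 x ^ exq e i0) (v := fun x => v i x ^ exq e i) (hv0d.pow W _).1.cont (hvd.pow W _).1.cont
          (pow_ne_zero _ hv00) (pow_ne_zero _ hvi0) ?_
        have ed : ∀ᶠ x in 𝓝 0, mon β x * v i0 x ^ exq e i0 - mon (exq e i • α i) x * v i x ^ exq e i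
            = c i0 x ^ exq e i0 - c i x ^ exq e i := by
          filter_upwards [ev0, evi] with x hx hx'
          rw [hx, hx', hβ, mon_smul, mon_smul, mul_pow, mul_pow]
        rcases hd i0 (hIe _ hi0) i (hIe _ hi) with h | ⟨δ, z, -, hz, hz0, h⟩
        · left
          filter_upwards [ed, h] with x hx hx'
          rw [hx]; exact hx'
        · right
          refine ⟨δ, z, hz.1.cont, hz0, ?_⟩
          filter_upwards [ed, h] with x hx hx'
          rw [hx]; exact hx'
      rcases hcmp with h | h
      · exact h
      · intro k
        have h1 := hmin i hi
        by_contra hlt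
        push Not at hlt
        have := Finset.sum_lt_sum (s := Finset.univ) (fun k _ => h k) ⟨k, Finset.mem_univ k, hlt⟩
        omega
    set D := (e+1).factorial with hD
    have hD0 : D ≠ 0 := Nat.factorial_ne_zero _
    have hle' : ∀ i ∈ I, (e+1-i) • β ≤ D • α i := by
      intro i hi k
      have h1 := hle i hi k
      simp only [Pi.smul_apply, smul_eq_mul] at h1 ⊢
      calc (e+1-i) * β k ≤ (e+1-i) * (exq e i * α i k) := Nat.mul_le_mul_left _ h1
        _ = D * α i k := by rw [← mul_assoc, exq_mul (hIe i hi)]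
    have heq : (e+1-i0) • β = D • α i0 := by
      ext k
      simp only [hβ, Pi.smul_apply, smul_eq_mul]
      rw [← mul_assoc, exq_mul (hIe _ hi0)]
    have hβS : ∀ i ∉ S, β i = 0 := fun i hi => by simp [hβ, (hαv i0 hi0).1 i hi]
    refine Good.step _ (Fin n → Bool) (pw S D) (fun ε => (pw_adm W S hD0 ε).mono hss) (pw_cover S hD0) fun ε => ?_
    have hp := pw_adm (M := M) W S hD0 ε
    have hp' := hp.mono hss
    set a : ℕ → (Fin n → ℝ) → ℝ := fun i => if i ∈ I then
      (fun x => sg ε (α i) * (mon (D • α i - (e+1-i) • β) x * (v i ∘ pw S D ε) x)) else fun _ => 0 with ha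
    have had : ∀ i, DCS M S (a i) := by
      intro i
      by_cases hi : i ∈ I
      · simp only [ha, hi, if_true]
        refine (dcs_const W _ _).mul W ((dcs_mon W ?_).mul W ((hαv i hi).2.1.comp W hp))
        intro k hk
        simp [(hαv i hi).1 k hk]
      · simp only [ha, hi, if_false]
        exact dcs_const W _ _
    have ha0 : a i0 0 ≠ 0 := by
      simp only [ha, hi0, if_true, heq, tsub_self, mon_zero, one_mul, Function.comp, hp.zero]
      exact mul_ne_zero (sg_ne _ _) (hαv i0 hi0).2.2.1
    refine (core W hj hK _ β (D • γ) (fun x => sg ε γ * (w ∘ pw S D ε) x) (u ∘ pw S D ε) a rfl hβS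
      (fun i hi => by simp [hγ i hi]) ((dcs_const W _ _).mul W (hw.comp W hp))
      (by simp only [Function.comp, hp.zero]; exact mul_ne_zero (sg_ne _ _) hw0) (hu.comp W hp')
      (by simp only [Function.comp, hp.zero]; exact hu0) had ⟨i0, hIe _ hi0, ha0⟩).congr ?_
    have hca : ∀ᶠ x in 𝓝 0, ∀ i ∈ Finset.range e, c i (pw S D ε x) = mon β x ^ (e+1-i) * a i x := by
      rw [Filter.eventually_all_finset]
      intro i hi
      by_cases hiI : i ∈ I
      · filter_upwards [hp.tendsto.eventually (hαv i hiI).2.2.2] with x hx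
        simp only [ha, hiI, if_true]
        rw [hx, mon_pw (hαv i hiI).1, ← mon_smul]
        conv_lhs => rw [← tsub_add_cancel_of_le (hle' i hiI), mon_add]
        simp only [Function.comp]; ring
      · filter_upwards [hp.tendsto.eventually (hIz i hi hiI)] with x hx
        rw [hx]
        simp [ha, hiI]
    filter_upwards [hca, hp.tendsto.eventually eh] with x hx hx'
    simp only [Function.comp]
    rw [hx', mon_pw hγ, hp.out x j hj, Finset.sum_congr rfl fun i hi => by rw [← hx i hi]]
    ring

lemma lift (W : Wt M) {S : Finset (Fin n)} {j : Fin n} (hj : j ∉ S) {e : ℕ} (hK : KK M S j e)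
    {H : (Fin n → ℝ) → ℝ} (hH : Good M S H) :
    ∀ {h u : (Fin n → ℝ) → ℝ} {c : ℕ → (Fin n → ℝ) → ℝ}, DCS M S h → (∀ i, DCS M S (c i)) → DCS M (insert j S) u →
    u 0 ≠ 0 → (∃ q, DCS M S q ∧ H =ᶠ[𝓝 0] fun x => h x * q x) → (∀ i < e, Dv M S H (c i)) →
    (∀ i < e, ∀ k < e, Dv M S H (fun x => c i x ^ exq e i - c k x ^ exq e k)) →
    Good M (insert j S) (fun x => h x * (∑ i ∈ Finset.range e, c i x * x j ^ i + u x * x j ^ (e+1))) := by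
  have hss : S ⊆ insert j S := Finset.subset_insert j S
  induction hH with
  | mono f α hα v hv hv0 ef =>
    intro h u c hh hc hu hu0 hq h1 h2
    obtain ⟨q, hq, eq⟩ := hq
    exact lift_mono W hj hK hc hu hu0 (mono_div W _ rfl hh hq hv hv0 hα (ef.symm.trans eq))
      (fun i hi => (h1 i hi).mono W (hc i) hα hv hv0 ef)
      (fun i hi k hk => (h2 i hi k hk).mono W (((hc i).pow W _).sub W ((hc k).pow W _)) hα hv hv0 ef)
  | step f ι p hp hcov _ ih =>
    intro h u c hh hc hu hu0 hq h1 h2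
    obtain ⟨q, hq, eq⟩ := hq
    refine Good.step _ ι p (fun i => (hp i).mono hss) hcov fun i => ?_
    refine (ih i (h := h ∘ p i) (u := u ∘ p i) (c := fun k => c k ∘ p i) (hh.comp W (hp i)) (fun k => (hc k).comp W (hp i)) (hu.comp W ((hp i).mono hss))
      (by simpa [(hp i).zero] using hu0) ⟨q ∘ p i, hq.comp W (hp i), ev_comp (hp i) eq⟩
      (fun k hk => (h1 k hk).comp W (hp i)) (fun k hk l hl => (h2 k hk l hl).comp W (hp i))).congr ?_
    refine Eventually.of_forall fun x => ?_
    simp only [Function.comp, (hp i).out x j hj]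

end
end QDC

/-! ## Part 10 -/

namespace QDC
open Set Filter Topology
open scoped ContDiff

section
variable {n : ℕ} {M : ℕ → ℝ}

noncomputable def Dj (j : Fin n) (g : (Fin n → ℝ) → ℝ) (x : Fin n → ℝ) : ℝ := lineDeriv ℝ g x (Pi.single j 1)

lemma add_single (x : Fin n → ℝ) (j : Fin n) (t : ℝ) : x + t • Pi.single j (1:ℝ) = Function.update x j (x j + t) := by
  ext i
  by_cases h : i = j
  · subst h; simp
  · simp [h]

lemma Dj_eq {j : Fin n} {g : (Fin n → ℝ) → ℝ} {x : Fin n → ℝ} (h : DifferentiableAt ℝ g x) :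
    Dj j g x = fderiv ℝ g x (Pi.single j 1) := h.lineDeriv_eq_fderiv

lemma dc_Dj (W : Wt M) {g : (Fin n → ℝ) → ℝ} (hg : DCAt M g 0) (j : Fin n) : DCAt M (Dj j g) 0 := by
  have : DCAt M (fun x => fderiv ℝ g x (Pi.single j 1)) 0 :=
    (hg.fderiv W).clm_comp W (ContinuousLinearMap.apply ℝ ℝ (Pi.single j (1:ℝ) : Fin n → ℝ))
  refine this.congr ?_
  filter_upwards [hg.ev] with x hx
  rw [Dj_eq (hx.cda.differentiableAt (by simp))]

lemma dc_Dj_iter (W : Wt M) {g : (Fin n → ℝ) → ℝ} (hg : DCAt M g 0) (j : Fin n) (d : ℕ) : DCAt M ((Dj j)^[d] g) 0 := by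
  induction d with
  | zero => exact hg
  | succ d ih => rw [Function.iterate_succ_apply']; exact dc_Dj W ih j

lemma Dj_congr {j : Fin n} {f g : (Fin n → ℝ) → ℝ} {x : Fin n → ℝ} (h : f =ᶠ[𝓝 x] g) : Dj j f =ᶠ[𝓝 x] Dj j g := by
  filter_upwards [h.eventually_nhds] with y hy
  exact Filter.EventuallyEq.lineDeriv_eq hy

lemma Dj_iter_congr {j : Fin n} {f g : (Fin n → ℝ) → ℝ} {x : Fin n → ℝ} (h : f =ᶠ[𝓝 x] g) (d : ℕ) :
    (Dj j)^[d] f =ᶠ[𝓝 x] (Dj j)^[d] g := by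
  induction d with
  | zero => exact h
  | succ d ih => rw [Function.iterate_succ_apply', Function.iterate_succ_apply']; exact Dj_congr ih

lemma Dj_shift {j : Fin n} {p : (Fin n → ℝ) → (Fin n → ℝ)}
    (hp : ∀ x (t : ℝ), p (x + t • Pi.single j (1:ℝ)) = p x + t • Pi.single j (1:ℝ)) (g : (Fin n → ℝ) → ℝ) :
    Dj j (g ∘ p) = Dj j g ∘ p := by
  ext x
  simp only [Dj, lineDeriv, Function.comp, hp]

lemma Dj_shift_iter {j : Fin n} {p : (Fin n → ℝ) → (Fin n → ℝ)}
    (hp : ∀ x (t : ℝ), p (x + t • Pi.single j (1:ℝ)) = p x + t • Pi.single j (1:ℝ)) (d : ℕ) (g : (Fin n → ℝ) → ℝ) :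
    (Dj j)^[d] (g ∘ p) = (Dj j)^[d] g ∘ p := by
  induction d with
  | zero => rfl
  | succ d ih => rw [Function.iterate_succ_apply', Function.iterate_succ_apply', ih, Dj_shift hp]

lemma Dj_form {S : Finset (Fin n)} {j : Fin n} (hj : j ∉ S) {d : ℕ} {g u : (Fin n → ℝ) → ℝ}
    {c : ℕ → (Fin n → ℝ) → ℝ} (hc : ∀ i, DCS M S (c i)) (hu : DCAt M u 0)
    (e : g =ᶠ[𝓝 0] fun x => ∑ i ∈ Finset.range (d+1), c i x * x j ^ i + u x * x j ^ (d+1)) :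
    Dj j g =ᶠ[𝓝 0] fun x => ∑ i ∈ Finset.range d, ((i+1 : ℕ) * c (i+1) x) * x j ^ i +
      ((d+1 : ℕ) * u x + x j * Dj j u x) * x j ^ d := by
  refine (Dj_congr e).trans ?_
  filter_upwards [hu.ev] with x hx
  have hpw : ∀ i : ℕ, HasDerivAt (fun t : ℝ => (x j + t) ^ i) (i * x j ^ (i-1)) 0 := by
    intro i
    have := ((hasDerivAt_id (0:ℝ)).const_add (x j)).pow i
    exact this.congr_deriv (by simp)
  have hu1 : HasDerivAt (fun t : ℝ => u (x + t • Pi.single j (1:ℝ))) (Dj j u x) 0 :=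
    (hx.cda.differentiableAt (by simp)).lineDifferentiableAt.hasLineDerivAt
  have h2 := hu1.mul (hpw (d+1))
  have h1 : HasDerivAt (fun t : ℝ => ∑ i ∈ Finset.range (d+1), c i x * (x j + t) ^ i)
      (∑ i ∈ Finset.range (d+1), c i x * (i * x j ^ (i-1))) 0 :=
    HasDerivAt.fun_sum fun i _ => (hpw i).const_mul (c i x)
  have h3 := (h1.add h2).deriv
  have h4 : Dj j (fun x => ∑ i ∈ Finset.range (d+1), c i x * x j ^ i + u x * x j ^ (d+1)) x
      = deriv (fun t : ℝ => ∑ i ∈ Finset.range (d+1), c i x * (x j + t) ^ i +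
        u (x + t • Pi.single j (1:ℝ)) * (x j + t) ^ (d+1)) 0 := by
    simp only [Dj, lineDeriv]
    congr 1
    ext t
    have : ∀ i, c i (x + t • Pi.single j (1:ℝ)) = c i x := fun i => by rw [add_single, (hc i).update hj]
    simp [this]
  rw [h4]
  refine h3.trans ?_
  rw [Finset.sum_range_succ']
  simp only [zero_smul, add_zero, Nat.add_sub_cancel]
  have : ∑ i ∈ Finset.range d, c (i+1) x * (((i+1 : ℕ) : ℝ) * x j ^ i)
    = ∑ i ∈ Finset.range d, ((i+1 : ℕ) * c (i+1) x) * x j ^ i := Finset.sum_congr rfl fun i _ => by ring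
  rw [this]
  simp only [Nat.cast_zero, zero_mul, mul_zero, add_zero]
  ring

lemma Dj_iter {S : Finset (Fin n)} (W : Wt M) {j : Fin n} (hj : j ∉ S) (d : ℕ) : ∀ {g u : (Fin n → ℝ) → ℝ}
    {c : ℕ → (Fin n → ℝ) → ℝ}, (∀ i, DCS M S (c i)) → DCAt M u 0 →
    (g =ᶠ[𝓝 0] fun x => ∑ i ∈ Finset.range (d+1), c i x * x j ^ i + u x * x j ^ (d+1)) →
    ∃ v, DCAt M v 0 ∧ v 0 = (d+1).factorial * u 0 ∧
      (Dj j)^[d] g =ᶠ[𝓝 0] fun x => d.factorial * c d x + v x * x j := by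
  induction d with
  | zero =>
    intro g u c hc hu e
    exact ⟨u, hu, by simp, by simpa using e⟩
  | succ d ih =>
    intro g u c hc hu e
    have h1 := Dj_form hj hc hu e
    obtain ⟨v, hv, hv0, ev⟩ := ih (c := fun i x => (i+1 : ℕ) * c (i+1) x) (fun i => (dcs_const W _ _).mul W (hc (i+1)))
      (((dc_const W _ 0).mul W hu).add W ((dc_coord W j 0).mul W (dc_Dj W hu j))) h1
    refine ⟨v, hv, ?_, ?_⟩
    · rw [hv0, Nat.factorial_succ (d+1)]; push_cast; simp; ring
    · rw [Function.iterate_succ_apply]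
      filter_upwards [ev] with x hx
      rw [hx, Nat.factorial_succ d]; push_cast; ring

lemma unit_ord {S : Finset (Fin n)} {j : Fin n} (hj : j ∉ S) {d : ℕ} {g u : (Fin n → ℝ) → ℝ}
    {c : ℕ → (Fin n → ℝ) → ℝ} (hc : ∀ i, DCS M S (c i)) (hu : DCAt M u 0)
    (e : g =ᶠ[𝓝 0] fun x => ∑ i ∈ Finset.range d, c i x * x j ^ i + u x * x j ^ d)
    (h1 : ¬ (fun s : ℝ => g (Pi.single j s)) =O[𝓝 0] fun s : ℝ => s ^ (d+1))
    (h0 : (fun s : ℝ => g (Pi.single j s)) =O[𝓝 0] fun s : ℝ => s ^ d) :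
    (∀ i < d, c i 0 = 0) ∧ u 0 ≠ 0 := by
  have e1 : (fun s : ℝ => g (Pi.single j s)) =ᶠ[𝓝 0] fun s : ℝ => ∑ i ∈ Finset.range d, c i 0 * s ^ i +
      u (Pi.single j s) * s ^ d := by
    filter_upwards [(single_tendsto j).eventually e] with s hs
    rw [hs]
    simp [(hc _).line hj]
  have hO2 : (fun s : ℝ => u (Pi.single j s) * s ^ d) =O[𝓝 0] fun s : ℝ => s ^ d := by
    have h1 : (fun s : ℝ => u (Pi.single j s)) =O[𝓝 0] fun _ : ℝ => (1:ℝ) :=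
      (hu.cont.tendsto.comp (single_tendsto j)).isBigO_one ℝ
    simpa using h1.mul (Asymptotics.isBigO_refl (fun s : ℝ => s ^ d) (𝓝 0))
  have hz : ∀ i < d, c i 0 = 0 := by
    refine sum_ord (κ := fun i => c i 0) le_rfl ?_
    refine ((h0.congr' e1 EventuallyEq.rfl).sub hO2).congr_left fun s => ?_
    simp
  refine ⟨hz, fun hu0 => h1 ?_⟩
  have e2 : (fun s : ℝ => g (Pi.single j s)) =ᶠ[𝓝 0] fun s : ℝ => u (Pi.single j s) * s ^ d := by
    filter_upwards [e1] with s hs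
    rw [hs, Finset.sum_eq_zero fun i hi => by rw [hz i (Finset.mem_range.1 hi), zero_mul], zero_add]
  refine Asymptotics.IsBigO.congr' ?_ e2.symm EventuallyEq.rfl
  have h3 : (fun s : ℝ => u (Pi.single j s)) =O[𝓝 0] fun s : ℝ => s := by
    have hd : HasDerivAt (fun t : ℝ => u (0 + t • Pi.single j (1:ℝ))) (lineDeriv ℝ u 0 (Pi.single j (1:ℝ))) 0 :=
      (hu.cda.differentiableAt (by simp)).lineDifferentiableAt.hasLineDerivAt
    have := hd.isBigO_sub
    simp only [zero_add, zero_smul, hu0, sub_zero] at this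
    refine this.congr_left fun s => ?_
    congr 1; ext i; by_cases h : i = j
    · subst h; simp
    · simp [h]
  refine (h3.mul (Asymptotics.isBigO_refl (fun s : ℝ => s ^ d) (𝓝 0))).congr_right fun s => ?_
  ring

end
end QDC

/-! ## Part 11 -/

namespace QDC
open Set Filter Topology
open scoped ContDiff

section
variable {n : ℕ} {M : ℕ → ℝ}

lemma lift0 (W : Wt M) {S : Finset (Fin n)} (j : Fin n)
    {H : (Fin n → ℝ) → ℝ} (hH : Good M S H) : ∀ {u : (Fin n → ℝ) → ℝ}, DCS M (insert j S) u → u 0 ≠ 0 →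
    Good M (insert j S) (fun x => H x * u x) := by
  have hss : S ⊆ insert j S := Finset.subset_insert j S
  induction hH with
  | mono f α hα v hv hv0 ef =>
    intro u hu hu0
    refine Good.mono _ α (fun i hi => hα i fun h => hi (hss h)) (fun x => v x * u x) ((hv.mono hss).mul W hu)
      (mul_ne_zero hv0 hu0) ?_
    filter_upwards [ef] with x hx
    rw [hx]; ring
  | step f ι p hp hcov _ ih =>
    intro u hu hu0
    exact Good.step _ ι p (fun i => (hp i).mono hss) hcov fun i =>
      ih i (hu.comp W ((hp i).mono hss)) (by simpa [(hp i).zero] using hu0)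

lemma KK_zero (W : Wt M) {S : Finset (Fin n)} {j : Fin n} (hj : j ∉ S)
    (hS : ∀ f, DCS M S f → ¬ f =ᶠ[𝓝 0] 0 → Good M S f) : KK M S j 0 := by
  intro h g hh hh0 hg hO
  refine lift0 W j (hS h hh hh0) hg fun hg0 => ?_
  have := (unit_ord (d := 0) (u := g) (c := fun _ _ => 0) hj (fun _ => dcs_const W _ _) hg.1 (by simp) hO (by
    simpa using (hg.1.cont.tendsto.comp (single_tendsto j)).isBigO_one ℝ)).2
  exact this hg0

open Classical in
/-- replace a zero germ by `1` -/
noncomputable def nz (a : (Fin n → ℝ) → ℝ) : (Fin n → ℝ) → ℝ := if a =ᶠ[𝓝 0] 0 then fun _ => 1 else a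

lemma nz_dcs (W : Wt M) {S : Finset (Fin n)} {a : (Fin n → ℝ) → ℝ} (h : DCS M S a) : DCS M S (nz a) := by
  unfold nz; split_ifs
  · exact dcs_const W _ _
  · exact h

lemma nz_ne (a : (Fin n → ℝ) → ℝ) : ¬ nz a =ᶠ[𝓝 0] 0 := by
  unfold nz; split_ifs with h
  · intro h; have := h.self_of_nhds; simp at this
  · exact h

lemma nz_dv {S : Finset (Fin n)} {a q H : (Fin n → ℝ) → ℝ} (hq : DCS M S q) (e : ∀ x, H x = nz a x * q x) : Dv M S H a := by
  by_cases h : a =ᶠ[𝓝 0] 0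
  · exact .inl h
  · refine .inr ⟨q, hq, Eventually.of_forall fun x => ?_⟩
    rw [e, nz, if_neg h]

/-- the final step, once the subprincipal coefficient is killed -/
lemma KK_fin (W : Wt M) {S : Finset (Fin n)} {j : Fin n} (hj : j ∉ S)
    (hS : ∀ f, DCS M S f → ¬ f =ᶠ[𝓝 0] 0 → Good M S f) {e : ℕ} (hK : KK M S j e)
    {h u : (Fin n → ℝ) → ℝ} {c : ℕ → (Fin n → ℝ) → ℝ} (hh : DCS M S h) (hh0 : ¬ h =ᶠ[𝓝 0] 0)
    (hc : ∀ i, DCS M S (c i)) (hu : DCS M (insert j S) u) (hu0 : u 0 ≠ 0) :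
    Good M (insert j S) (fun x => h x * (∑ i ∈ Finset.range e, c i x * x j ^ i + u x * x j ^ (e+1))) := by
  classical
  set R := Finset.range e
  set df : ℕ × ℕ → (Fin n → ℝ) → ℝ := fun p x => c p.1 x ^ exq e p.1 - c p.2 x ^ exq e p.2 with hdf
  have hdfd : ∀ p, DCS M S (df p) := fun p => ((hc _).pow W _).sub W ((hc _).pow W _)
  set P1 : (Fin n → ℝ) → ℝ := fun x => ∏ i ∈ R, nz (c i) x with hP1
  set P2 : (Fin n → ℝ) → ℝ := fun x => ∏ p ∈ R ×ˢ R, nz (df p) x with hP2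
  have d1 : DCS M S P1 := DCS.prod W _ fun i _ => nz_dcs W (hc i)
  have d2 : DCS M S P2 := DCS.prod W _ fun i _ => nz_dcs W (hdfd i)
  have n1 : ¬ P1 =ᶠ[𝓝 0] 0 := DCAt.prod_ne W _ (fun i _ => (nz_dcs W (hc i)).1) fun i _ => nz_ne _
  have n2 : ¬ P2 =ᶠ[𝓝 0] 0 := DCAt.prod_ne W _ (fun i _ => (nz_dcs W (hdfd i)).1) fun i _ => nz_ne _
  have hH := hS (fun x => h x * (P1 x * P2 x)) (hh.mul W (d1.mul W d2))
    (hh.1.mul_ne W (d1.1.mul W d2.1) hh0 (d1.1.mul_ne W d2.1 n1 n2))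
  refine lift W hj hK hH hh hc hu hu0 ⟨_, d1.mul W d2, EventuallyEq.rfl⟩ ?_ ?_
  · intro i hi
    refine nz_dv (q := fun x => h x * ((∏ k ∈ R.erase i, nz (c k) x) * P2 x))
      (hh.mul W ((DCS.prod W _ fun k _ => nz_dcs W (hc k)).mul W d2)) fun x => ?_
    simp only [hP1]
    rw [← Finset.mul_prod_erase R _ (Finset.mem_range.2 hi)]; ring
  · intro i hi k hk
    refine nz_dv (a := df (i, k)) (q := fun x => h x * (P1 x * (∏ p ∈ (R ×ˢ R).erase (i, k), nz (df p) x)))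
      (hh.mul W (d1.mul W (DCS.prod W _ fun k _ => nz_dcs W (hdfd k)))) fun x => ?_
    simp only [hP2]
    have hm : (i, k) ∈ R ×ˢ R := Finset.mem_product.2 ⟨Finset.mem_range.2 hi, Finset.mem_range.2 hk⟩
    rw [← Finset.mul_prod_erase (R ×ˢ R) _ hm]; ring

lemma KK_succ (W : Wt M) {S : Finset (Fin n)} {j : Fin n} (hj : j ∉ S)
    (hS : ∀ f, DCS M S f → ¬ f =ᶠ[𝓝 0] 0 → Good M S f) {e : ℕ} (hK : KK M S j e) : KK M S j (e+1) := by
  intro h g hh hh0 hg hO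
  have hjS : j ∈ insert j S := Finset.mem_insert_self j S
  have hss : S ⊆ insert j S := Finset.subset_insert j S
  by_cases hO' : ((fun s : ℝ => g (Pi.single j s)) =O[𝓝 0] fun s : ℝ => s ^ (e+1))
  swap
  · exact hK h g hh hh0 hg hO'
  obtain ⟨c, u, hc, hu, eg⟩ := dcs_expand W hj hg (e+1)
  obtain ⟨hc0, hu0⟩ := unit_ord hj hc hu.1 eg hO hO'
  obtain ⟨v, hv, hv0, eG⟩ := Dj_iter W hj e hc hu.1 eg
  set G := (Dj j)^[e] g with hG
  have hGd : DCAt M G 0 := dc_Dj_iter W hg.1 j e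
  have hG0 : G 0 = 0 := by
    rw [eG.self_of_nhds]; beta_reduce; rw [hc0 e (by omega)]; simp
  have hG1 : fderiv ℝ G 0 (Pi.single j 1) ≠ 0 := by
    rw [← Dj_eq (hGd.cda.differentiableAt (by simp))]
    have := (Dj_form (d := 0) (c := fun i x => e.factorial * c e x) hj (fun i => (dcs_const W _ _).mul W (hc e)) hv
      (by simpa using eG)).self_of_nhds
    rw [this]
    simp [hv0, hu0, Nat.factorial_ne_zero]
  obtain ⟨ψ, hψ, hψ0, eψ⟩ := dc_ift W hGd hG0 j hG1
  set φ : (Fin n → ℝ) → ℝ := fun x => ψ (PS S x) with hφ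
  have hφd : DCS M S φ := DCS.mk' W hψ
  have hφ0 : φ 0 = 0 := by simp [hφ, hψ0]
  set p : (Fin n → ℝ) → (Fin n → ℝ) := fun x => Function.update x j (x j + φ x) with hp
  have hpa : Adm M (insert j S) p :=
    adm_update W ((dcs_coord W hjS).add W (hφd.mono hss)) (by simp [hφ0]) hjS
  have hcov : Cover (fun _ : Unit => p) := by
    refine cover_inv (q := fun x => Function.update x j (x j - φ x)) ?_ (by simp [hφ0]) fun x => ?_
    · exact (dc_update W ((dc_coord W j 0).sub W hφd.1) j).cont
    · simp only [hp, hφd.update hj]; simp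
  have hpt : ∀ x (t : ℝ), p (x + t • Pi.single j (1:ℝ)) = p x + t • Pi.single j (1:ℝ) := by
    intro x t
    rw [add_single, add_single]
    simp only [hp, hφd.update hj]
    simp only [Function.update_self, Function.update_idem]
    congr 1; ring
  have hps : ∀ s : ℝ, p (Pi.single j s) = Pi.single j s := by
    intro s
    simp only [hp, hφd.line hj, hφ0, add_zero, Function.update_eq_self]
  refine Good.step _ Unit (fun _ => p) (fun _ => hpa) hcov fun _ => ?_
  have hg' := hg.comp W hpa
  obtain ⟨c', u', hc', hu', eg'⟩ := dcs_expand W hj hg' (e+1)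
  have hu0' := (unit_ord hj hc' hu'.1 eg' (by simpa [Function.comp, hps] using hO) (by simpa [Function.comp, hps] using hO')).2
  obtain ⟨v', hv', -, eG'⟩ := Dj_iter W hj e hc' hu'.1 eg'
  rw [Dj_shift_iter hpt, ← hG] at eG'
  have hPt : Tendsto (PS S) (𝓝 0) (𝓝 0) := by simpa using (dc_PS W S 0).cont.tendsto
  have hz : c' e =ᶠ[𝓝 0] 0 := by
    filter_upwards [hPt.eventually eG', hPt.eventually eψ] with x h1 h2
    have hxj := PS_not hj x
    have h3 : p (PS S x) = Function.update (PS S x) j (ψ (PS S x)) := by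
      simp only [hp, hφ, PS_PS subset_rfl, hxj, zero_add]
    simp only [Function.comp] at h1
    rw [h3, h2 hxj, hxj, mul_zero, add_zero, ← (hc' e).2] at h1
    have : (e.factorial : ℝ) ≠ 0 := by exact_mod_cast Nat.factorial_ne_zero e
    simpa [this] using h1.symm
  refine (KK_fin W hj hS hK hh hh0 hc' hu' hu0').congr ?_
  filter_upwards [eg', hz] with x hx hx'
  simp only [Function.comp] at hx ⊢
  rw [hx, Finset.sum_range_succ, hx']
  have : h (p x) = h x := by simp only [hp, hh.update hj]
  rw [this]; simp

lemma KK_all (W : Wt M) {S : Finset (Fin n)} {j : Fin n} (hj : j ∉ S)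
    (hS : ∀ f, DCS M S f → ¬ f =ᶠ[𝓝 0] 0 → Good M S f) (e : ℕ) : KK M S j e := by
  induction e with
  | zero => exact KK_zero W hj hS
  | succ e ih => exact KK_succ W hj hS ih

theorem resolve (W : Wt M) (S : Finset (Fin n)) : ∀ f, DCS M S f → ¬ f =ᶠ[𝓝 0] 0 → Good M S f := by
  induction S using Finset.induction_on with
  | empty =>
    intro f hf hf0
    have h : ∀ x, f x = f 0 := fun x => by
      rw [hf.2]; congr 1
    refine Good.mono f 0 (by simp) f hf ?_ (by simp)
    intro h0; apply hf0
    exact Eventually.of_forall fun x => by rw [h, h0]; rfl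
  | insert j S hj ih =>
    intro f hf hf0
    have hjS : j ∈ insert j S := Finset.mem_insert_self j S
    have hss : S ⊆ insert j S := Finset.subset_insert j S
    have h1 : ∃ᶠ x in 𝓝 0, f x * x j ≠ 0 := fun h =>
      hf.1.mul_ne W (dc_coord W j 0) hf0 (coord_ne j) (h.mono fun y hy => not_not.1 hy)
    obtain ⟨x, hx, hray⟩ := (h1.and_eventually (hf.1.ray W)).exists
    have hfx : f x ≠ 0 := left_ne_zero_of_mul hx
    have hxj : x j ≠ 0 := right_ne_zero_of_mul hx
    have : ∃ d : ℕ, ¬ (fun s : ℝ => f (s • x)) =O[𝓝 0] fun s : ℝ => s ^ (d+1) := by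
      by_contra hc; push Not at hc; exact hfx (hray hc)
    obtain ⟨d, hd⟩ := this
    set v : Fin n → ℝ := fun i => if i ∈ S then x i / x j else 0 with hv
    have hvj : v j = 0 := by simp [hv, hj]
    set p : (Fin n → ℝ) → (Fin n → ℝ) := fun y i => y i + y j * v i with hp
    have hpa : Adm M (insert j S) p := by
      refine ⟨dc_pi W fun i => (dc_coord W i 0).add W ((dc_coord W j 0).mul W (dc_const W _ 0)), ?_, ?_, ?_⟩
      · ext i; simp [hp]
      · intro y i hi
        simp only [Finset.mem_insert, not_or] at hi
        simp [hp, hv, hi.2]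
      · intro y; ext i
        by_cases hi : i ∈ insert j S
        · rw [PS_mem hi, PS_mem hi]
          simp only [hp, PS_mem hi, PS_mem hjS]
        · rw [PS_not hi, PS_not hi]
    have hcov : Cover (fun _ : Unit => p) := by
      refine cover_inv (q := fun y i => y i - y j * v i) ?_ (by ext i; simp) fun y => ?_
      · have hq : DCAt M (fun (y : Fin n → ℝ) (i : Fin n) => y i - y j * v i) 0 :=
          dc_pi W fun i => (dc_coord W i 0).sub W ((dc_coord W j 0).mul W (dc_const W (v i) 0))
        exact hq.cont
      · ext i; simp [hp, hvj]
    refine Good.step _ Unit (fun _ => p) (fun _ => hpa) hcov fun _ => ?_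
    have := KK_all W hj ih d (fun _ => 1) (f ∘ p) (dcs_const W _ 1) (fun h => by
      have := h.self_of_nhds; simp at this) (hf.comp W hpa) ?_
    · exact this.congr (Eventually.of_forall fun x => by simp)
    · intro hO
      apply hd
      have ht : Tendsto (fun s : ℝ => s * x j) (𝓝 0) (𝓝 0) := by
        have : Continuous fun s : ℝ => s * x j := by fun_prop
        simpa using this.tendsto 0
      have h2 := hO.comp_tendsto ht
      have h3 : ((fun s : ℝ => (f ∘ p) (Pi.single j s)) ∘ fun s : ℝ => s * x j) = fun s : ℝ => f (s • x) := by
        ext s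
        simp only [Function.comp]
        rw [hf.2 (s • x), hf.2]
        congr 1
        ext i
        by_cases hi : i ∈ insert j S
        · rw [PS_mem hi, PS_mem hi]
          by_cases hij : i = j
          · subst hij; simp [hp, hvj]
          · have hiS : i ∈ S := (Finset.mem_insert.1 hi).resolve_left hij
            simp [hp, hv, hij, hiS]
            field_simp
        · rw [PS_not hi, PS_not hi]
      rw [h3] at h2
      refine h2.trans ?_
      refine Asymptotics.IsBigO.of_bound (‖x j‖ ^ (d+1)) (Eventually.of_forall fun s => ?_)
      simp [mul_pow, mul_comm]

end
end QDC

/-! ## Part 12 -/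

namespace QDC
open Set Filter Topology
open scoped ContDiff

section
variable {n : ℕ} {M : ℕ → ℝ}

/-- local Łojasiewicz inequality at the origin -/
def Loj (f : (Fin n → ℝ) → ℝ) : Prop :=
  ∀ N ∈ 𝓝 (0 : Fin n → ℝ), ∃ (d : ℕ) (C : ℝ), 0 ≤ C ∧ ∀ᶠ x in 𝓝 (0 : Fin n → ℝ),
    1 ≤ C * |f x| ∨ ∃ z ∈ N, f z = 0 ∧ ‖x - z‖ ^ d ≤ C * |f x|

lemma loj_mono {f : (Fin n → ℝ) → ℝ} {α : Fin n → ℕ} {u : (Fin n → ℝ) → ℝ} (hu : ContinuousAt u 0)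
    (hu0 : u 0 ≠ 0) (e : f =ᶠ[𝓝 0] fun x => mon α x * u x) : Loj f := by
  intro N hN
  set c := |u 0| / 2 with hc
  have hc0 : 0 < c := by positivity
  have h1 : ∀ᶠ x in 𝓝 0, c < |u x| := by
    have : Tendsto (fun x => |u x|) (𝓝 0) (𝓝 |u 0|) := hu.tendsto.abs
    exact this.eventually (lt_mem_nhds (by rw [hc]; linarith [abs_pos.2 hu0]))
  obtain ⟨r, hr, hball⟩ := Metric.mem_nhds_iff.1 (inter_mem (inter_mem hN e) h1)
  refine ⟨∑ i, α i, c⁻¹, by positivity, ?_⟩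
  filter_upwards [Metric.ball_mem_nhds (0 : Fin n → ℝ) hr] with x hx
  obtain ⟨⟨hxN, hxe⟩, hxc⟩ := hball hx
  have hxe' : f x = mon α x * u x := hxe
  have hxc' : c < |u x| := hxc
  have key : |mon α x| ≤ c⁻¹ * |f x| := by
    rw [hxe', abs_mul, inv_mul_eq_div, le_div_iff₀ hc0]
    gcongr
  by_cases hα : ∀ i, α i = 0
  · left
    have : mon α x = 1 := by simp [mon, hα]
    simpa [this] using key
  · right
    push Not at hα
    obtain ⟨i0, hi0⟩ := hα
    obtain ⟨l, hl, hmin⟩ := Finset.exists_min_image (Finset.univ.filter fun i => α i ≠ 0) (fun i => |x i|)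
      ⟨i0, by simp [hi0]⟩
    simp only [Finset.mem_filter, Finset.mem_univ, true_and] at hl hmin
    have hz : Function.update x l 0 ∈ Metric.ball (0 : Fin n → ℝ) r := by
      rw [mem_ball_zero_iff] at hx ⊢
      refine lt_of_le_of_lt ?_ hx
      rw [pi_norm_le_iff_of_nonneg (norm_nonneg _)]
      intro i
      by_cases h : i = l
      · subst h; simp
      · simp only [Function.update_of_ne h]; exact norm_le_pi_norm x i
    obtain ⟨⟨hzN, hze⟩, -⟩ := hball hz
    have hze' : f (Function.update x l 0) = mon α (Function.update x l 0) * u (Function.update x l 0) := hze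
    refine ⟨_, hzN, ?_, ?_⟩
    · rw [hze', mon, Finset.prod_eq_zero (Finset.mem_univ l) (by simp [hl]), zero_mul]
    · refine le_trans ?_ key
      have hn : ‖x - Function.update x l 0‖ ≤ |x l| := by
        rw [pi_norm_le_iff_of_nonneg (abs_nonneg _)]
        intro i
        by_cases h : i = l
        · subst h; simp
        · simp [h]
      calc ‖x - Function.update x l 0‖ ^ (∑ i, α i) ≤ |x l| ^ (∑ i, α i) := by gcongr
        _ = ∏ i, |x l| ^ α i := (Finset.prod_pow_eq_pow_sum _ _ _).symm
        _ ≤ ∏ i, |x i| ^ α i := by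
          refine Finset.prod_le_prod (fun i _ => by positivity) fun i _ => ?_
          by_cases h : α i = 0
          · simp [h]
          · exact pow_le_pow_left₀ (abs_nonneg _) (hmin i h) _
        _ = |mon α x| := by
          rw [mon, Finset.abs_prod]; simp [abs_pow]

lemma loj_step {S : Finset (Fin n)} {f : (Fin n → ℝ) → ℝ} {ι : Type} {p : ι → (Fin n → ℝ) → (Fin n → ℝ)}
    (hp : ∀ i, Adm M S (p i)) (hc : Cover p) (h : ∀ i, Loj (f ∘ p i)) : Loj f := by
  intro N hN
  have hB : Metric.ball (0 : Fin n → ℝ) (1/2) ∈ 𝓝 (0 : Fin n → ℝ) := Metric.ball_mem_nhds _ (by norm_num)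
  have hl : ∀ i, ∃ K : NNReal, ∃ t ∈ 𝓝 (0 : Fin n → ℝ), LipschitzOnWith K (p i) t := fun i =>
    ((hp i).dc.cda.of_le (by simp : (1 : WithTop ℕ∞) ≤ ∞)).exists_lipschitzOnWith
  choose K t ht hK using hl
  have hW : ∀ i, t i ∩ p i ⁻¹' (N ∩ Metric.ball 0 (1/2)) ∈ 𝓝 (0 : Fin n → ℝ) := fun i =>
    inter_mem (ht i) ((hp i).tendsto (inter_mem hN hB))
  choose d C hC0 hC using fun i => h i _ (hW i)
  obtain ⟨s, hs⟩ := hc (fun i => {x | 1 ≤ C i * |(f ∘ p i) x| ∨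
      ∃ z ∈ t i ∩ p i ⁻¹' (N ∩ Metric.ball 0 (1/2)), (f ∘ p i) z = 0 ∧ ‖x - z‖ ^ d i ≤ C i * |(f ∘ p i) x|} ∩ t i)
    fun i => inter_mem (hC i) (ht i)
  refine ⟨∑ i ∈ s, d i, ∑ i ∈ s, (C i + (K i) ^ d i * C i), Finset.sum_nonneg fun i _ => by
    have := hC0 i; positivity, ?_⟩
  filter_upwards [hs, hB] with x hx hxB
  simp only [mem_iUnion] at hx
  obtain ⟨i, hi, y, ⟨hy, hyt⟩, rfl⟩ := hx
  have hCi := hC0 i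
  have hle : C i + (K i) ^ d i * C i ≤ ∑ i ∈ s, (C i + (K i) ^ d i * C i) :=
    Finset.single_le_sum (f := fun i => C i + (K i : ℝ) ^ d i * C i)
      (fun i _ => by have := hC0 i; positivity) hi
  have hKn : 0 ≤ (K i : ℝ) ^ d i * C i := by positivity
  rcases hy with hy | ⟨z, ⟨hzt, hzN, hzB⟩, hz0, hz⟩
  · left
    refine hy.trans ?_
    simp only [Function.comp]
    gcongr; linarith
  · right
    refine ⟨p i z, hzN, hz0, ?_⟩
    simp only [Function.comp] at hz
    have h1 : ‖p i y - p i z‖ ≤ 1 := by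
      rw [mem_ball_zero_iff] at hxB hzB
      have := norm_sub_le (p i y) (p i z)
      linarith
    have h2 : ‖p i y - p i z‖ ≤ K i * ‖y - z‖ := by
      have := (hK i).dist_le_mul y hyt z hzt
      rwa [dist_eq_norm, dist_eq_norm] at this
    calc ‖p i y - p i z‖ ^ (∑ i ∈ s, d i) ≤ ‖p i y - p i z‖ ^ d i :=
          pow_le_pow_of_le_one (norm_nonneg _) h1 (Finset.single_le_sum (f := d) (fun _ _ => Nat.zero_le _) hi)
      _ ≤ (K i * ‖y - z‖) ^ d i := by gcongr
      _ = (K i) ^ d i * ‖y - z‖ ^ d i := mul_pow _ _ _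
      _ ≤ (K i) ^ d i * (C i * |f (p i y)|) := by gcongr
      _ = ((K i) ^ d i * C i) * |f (p i y)| := by ring
      _ ≤ _ := by gcongr; linarith

lemma Good.loj {S : Finset (Fin n)} {f : (Fin n → ℝ) → ℝ} (h : Good M S f) : Loj f := by
  induction h with
  | mono f α hα u hu hu0 e => exact loj_mono hu.1.cont hu0 e
  | step f ι p hp hc h ih => exact loj_step hp hc ih

theorem dc_loj (W : Wt M) {f : (Fin n → ℝ) → ℝ} (hf : DCAt M f 0) : Loj f := by
  by_cases h0 : f =ᶠ[𝓝 0] 0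
  · intro N hN
    refine ⟨1, 0, le_rfl, ?_⟩
    filter_upwards [h0, hN] with x hx hxN
    exact Or.inr ⟨x, hxN, hx, by simp⟩
  · refine (resolve W Finset.univ f ⟨hf, fun x => ?_⟩ h0).loj
    congr 1; ext i; simp [PS]

/-- Łojasiewicz inequality at an arbitrary point -/
theorem dc_loj_at (W : Wt M) {f : (Fin n → ℝ) → ℝ} {b : Fin n → ℝ} (hf : DCAt M f b)
    {N : Set (Fin n → ℝ)} (hN : N ∈ 𝓝 b) :
    ∃ (d : ℕ) (C : ℝ), 0 ≤ C ∧ ∀ᶠ x in 𝓝 b,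
      1 ≤ C * |f x| ∨ ∃ z ∈ N, f z = 0 ∧ ‖x - z‖ ^ d ≤ C * |f x| := by
  have hs : DCAt M (fun x : Fin n → ℝ => x + b) 0 :=
    (dc_clm W (ContinuousLinearMap.id ℝ _) 0).add W (dc_const W b 0)
  have hf' : DCAt M (fun x => f (x + b)) 0 := DCAt.comp W (by simpa using hf) hs
  have ht : Tendsto (fun x : Fin n → ℝ => x + b) (𝓝 0) (𝓝 b) := by simpa using hs.cont.tendsto
  obtain ⟨d, C, hC, h⟩ := dc_loj W hf' _ (ht hN)
  refine ⟨d, C, hC, ?_⟩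
  have ht' : Tendsto (fun x : Fin n → ℝ => x - b) (𝓝 b) (𝓝 0) := by
    have : Continuous fun x : Fin n → ℝ => x - b := by fun_prop
    simpa using this.tendsto b
  filter_upwards [ht'.eventually h] with x hx
  simp only [sub_add_cancel] at hx
  refine hx.imp id ?_
  rintro ⟨z, hz, hz0, hzx⟩
  refine ⟨z + b, hz, hz0, ?_⟩
  rwa [sub_sub, add_comm b z] at hzx

end
end QDC

/-! ## Part 13 -/

namespace QDC
open Set Filter Topology
open scoped ContDiff

section
variable {n : ℕ} {M : ℕ → ℝ}

/-- normalised weight sequence -/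
noncomputable def nrm (M : ℕ → ℝ) (k : ℕ) : ℝ := M k / M 0 * (M 0 / M 1) ^ k

lemma nrm_wt (h : IsDCSeq M) : Wt (nrm M) := by
  obtain ⟨hp, hl, ⟨C, hC⟩, hns⟩ := h
  have h0 := hp 0
  have h1 := hp 1
  have pos : ∀ k, 0 < nrm M k := fun k => by
    have := hp k; unfold nrm; positivity
  set r : ℕ → ℝ := fun k => M (k+1) / M k * (M 0 / M 1) with hr
  have hrs : ∀ k, nrm M (k+1) = r k * nrm M k := fun k => by
    have := hp k
    simp only [hr, nrm, pow_succ]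
    field_simp
  have hrm : Monotone r := monotone_nat_of_le_succ fun k => by
    simp only [hr]; gcongr ?_ * _; exact hl k
  have hr0 : r 0 = 1 := by simp only [hr]; field_simp
  have hr1 : ∀ k, 1 ≤ r k := fun k => by rw [← hr0]; exact hrm (Nat.zero_le k)
  have z : nrm M 0 = 1 := by simp [nrm, h0.ne']
  have o : nrm M 1 = 1 := by rw [hrs 0, hr0, z, one_mul]
  refine ⟨?_, z, ?_, ?_, ?_, ?_, ?_⟩
  · intro k
    induction k with
    | zero => exact z.ge
    | succ k ih => rw [hrs]; exact one_le_mul_of_one_le_of_one_le (hr1 k) ih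
  · intro a b
    induction b with
    | zero => simp [z]
    | succ b ih =>
      have p1 := pos (a + b)
      have p2 := hr1 b
      calc nrm M a * nrm M (b+1) = r b * (nrm M a * nrm M b) := by rw [hrs]; ring
        _ ≤ r b * nrm M (a + b) := by gcongr
        _ ≤ r (a + b) * nrm M (a + b) := by gcongr; exact hrm (by omega)
        _ = _ := by rw [← hrs]; rfl
  · intro a b
    induction b with
    | zero => simp [o]
    | succ b ih =>
      have p1 := pos (a + b + 1)
      have p2 := hr1 (b+1)
      calc nrm M (a+1) * nrm M (b+1+1) = r (b+1) * (nrm M (a+1) * nrm M (b+1)) := by rw [hrs (b+1)]; ring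
        _ ≤ r (b+1) * nrm M (a + b + 1) := by gcongr
        _ ≤ r (a + b + 1) * nrm M (a + b + 1) := by gcongr; exact hrm (by omega)
        _ = _ := by rw [← hrs]; rfl
  · refine ⟨max 1 C * max 1 (M 0 / M 1), one_le_mul_of_one_le_of_one_le (le_max_left _ _) (le_max_left _ _), fun k => ?_⟩
    rw [hrs]
    have := pos k
    gcongr
    rcases Nat.eq_zero_or_pos k with rfl | hk
    · simp [hr0]
    · have h2 := hC k hk
      have hq : 0 < M (k+1) / M k := div_pos (hp _) (hp _)
      have h3 : M (k+1) / M k ≤ (max 1 C) ^ k := by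
        have h4 : (M (k+1) / M k) = ((M (k+1) / M k) ^ ((1:ℝ)/k)) ^ k := by
          rw [← Real.rpow_natCast, ← Real.rpow_mul hq.le]
          have : (k:ℝ) ≠ 0 := by positivity
          field_simp; simp
        rw [h4]
        exact pow_le_pow_left₀ (by positivity) (h2.trans (le_max_right _ _)) _
      rw [mul_pow]
      simp only [hr]
      refine mul_le_mul h3 ?_ (by positivity) (by positivity)
      exact (le_max_right _ _).trans (le_self_pow₀ (le_max_left _ _) (by omega))
  · intro k
    rw [hrs (k+1)]
    have p1 := pos (k)
    have p2 := pos (k+1)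
    calc _ = r k * nrm M k * nrm M (k+1) := by rw [← hrs]
      _ ≤ r (k+1) * nrm M k * nrm M (k+1) := by gcongr; exact hrm (by omega)
      _ = _ := by ring
  · intro hs
    apply hns
    have : (fun k : ℕ => M k / ((k + 1) * M (k + 1))) =
        fun k : ℕ => (M 0 / M 1) * (nrm M k / ((k+1) * nrm M (k+1))) := by
      ext k
      have a1 := hp k
      have a2 := hp (k+1)
      have a3 : (0:ℝ) < k + 1 := by positivity
      simp only [nrm, pow_succ]
      field_simp
    rw [this]
    exact hs.mul_left _

lemma nrm_eq (h : IsDCSeq M) (k : ℕ) : M k = M 0 * (M 1 / M 0) ^ k * nrm M k := by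
  have h0 := h.1 0
  have h1 := h.1 1
  rw [nrm, div_pow, div_pow]
  field_simp

/-! ### partial derivatives -/

noncomputable def pdl (L : List (Fin n)) (f : (Fin n → ℝ) → ℝ) : (Fin n → ℝ) → ℝ := L.foldr pd f

lemma pdl_cons (i : Fin n) (L : List (Fin n)) (f : (Fin n → ℝ) → ℝ) : pdl (i :: L) f = pd i (pdl L f) := rfl

lemma cda_pd {f : (Fin n → ℝ) → ℝ} {x : Fin n → ℝ} (hf : ContDiffAt ℝ ∞ f x) (i : Fin n) :
    ContDiffAt ℝ ∞ (pd i f) x :=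
  (cda_fderiv hf).clm_apply contDiffAt_const

lemma cda_pdl {f : (Fin n → ℝ) → ℝ} {x : Fin n → ℝ} (hf : ContDiffAt ℝ ∞ f x) (L : List (Fin n)) :
    ContDiffAt ℝ ∞ (pdl L f) x := by
  induction L with
  | nil => exact hf
  | cons i L ih => exact cda_pd ih i

lemma pd_congr {f g : (Fin n → ℝ) → ℝ} {x : Fin n → ℝ} (h : f =ᶠ[𝓝 x] g) (i : Fin n) :
    pd i f =ᶠ[𝓝 x] pd i g := by
  filter_upwards [h.fderiv (𝕜 := ℝ)] with y hy
  simp only [pd, hy]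

lemma cda_evinf {f : (Fin n → ℝ) → ℝ} {x : Fin n → ℝ} {U : Set (Fin n → ℝ)} (hU : IsOpen U) (hx : x ∈ U)
    (hf : ContDiffOn ℝ ∞ f U) : ∀ᶠ y in 𝓝 x, ContDiffAt ℝ ∞ f y := by
  filter_upwards [hU.mem_nhds hx] with y hy
  exact hf.contDiffAt (hU.mem_nhds hy)

lemma pd_comm {f : (Fin n → ℝ) → ℝ} {x : Fin n → ℝ} (hf : ContDiffAt ℝ ∞ f x) (i j : Fin n) :
    pd i (pd j f) x = pd j (pd i f) x := by
  have h : ∀ i j : Fin n, pd i (pd j f) x = fderiv ℝ (fderiv ℝ f) x (Pi.single i 1) (Pi.single j 1) := by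
    intro i j
    have hd : DifferentiableAt ℝ (fderiv ℝ f) x := (cda_fderiv hf).differentiableAt (by simp)
    have := (hd.hasFDerivAt.clm_apply (hasFDerivAt_const (Pi.single j (1:ℝ)) x)).fderiv
    have e : pd i (pd j f) x = fderiv ℝ (fun y => fderiv ℝ f y (Pi.single j 1)) x (Pi.single i 1) := rfl
    rw [e, this]
    simp
  rw [h, h]
  exact (hf.isSymmSndFDerivAt (by simp; exact WithTop.coe_le_coe.2 (le_top : (2 : ℕ∞) ≤ ⊤))).eq _ _

lemma pdl_perm {f : (Fin n → ℝ) → ℝ} {U : Set (Fin n → ℝ)} (hU : IsOpen U) (hf : ContDiffOn ℝ ∞ f U)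
    {L L' : List (Fin n)} (h : L.Perm L') : ∀ x ∈ U, pdl L f x = pdl L' f x := by
  induction h with
  | nil => intro x _; rfl
  | cons i _ ih =>
    intro x hx
    rw [pdl_cons, pdl_cons]
    exact (pd_congr (by filter_upwards [hU.mem_nhds hx] with y hy using ih y hy) i).self_of_nhds
  | swap i j l =>
    intro x hx
    simp only [pdl_cons]
    exact pd_comm (cda_pdl (hf.contDiffAt (hU.mem_nhds hx)) l) _ _
  | trans _ _ ih1 ih2 => intro x hx; rw [ih1 x hx, ih2 x hx]

lemma pdl_eq {f : (Fin n → ℝ) → ℝ} {U : Set (Fin n → ℝ)} (hU : IsOpen U) (hf : ContDiffOn ℝ ∞ f U)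
    (L : List (Fin n)) : ∀ x ∈ U, pdl L f x = iteratedFDeriv ℝ L.length f x (fun k => Pi.single (L.get k) 1) := by
  induction L with
  | nil => intro x _; simp [pdl]
  | cons i L ih =>
    intro x hx
    have hd : DifferentiableAt ℝ (iteratedFDeriv ℝ L.length f) x :=
      ((hf.contDiffAt (hU.mem_nhds hx)).iteratedFDeriv_right (m := 1) (i := L.length) (by
        norm_cast; exact le_top)).differentiableAt (by simp)
    have e : pdl L f =ᶠ[𝓝 x] fun y => iteratedFDeriv ℝ L.length f y (fun k => Pi.single (L.get k) 1) := by
      filter_upwards [hU.mem_nhds hx] with y hy using ih y hy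
    have h1 : pdl (i :: L) f x = fderiv ℝ (pdl L f) x (Pi.single i 1) := rfl
    rw [h1, e.fderiv_eq]
    refine Eq.trans ?_ (iteratedFDeriv_succ_apply_left (n := L.length)
      (fun k : Fin (L.length + 1) => (Pi.single ((i :: L).get k) 1 : Fin n → ℝ))).symm
    have := ((ContinuousMultilinearMap.apply ℝ (fun _ : Fin L.length => (Fin n → ℝ)) ℝ
      (fun k => Pi.single (L.get k) 1)).hasFDerivAt.comp x hd.hasFDerivAt).fderiv
    have h2 : (fun y => iteratedFDeriv ℝ L.length f y (fun k => Pi.single (L.get k) 1)) =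
      (⇑(ContinuousMultilinearMap.apply ℝ (fun _ : Fin L.length => (Fin n → ℝ)) ℝ
      (fun k => Pi.single (L.get k) 1)) ∘ iteratedFDeriv ℝ L.length f) := rfl
    rw [h2, this]
    rfl

noncomputable def ml (α : Fin n → ℕ) : List (Fin n) :=
  (Finset.univ : Finset (Fin n)).toList.flatMap fun i => List.replicate (α i) i

lemma mpd_eq_pdl (α : Fin n → ℕ) (f : (Fin n → ℝ) → ℝ) : mpd α f = pdl (ml α) f := by
  unfold mpd ml
  generalize (Finset.univ : Finset (Fin n)).toList = l
  induction l with
  | nil => rfl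
  | cons i l ih =>
    rw [List.foldr_cons, List.flatMap_cons, ih]
    simp only [pdl, List.foldr_append]
    generalize List.foldr pd f _ = g
    generalize α i = k
    induction k generalizing g with
    | zero => rfl
    | succ k ih' => rw [Function.iterate_succ_apply', List.replicate_succ, List.foldr_cons, ih']

lemma ml_count (α : Fin n → ℕ) (i : Fin n) : (ml α).count i = α i := by
  unfold ml
  rw [List.count_flatMap]
  have : (List.count i ∘ fun j => List.replicate (α j) j) = fun j => if j = i then α j else 0 := by
    ext j
    simp [List.count_replicate]
  rw [this]
  rw [Finset.sum_map_toList]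
  simp

lemma ml_length (α : Fin n → ℕ) : (ml α).length = mdeg α := by
  unfold ml mdeg
  rw [List.length_flatMap]
  simp [Finset.sum_map_toList]

/-- every mixed partial derivative is some `mpd` -/
lemma ifd_basis {f : (Fin n → ℝ) → ℝ} {U : Set (Fin n → ℝ)} (hU : IsOpen U) (hf : ContDiffOn ℝ ∞ f U)
    {k : ℕ} (i : Fin k → Fin n) : ∃ α : Fin n → ℕ, mdeg α = k ∧ ∀ x ∈ U,
      iteratedFDeriv ℝ k f x (fun j => Pi.single (i j) 1) = mpd α f x := by
  have hp : (List.ofFn i).Perm (ml fun a => (List.ofFn i).count a) := by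
    rw [List.perm_iff_count]; intro a; rw [ml_count]
  refine ⟨fun a => (List.ofFn i).count a, ?_, fun x hx => ?_⟩
  · rw [← ml_length, ← hp.length_eq, List.length_ofFn]
  · rw [mpd_eq_pdl, ← pdl_perm hU hf hp x hx, pdl_eq hU hf _ x hx]
    have : ∀ (L : List (Fin n)) (hk : L.length = k) (hL : ∀ j : Fin k, L.get (Fin.cast hk.symm j) = i j),
        iteratedFDeriv ℝ k f x (fun j => Pi.single (i j) 1) =
        iteratedFDeriv ℝ L.length f x (fun j => Pi.single (L.get j) 1) := by
      rintro L rfl hL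
      congr 1; ext1 j; rw [← hL]; rfl
    exact this _ List.length_ofFn fun j => by simp

lemma mlin_bound {k : ℕ} (T : ContinuousMultilinearMap ℝ (fun _ : Fin k => (Fin n → ℝ)) ℝ) {C : ℝ} (hC : 0 ≤ C)
    (h : ∀ i : Fin k → Fin n, |T (fun j => Pi.single (i j) 1)| ≤ C) : ‖T‖ ≤ (n:ℝ) ^ k * C := by
  refine ContinuousMultilinearMap.opNorm_le_bound (by positivity) fun m => ?_
  have h1 : m = fun j => ∑ i, m j i • (Pi.single i 1 : Fin n → ℝ) := by
    ext j i
    simp [Finset.sum_apply, Pi.single_apply]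
  have h2 : T m = ∑ r : Fin k → Fin n, (∏ j, m j (r j)) • T (fun j => Pi.single (r j) 1) := by
    conv_lhs => rw [h1]
    rw [ContinuousMultilinearMap.map_sum]
    exact Finset.sum_congr rfl fun r _ => T.map_smul_univ _ _
  rw [h2]
  refine (norm_sum_le _ _).trans ?_
  calc _ ≤ ∑ r : Fin k → Fin n, C * ∏ j, ‖m j‖ := by
        refine Finset.sum_le_sum fun r _ => ?_
        rw [norm_smul, mul_comm, norm_prod]
        refine mul_le_mul (h r) (Finset.prod_le_prod (fun _ _ => norm_nonneg _) fun j _ => norm_le_pi_norm (m j) (r j)) (by positivity) hC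
    _ = _ := by simp; ring

lemma memDC_dcat (hM : IsDCSeq M) {V : Set (Fin n → ℝ)} (hV : IsOpen V) {f : (Fin n → ℝ) → ℝ}
    (hf : MemDC M V f) {x : Fin n → ℝ} (hx : x ∈ V) : DCAt (nrm M) f x := by
  obtain ⟨K, hK, hxK, hKV⟩ := exists_compact_subset hV hx
  obtain ⟨hs, hb⟩ := hf
  obtain ⟨A, B, hA, hB, h⟩ := hb K hKV hK
  have m0 := hM.1 0
  have m1 := hM.1 1
  have W := nrm_wt hM
  refine ⟨A * M 0, max 1 (n * B * (M 1 / M 0)), by positivity, le_max_left _ _, ?_⟩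
  filter_upwards [mem_interior_iff_mem_nhds.1 hxK] with y hy
  refine ⟨hs.contDiffAt (hV.mem_nhds (hKV hy)), fun k => ?_⟩
  have hMk := hM.1 k
  have hb2 : ∀ i : Fin k → Fin n, |iteratedFDeriv ℝ k f y (fun j => Pi.single (i j) 1)| ≤
      A * B ^ k * k.factorial * M k := by
    intro i
    obtain ⟨α, hα, e⟩ := ifd_basis hV hs i
    rw [e y (hKV hy)]
    refine (h y hy α).trans ?_
    rw [hα]
    gcongr
    rw [← hα]
    exact Nat.le_of_dvd (Nat.factorial_pos _) (Nat.prod_factorial_dvd_factorial_sum _ _)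
  refine (mlin_bound _ (by positivity) hb2).trans ?_
  have wk := W.pos k
  calc _ = A * M 0 * (n * B * (M 1 / M 0)) ^ k * k.factorial * nrm M k := by
        rw [nrm_eq hM k]; simp only [mul_pow]; ring
    _ ≤ _ := by gcongr; exact le_max_right _ _

lemma flat_ifd {f : (Fin n → ℝ) → ℝ} {U : Set (Fin n → ℝ)} (hU : IsOpen U) (hf : ContDiffOn ℝ ∞ f U)
    {x : Fin n → ℝ} (hx : x ∈ U) : FlatAt f x ↔ ∀ k, iteratedFDeriv ℝ k f x = 0 := by
  constructor
  · intro h k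
    rw [← norm_le_zero_iff]
    refine (mlin_bound _ le_rfl fun i => ?_).trans (by simp)
    obtain ⟨α, hα, e⟩ := ifd_basis hU hf i
    rw [e x hx, h α, abs_zero]
  · intro h α
    rw [mpd_eq_pdl, pdl_eq hU hf _ x hx, h]; rfl

end
end QDC

/-! ## Part 14 -/

namespace QDC
open Set Filter Topology
open scoped ContDiff

section
variable {E F G F' : Type} [NormedAddCommGroup E] [NormedSpace ℝ E] [NormedAddCommGroup F]
  [NormedSpace ℝ F] [NormedAddCommGroup G] [NormedSpace ℝ G] [NormedAddCommGroup F'] [NormedSpace ℝ F']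

/-- smooth on `V` and flat on `Z` -/
def Fl (V Z : Set E) (P : E → F) : Prop :=
  ContDiffOn ℝ ∞ P V ∧ ∀ z ∈ Z, ∀ k, iteratedFDeriv ℝ k P z = 0

lemma Fl.at {V Z : Set E} {P : E → F} (h : Fl V Z P) (hV : IsOpen V) {x : E} (hx : x ∈ V) :
    ContDiffAt ℝ ∞ P x := h.1.contDiffAt (hV.mem_nhds hx)

lemma Fl.zero {V Z : Set E} {P : E → F} (h : Fl V Z P) {z : E} (hz : z ∈ Z) : P z = 0 := by
  have := h.2 z hz 0
  rw [← norm_eq_zero, norm_iteratedFDeriv_zero, norm_eq_zero] at this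
  exact this

lemma Fl.fderiv {V Z : Set E} (hV : IsOpen V) {P : E → F} (h : Fl V Z P) : Fl V Z (fderiv ℝ P) := by
  refine ⟨fun x hx => (cda_fderiv (h.at hV hx)).contDiffWithinAt, fun z hz k => ?_⟩
  rw [← norm_eq_zero, norm_iteratedFDeriv_fderiv, h.2 z hz, norm_zero]

lemma Fl.bil {V Z : Set E} (hV : IsOpen V) (hZ : Z ⊆ V) (B : G →L[ℝ] F →L[ℝ] F') (hB : ‖B‖ ≤ 1)
    {f : E → G} (hf : ContDiffOn ℝ ∞ f V) {P : E → F} (h : Fl V Z P) : Fl V Z (fun x => B (f x) (P x)) := by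
  refine ⟨fun x hx => ?_, fun z hz k => ?_⟩
  · exact ((B.isBoundedBilinearMap.contDiff.contDiffAt (x := (f x, P x))).comp x
      ((hf.contDiffAt (hV.mem_nhds hx)).prodMk (h.at hV hx))).contDiffWithinAt
  · rw [← norm_le_zero_iff]
    refine (bil_bound B hB (hf.contDiffAt (hV.mem_nhds (hZ hz))) (h.at hV (hZ hz)) k).trans ?_
    exact (Finset.sum_eq_zero fun i _ => by rw [h.2 z hz]; simp).le

lemma Fl.smul {V Z : Set E} (hV : IsOpen V) (hZ : Z ⊆ V)
    {f : E → ℝ} (hf : ContDiffOn ℝ ∞ f V) {P : E → F} (h : Fl V Z P) : Fl V Z (fun x => f x • P x) :=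
  Fl.bil hV hZ (ContinuousLinearMap.lsmul ℝ ℝ : ℝ →L[ℝ] F →L[ℝ] F) ContinuousLinearMap.opNorm_lsmul_le hf h

lemma Fl.sub {V Z : Set E} (hV : IsOpen V) (hZ : Z ⊆ V) {P Q : E → F} (h : Fl V Z P) (h' : Fl V Z Q) :
    Fl V Z (fun x => P x - Q x) := by
  refine ⟨h.1.sub h'.1, fun z hz k => ?_⟩
  have := iteratedFDeriv_sub_apply (cda_nat (h.at hV (hZ hz)) k) (cda_nat (h'.at hV (hZ hz)) k)
  have e : (fun x => P x - Q x) = P - Q := rfl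
  rw [e, this, h.2 z hz, h'.2 z hz, sub_zero]

/-- Taylor estimate for flat functions -/
lemma fl_taylor {V Z : Set E} (hV : IsOpen V) (hZ : Z ⊆ V) {z0 : E} (hz0 : z0 ∈ Z) (K : ℕ) :
    ∀ {F : Type} [NormedAddCommGroup F] [NormedSpace ℝ F] (P : E → F), Fl V Z P →
      ∃ C r : ℝ, 0 ≤ C ∧ 0 < r ∧ ∀ z ∈ Z ∩ Metric.ball z0 r, ∀ x ∈ Metric.ball z0 r, ‖P x‖ ≤ C * ‖x - z‖ ^ K := by
  induction K with
  | zero =>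
    intro F _ _ P hP
    have hc : ContinuousAt P z0 := (hP.at hV (hZ hz0)).continuousAt
    have h1 : ∀ᶠ x in 𝓝 z0, ‖P x‖ < ‖P z0‖ + 1 :=
      hc.norm.tendsto.eventually (gt_mem_nhds (by linarith))
    obtain ⟨r, hr, h2⟩ := Metric.eventually_nhds_iff_ball.1 h1
    exact ⟨‖P z0‖ + 1, r, by positivity, hr, fun z _ x hx => by simpa using (h2 x hx).le⟩
  | succ K ih =>
    intro F _ _ P hP
    obtain ⟨C, r, hC, hr, h⟩ := ih (fderiv ℝ P) (hP.fderiv hV)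
    obtain ⟨r', hr', hb⟩ := Metric.isOpen_iff.1 hV z0 (hZ hz0)
    refine ⟨C, min r r', hC, lt_min hr hr', fun z hz x hx => ?_⟩
    have hzb := hz.2
    have hseg : segment ℝ z x ⊆ Metric.ball z0 (min r r') := (convex_ball z0 _).segment_subset hzb hx
    have := (convex_segment (𝕜 := ℝ) z x).norm_image_sub_le_of_norm_fderiv_le (f := P) (C := C * ‖x - z‖ ^ K)
      (fun y hy => cda_diff (hP.at hV (hb (Metric.ball_subset_ball (min_le_right _ _) (hseg hy)))))
      (fun y hy => ?_) (left_mem_segment ℝ z x) (right_mem_segment ℝ z x)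
    · rw [hP.zero hz.1, sub_zero] at this
      rw [pow_succ, ← mul_assoc]; exact this
    · refine (h z ⟨hz.1, Metric.ball_subset_ball (min_le_left _ _) hzb⟩ y
        (Metric.ball_subset_ball (min_le_left _ _) (hseg hy))).trans ?_
      gcongr
      have h3 : segment ℝ z x ⊆ Metric.closedBall z (‖x - z‖) :=
        (convex_closedBall z _).segment_subset (Metric.mem_closedBall_self (norm_nonneg _))
          (by rw [mem_closedBall_iff_norm])
      have := h3 hy
      rwa [mem_closedBall_iff_norm] at this

/-- data for the quotient construction -/
structure QD (V Z : Set E) (H : E → ℝ) : Prop where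
  op : IsOpen V
  sub : Z ⊆ V
  sm : ContDiffOn ℝ ∞ H V
  zero : ∀ x ∈ V, H x = 0 ↔ x ∈ Z
  loj : ∀ z0 ∈ Z, ∃ (d : ℕ) (C : ℝ), 0 ≤ C ∧ ∀ᶠ x in 𝓝 z0, ∃ z ∈ Z, ‖x - z‖ ^ d ≤ C * |H x|

noncomputable def qq (H : E → ℝ) (m : ℕ) (P : E → F) : E → F := fun x => (H x)⁻¹ ^ (m+1) • P x

lemma QD.bound {V Z : Set E} {H : E → ℝ} (D : QD V Z H) {P : E → F} (hP : Fl V Z P) (m : ℕ)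
    {z0 : E} (hz0 : z0 ∈ Z) : ∃ C, ∀ᶠ x in 𝓝 z0, ‖qq H m P x‖ ≤ C * ‖x - z0‖ ^ 2 := by
  have hz0V := D.sub hz0
  have hH0 : H z0 = 0 := (D.zero z0 hz0V).2 hz0
  obtain ⟨d, C, hC, hL⟩ := D.loj z0 hz0
  obtain ⟨C1, r, hC1, hr, hT⟩ := fl_taylor D.op D.sub hz0 (d * (m + 3)) P hP
  have hHs := D.sm.contDiffAt (D.op.mem_nhds hz0V)
  obtain ⟨L, t, ht, hLip⟩ := (cda_nat hHs 1).exists_lipschitzOnWith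
  have hd : d ≠ 0 := by
    rintro rfl
    obtain ⟨z, -, hz⟩ := hL.self_of_nhds
    rw [hH0] at hz; norm_num at hz
  have hsm : ∀ᶠ x in 𝓝 z0, C * |H x| < (r/2) ^ d := by
    have : Tendsto (fun x => C * |H x|) (𝓝 z0) (𝓝 (C * |H z0|)) := hHs.continuousAt.abs.tendsto.const_mul C
    rw [hH0, abs_zero, mul_zero] at this
    exact this.eventually (gt_mem_nhds (by positivity))
  refine ⟨C1 * C ^ (m+3) * L ^ 2, ?_⟩
  filter_upwards [hL, hsm, ht, Metric.ball_mem_nhds z0 (half_pos hr), D.op.mem_nhds hz0V] with x hx1 hx2 hx3 hx4 hx5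
  by_cases hHx : H x = 0
  · simp only [qq, hHx, inv_zero]
    rw [zero_pow (by omega), zero_smul, norm_zero]; positivity
  obtain ⟨z, hzZ, hz⟩ := hx1
  have h1 : ‖x - z‖ < r / 2 := lt_of_pow_lt_pow_left₀ d (by positivity) (hz.trans_lt hx2)
  have h2 : z ∈ Metric.ball z0 r := by
    rw [mem_ball_iff_norm] at hx4 ⊢
    have : z - z0 = (x - z0) - (x - z) := by abel
    rw [this]
    have := norm_sub_le (x - z0) (x - z)
    linarith
  have h3 := hT z ⟨hzZ, h2⟩ x (Metric.ball_subset_ball (by linarith) hx4)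
  have h4 : |H x| ≤ L * ‖x - z0‖ := by
    have := hLip.dist_le_mul x hx3 z0 (mem_of_mem_nhds ht)
    rwa [dist_eq_norm, dist_eq_norm, hH0, sub_zero, Real.norm_eq_abs] at this
  have h5 : 0 < |H x| := abs_pos.2 hHx
  calc ‖qq H m P x‖ = (|H x|⁻¹) ^ (m+1) * ‖P x‖ := by
        simp [qq, norm_smul]
    _ ≤ (|H x|⁻¹) ^ (m+1) * (C1 * (C * |H x|) ^ (m+3)) := by
        gcongr
        refine h3.trans ?_
        rw [pow_mul]; gcongr
    _ = C1 * C ^ (m+3) * |H x| ^ 2 := by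
        rw [mul_pow, inv_pow, pow_add |H x| (m+1) 2]
        field_simp
    _ ≤ C1 * C ^ (m+3) * (L * ‖x - z0‖) ^ 2 := by gcongr
    _ = _ := by ring

noncomputable def qd (H : E → ℝ) (m : ℕ) (P : E → F) : E → (E →L[ℝ] F) := fun x =>
  H x • fderiv ℝ P x -
    ContinuousLinearMap.smulRightL ℝ E F (((m:ℝ) + 1) • fderiv ℝ H x) (P x)

lemma QD.fl {V Z : Set E} {H : E → ℝ} (D : QD V Z H) {P : E → F} (hP : Fl V Z P) (m : ℕ) :
    Fl V Z (qd H m P) := by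
  have h1 : Fl V Z (fun x => H x • _root_.fderiv ℝ P x) := Fl.smul D.op D.sub D.sm (hP.fderiv D.op)
  have h2 : ContDiffOn ℝ ∞ (fun x => ((m:ℝ) + 1) • _root_.fderiv ℝ H x) V := fun x hx =>
    ((cda_fderiv (D.sm.contDiffAt (D.op.mem_nhds hx))).const_smul _).contDiffWithinAt
  have h3 : Fl V Z (fun x => ContinuousLinearMap.smulRightL ℝ E F (((m:ℝ) + 1) • _root_.fderiv ℝ H x) (P x)) :=
    Fl.bil D.op D.sub _ ContinuousLinearMap.norm_smulRightL_le h2 hP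
  exact Fl.sub D.op D.sub h1 h3

lemma QD.deriv {V Z : Set E} {H : E → ℝ} (D : QD V Z H) {P : E → F} (hP : Fl V Z P) (m : ℕ)
    {x : E} (hx : x ∈ V) : HasFDerivAt (qq H m P) (qq H (m+1) (qd H m P) x) x := by
  by_cases hHx : H x = 0
  · have hxZ := (D.zero x hx).1 hHx
    have e1 : qq H (m+1) (qd H m P) x = 0 := by simp [qq, hHx]
    have e2 : qq H m P x = 0 := by simp [qq, hHx]
    rw [e1]
    obtain ⟨C, hC⟩ := D.bound hP m hxZ
    rw [hasFDerivAt_iff_isLittleO, e2]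
    have h1 : (fun y => qq H m P y) =O[𝓝 x] fun y => ‖y - x‖ ^ 2 :=
      Asymptotics.IsBigO.of_bound C (by filter_upwards [hC] with y hy; simpa using hy)
    have h2 : (fun y : E => ‖y - x‖ ^ 2) =o[𝓝 x] fun y => y - x := by
      have := (Asymptotics.isLittleO_pow_id (𝕜 := ℝ) (n := 2) (by norm_num))
      have ht : Tendsto (fun y : E => ‖y - x‖) (𝓝 x) (𝓝 0) := by
        have : Continuous fun y : E => ‖y - x‖ := by fun_prop
        simpa using this.tendsto x
      exact (this.comp_tendsto ht).norm_right.congr_right (by simp) |>.of_norm_right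
    simpa using h1.trans_isLittleO h2
  · have hH := (cda_diff (D.sm.contDiffAt (D.op.mem_nhds hx))).hasFDerivAt
    have hPd := (cda_diff (hP.at D.op hx)).hasFDerivAt
    have h1 : HasDerivAt (fun t : ℝ => t⁻¹ ^ (m+1)) (-((m:ℝ)+1) * (H x)⁻¹ ^ (m+2)) (H x) := by
      refine ((hasDerivAt_inv hHx).pow (m+1)).congr_deriv ?_
      push_cast
      rw [inv_pow, inv_pow]
      field_simp
      ring
    refine ((h1.comp_hasFDerivAt x hH).smul hPd).congr_fderiv ?_
    ext v
    simp [qq, qd]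
    have : (H x ^ (m+1))⁻¹ = (H x ^ (m+1+1))⁻¹ * H x := by
      rw [pow_succ (H x) (m+1)]; field_simp
    rw [this]
    module

lemma QD.nat {V Z : Set E} {H : E → ℝ} (D : QD V Z H) (k : ℕ) : ∀ {F : Type} [NormedAddCommGroup F]
    [NormedSpace ℝ F] (P : E → F) (m : ℕ), Fl V Z P → ContDiffOn ℝ k (qq H m P) V ∧
      ∀ z ∈ Z, iteratedFDeriv ℝ k (qq H m P) z = 0 := by
  induction k with
  | zero =>
    intro F _ _ P m hP
    refine ⟨?_, fun z hz => ?_⟩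
    · exact contDiffOn_zero.2 fun x hx => (D.deriv hP m hx).continuousAt.continuousWithinAt
    · rw [← norm_eq_zero, norm_iteratedFDeriv_zero]
      simp [qq, (D.zero z (D.sub hz)).2 hz]
  | succ k ih =>
    intro F _ _ P m hP
    have h := ih (qd H m P) (m+1) (D.fl hP m)
    refine ⟨?_, fun z hz => ?_⟩
    · have := (contDiffOn_succ_iff_fderiv_of_isOpen (𝕜 := ℝ) (n := (k : WithTop ℕ∞)) (f := qq H m P) D.op).2
        ⟨fun x hx => (D.deriv hP m hx).differentiableAt.differentiableWithinAt, by simp,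
          h.1.congr fun x hx => (D.deriv hP m hx).fderiv⟩
      exact_mod_cast this
    · rw [← norm_eq_zero, ← norm_iteratedFDeriv_fderiv, norm_eq_zero, ← h.2 z hz]
      apply ifd_congr
      filter_upwards [D.op.mem_nhds (D.sub hz)] with x hx using (D.deriv hP m hx).fderiv

lemma QD.main {V Z : Set E} {H : E → ℝ} (D : QD V Z H) {P : E → F} (hP : Fl V Z P) (m : ℕ) :
    Fl V Z (qq H m P) :=
  ⟨contDiffOn_infty.2 fun k => (D.nat k P m hP).1, fun z hz k => (D.nat k P m hP).2 z hz⟩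

end
end QDC

/-! ## Part 15 -/

namespace QDC
open Set Filter Topology
open scoped ContDiff

section
variable {n : ℕ} {M : ℕ → ℝ}

lemma exists_sum (f : ℕ → (Fin n → ℝ) → ℝ) (hf : ∀ i, ContDiff ℝ ∞ (f i)) (hc : ∀ i, HasCompactSupport (f i)) :
    ∃ ε : ℕ → ℝ, (∀ i, 0 < ε i) ∧ (∀ x, Summable fun i => ε i * f i x) ∧
      ContDiff ℝ ∞ fun x => ∑' i, ε i * f i x := by
  have hb : ∀ i k, ∃ C : ℝ, ∀ x, ‖iteratedFDeriv ℝ k (f i) x‖ ≤ C := fun i k =>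
    ((hf i).continuous_iteratedFDeriv (m := k) (by exact_mod_cast le_top)).bounded_above_of_compact_support
      ((hc i).iteratedFDeriv k)
  choose R hR using hb
  have hR0 : ∀ i k, 0 ≤ R i k := fun i k => (norm_nonneg _).trans (hR i k 0)
  set D : ℕ → ℝ := fun i => 1 + ∑ k ∈ Finset.range (i+1), R i k with hD
  have hD1 : ∀ i, 0 < D i := fun i => by
    have := Finset.sum_nonneg fun k (_ : k ∈ Finset.range (i+1)) => hR0 i k
    simp only [hD]; linarith
  have hDR : ∀ i k, k ≤ i → R i k ≤ D i := fun i k hk => by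
    have := Finset.single_le_sum (fun k _ => hR0 i k) (Finset.mem_range.2 (Nat.lt_succ_of_le hk))
    simp only [hD]; linarith
  have key : ∀ i k, k ≤ i → ∀ x, ‖iteratedFDeriv ℝ k (fun x => ((1/2:ℝ)^i / D i) * f i x) x‖ ≤ (1/2:ℝ)^i := by
    intro i k hk x
    have e : (fun x => ((1/2:ℝ)^i / D i) * f i x) = ((1/2:ℝ)^i / D i) • f i := by ext x; simp
    rw [e, iteratedFDeriv_const_smul_apply (cda_nat (hf i).contDiffAt k), norm_smul, Real.norm_eq_abs,
      abs_of_pos (by have := hD1 i; positivity)]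
    have h1 := (hR i k x).trans (hDR i k hk)
    have h2 := hD1 i
    calc _ ≤ (1/2:ℝ)^i / D i * D i := by gcongr
      _ = _ := by field_simp
  have hs : Summable fun i : ℕ => (1/2:ℝ)^i := summable_geometric_two
  refine ⟨fun i => (1/2:ℝ)^i / D i, fun i => by have := hD1 i; positivity, fun x => ?_, ?_⟩
  · refine Summable.of_norm_bounded hs fun i => ?_
    have := key i 0 (Nat.zero_le _) x
    rwa [norm_iteratedFDeriv_zero] at this
  · refine contDiff_tsum_of_eventually (v := fun _ i => (1/2:ℝ)^i) (fun i => contDiff_const.mul (hf i)) (fun _ _ => hs) fun k _ => ?_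
    rw [Nat.cofinite_eq_atTop]
    filter_upwards [eventually_ge_atTop k] with i hi
    exact key i k hi

lemma local_data (hM : IsDCSeq M) {U X : Set (Fin n → ℝ)} (hX : IsQMClosed M U X) {b : Fin n → ℝ} (hb : b ∈ X) :
    ∃ (r : ℝ) (f : (Fin n → ℝ) → ℝ), 0 < r ∧ Metric.ball b r ⊆ U ∧ ContDiff ℝ ∞ f ∧ HasCompactSupport f ∧
      (∀ x, 0 ≤ f x) ∧ (∀ x ∈ X, f x = 0) ∧ (∀ x ∈ Metric.ball b r, f x = 0 → x ∈ X) ∧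
      ∀ x ∈ Metric.ball b r, DCAt (nrm M) f x := by
  obtain ⟨V, hV, hbV, hVU, k, g, hg, hXV⟩ := hX.2.2 b hb
  have W := nrm_wt hM
  obtain ⟨R, hR, hRV⟩ := Metric.isOpen_iff.1 hV b hbV
  set s : (Fin n → ℝ) → ℝ := fun x => ∑ i, g i x * g i x with hs
  have hs0 : ∀ x, 0 ≤ s x := fun x => Finset.sum_nonneg fun i _ => mul_self_nonneg _
  have hsz : ∀ x ∈ V, s x = 0 ↔ x ∈ X := by
    intro x hx
    have h1 : x ∈ X ↔ ∀ i, g i x = 0 := by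
      have : x ∈ X ∩ V ↔ x ∈ {x ∈ V | ∀ i, g i x = 0} := by rw [hXV]
      simpa [hx] using this
    rw [h1]
    simp only [hs]
    rw [Finset.sum_eq_zero_iff_of_nonneg fun i _ => mul_self_nonneg _]
    simp
  have hsd : ∀ x ∈ V, DCAt (nrm M) s x := fun x hx =>
    DCAt.sum W _ fun i _ => (memDC_dcat hM hV (hg i) hx).mul W (memDC_dcat hM hV (hg i) hx)
  let χ : ContDiffBump b := ⟨R/4, R/2, by positivity, by linarith⟩
  have hball : Metric.ball b (R/4) ⊆ V := (Metric.ball_subset_ball (by linarith)).trans hRV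
  have hts : tsupport χ ⊆ V := by
    rw [χ.tsupport_eq]
    exact (Metric.closedBall_subset_ball (show R/2 < R by linarith)).trans hRV
  have heq : ∀ x ∈ Metric.ball b (R/4), s x = χ x * s x := fun x hx => by
    rw [χ.one_of_mem_closedBall (Metric.ball_subset_closedBall hx), one_mul]
  refine ⟨R/4, fun x => χ x * s x, by positivity, hball.trans hVU, ?_, χ.hasCompactSupport.mul_right, ?_, ?_, ?_, ?_⟩
  · rw [contDiff_iff_contDiffAt]
    intro x
    by_cases hx : x ∈ V
    · exact χ.contDiff.contDiffAt.mul (hsd x hx).cda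
    · have h0 : (χ : (Fin n → ℝ) → ℝ) =ᶠ[𝓝 x] 0 := notMem_tsupport_iff_eventuallyEq.1 fun h => hx (hts h)
      refine (contDiffAt_const (c := (0:ℝ))).congr_of_eventuallyEq ?_
      filter_upwards [h0] with y hy
      rw [hy]; simp
  · intro x; exact mul_nonneg χ.nonneg (hs0 x)
  · intro x hx
    by_cases hxV : x ∈ V
    · beta_reduce; rw [(hsz x hxV).2 hx, mul_zero]
    · have : χ x = 0 := by
        by_contra h
        exact hxV (hts (subset_tsupport _ h))
      beta_reduce; rw [this, zero_mul]
  · intro x hx h0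
    beta_reduce at h0
    rw [← heq x hx] at h0
    exact (hsz x (hball hx)).1 h0
  · intro x hx
    refine (hsd x (hball hx)).congr ?_
    filter_upwards [Metric.isOpen_ball.mem_nhds hx] with y hy using heq y hy

theorem main_aux (hM : IsDCSeq M) {U X : Set (Fin n → ℝ)} (hU : IsOpen U) (hX : IsQMClosed M U X)
    {Φ : (Fin n → ℝ) → ℝ} (hΦ : MemDC M U Φ) :
    ∃ (V : Set (Fin n → ℝ)) (H : (Fin n → ℝ) → ℝ), X ⊆ V ∧ V ⊆ U ∧ QD V {x ∈ X | Φ x = 0} H ∧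
      ∀ x ∈ X, H x = Φ x * Φ x := by
  have W := nrm_wt hM
  have hΦs := hΦ.1
  have hXU := hX.1
  set Z : Set (Fin n → ℝ) := {x ∈ X | Φ x = 0} with hZ
  by_cases hne : Z.Nonempty
  swap
  · have hZe : Z = ∅ := not_nonempty_iff_eq_empty.1 hne
    refine ⟨U ∩ Φ ⁻¹' {0}ᶜ, fun x => Φ x * Φ x, ?_, inter_subset_left, ?_, fun _ _ => rfl⟩
    · intro x hx
      refine ⟨hXU hx, fun h => ?_⟩
      have : x ∈ Z := ⟨hx, h⟩
      rw [hZe] at this; exact this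
    · rw [hZe]
      refine ⟨hΦs.continuousOn.isOpen_inter_preimage hU isOpen_compl_singleton, empty_subset _,
        (hΦs.mul hΦs).mono inter_subset_left, fun x hx => ?_, fun z hz => hz.elim⟩
      have : Φ x ≠ 0 := hx.2
      simp [this]
  have hloc : ∀ b : Fin n → ℝ, ∃ (r : ℝ) (f : (Fin n → ℝ) → ℝ), b ∈ Z → (0 < r ∧ Metric.ball b r ⊆ U ∧ ContDiff ℝ ∞ f ∧ HasCompactSupport f ∧
      (∀ x, 0 ≤ f x) ∧ (∀ x ∈ X, f x = 0) ∧ (∀ x ∈ Metric.ball b r, f x = 0 → x ∈ X) ∧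
      ∀ x ∈ Metric.ball b r, DCAt (nrm M) f x) := by
    intro b
    by_cases hb : b ∈ Z
    · obtain ⟨r, f, h⟩ := local_data hM hX hb.1
      exact ⟨r, f, fun _ => h⟩
    · exact ⟨0, 0, fun h => absurd h hb⟩
  choose r f hrf using hloc
  obtain ⟨t, htZ, htc, hcov⟩ := TopologicalSpace.countable_cover_nhdsWithin (f := fun b => Metric.ball b (r b)) (s := Z)
    fun b hb => mem_nhdsWithin_of_mem_nhds (Metric.ball_mem_nhds b (hrf b hb).1)
  have htne : t.Nonempty := by
    obtain ⟨z, hz⟩ := hne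
    obtain ⟨b, hb, -⟩ := mem_iUnion₂.1 (hcov hz)
    exact ⟨b, hb⟩
  obtain ⟨e, he⟩ := htc.exists_eq_range htne
  have heZ : ∀ i, e i ∈ Z := fun i => htZ (he ▸ mem_range_self i)
  obtain ⟨ε, hε, hsum, hS⟩ := exists_sum (fun i => f (e i)) (fun i => (hrf _ (heZ i)).2.2.1)
    fun i => (hrf _ (heZ i)).2.2.2.1
  set S : (Fin n → ℝ) → ℝ := fun x => ∑' i, ε i * f (e i) x with hSd
  set H : (Fin n → ℝ) → ℝ := fun x => Φ x * Φ x + S x with hH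
  have hterm : ∀ i x, 0 ≤ ε i * f (e i) x := fun i x => mul_nonneg (hε i).le ((hrf _ (heZ i)).2.2.2.2.1 x)
  have hSge : ∀ i x, ε i * f (e i) x ≤ S x := fun i x => (hsum x).le_tsum i fun j _ => hterm j x
  have hSX : ∀ x ∈ X, S x = 0 := fun x hx => by
    simp only [hSd]
    have : (fun i => ε i * f (e i) x) = fun _ => 0 := by
      ext i; rw [(hrf _ (heZ i)).2.2.2.2.2.1 x hx, mul_zero]
    rw [this, tsum_zero]
  have hHX : ∀ x ∈ X, H x = Φ x * Φ x := fun x hx => by simp only [hH]; rw [hSX x hx, add_zero]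
  have hHs : ContDiffOn ℝ ∞ H U := (hΦs.mul hΦs).add hS.contDiffOn
  have hballU : ∀ i, Metric.ball (e i) (r (e i)) ⊆ U := fun i => (hrf _ (heZ i)).2.1
  have hcov' : ∀ z ∈ Z, ∃ i, z ∈ Metric.ball (e i) (r (e i)) := fun z hz => by
    obtain ⟨b, hb, hzb⟩ := mem_iUnion₂.1 (hcov hz)
    rw [he] at hb
    obtain ⟨i, rfl⟩ := hb
    exact ⟨i, hzb⟩
  have hZi : ∀ i, ∀ x ∈ Metric.ball (e i) (r (e i)), ∀ c > 0, Φ x * Φ x + c * f (e i) x ≤ 0 → x ∈ Z := by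
    intro i x hx c hc h0
    have h1 := mul_self_nonneg (Φ x)
    have h2 : 0 ≤ c * f (e i) x := mul_nonneg hc.le ((hrf _ (heZ i)).2.2.2.2.1 x)
    have h3 : Φ x = 0 := mul_self_eq_zero.1 (by linarith)
    have h4 : f (e i) x = 0 := by
      have : c * f (e i) x = 0 := by linarith
      exact (mul_eq_zero.1 this).resolve_left hc.ne'
    exact ⟨(hrf _ (heZ i)).2.2.2.2.2.2.1 x hx h4, h3⟩
  refine ⟨(U ∩ H ⁻¹' {0}ᶜ) ∪ ⋃ i, Metric.ball (e i) (r (e i)), H, ?_, ?_, ?_, hHX⟩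
  · intro x hx
    by_cases h0 : Φ x = 0
    · exact Or.inr (mem_iUnion.2 (hcov' x ⟨hx, h0⟩))
    · refine Or.inl ⟨hXU hx, ?_⟩
      simp [hHX x hx, h0]
  · exact union_subset inter_subset_left (iUnion_subset hballU)
  · refine ⟨(hHs.continuousOn.isOpen_inter_preimage hU isOpen_compl_singleton).union
        (isOpen_iUnion fun i => Metric.isOpen_ball), fun z hz => Or.inr (mem_iUnion.2 (hcov' z hz)),
        hHs.mono (union_subset inter_subset_left (iUnion_subset hballU)), ?_, ?_⟩
    · intro x hx
      constructor
      · intro h0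
        rcases hx with hx | hx
        · exact absurd h0 hx.2
        · obtain ⟨i, hi⟩ := mem_iUnion.1 hx
          refine hZi i x hi (ε i) (hε i) ?_
          have := hSge i x
          simp only [hH] at h0
          linarith
      · intro h
        rw [hHX x h.1, h.2, mul_zero]
    · intro z0 hz0
      obtain ⟨i, hi⟩ := hcov' z0 hz0
      set h : (Fin n → ℝ) → ℝ := fun x => Φ x * Φ x + f (e i) x with hh
      have hΦd := memDC_dcat hM hU hΦ (hXU hz0.1)
      have hhd : DCAt (nrm M) h z0 := (hΦd.mul W hΦd).add W ((hrf _ (heZ i)).2.2.2.2.2.2.2 z0 hi)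
      have hh0 : h z0 = 0 := by
        simp only [hh]
        rw [hz0.2, (hrf _ (heZ i)).2.2.2.2.2.1 z0 hz0.1]; simp
      obtain ⟨d, C, hC, hL⟩ := dc_loj_at W hhd (Metric.isOpen_ball.mem_nhds hi)
      have hsm : ∀ᶠ x in 𝓝 z0, C * |h x| < 1 := by
        have : Tendsto (fun x => C * |h x|) (𝓝 z0) (𝓝 (C * |h z0|)) := hhd.cont.abs.tendsto.const_mul C
        rw [hh0, abs_zero, mul_zero] at this
        exact this.eventually (gt_mem_nhds one_pos)
      refine ⟨d, C * max 1 (ε i)⁻¹, by positivity, ?_⟩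
      filter_upwards [hL, hsm] with x hx hx1
      obtain ⟨z, hz, hz0, hxz⟩ := hx.resolve_left (not_le.2 hx1)
      refine ⟨z, hZi i z hz 1 one_pos (by simp only [hh] at hz0; linarith), hxz.trans ?_⟩
      rw [mul_assoc]
      gcongr
      have hf0 : 0 ≤ f (e i) x := (hrf _ (heZ i)).2.2.2.2.1 x
      have hΦ0 := mul_self_nonneg (Φ x)
      have h2 := hSge i x
      have h3 := (hterm i x).trans h2
      have hεi := hε i
      rw [abs_of_nonneg (by simp only [hh]; linarith), abs_of_nonneg (by simp only [hH]; linarith)]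
      simp only [hh, hH]
      have h4 : f (e i) x ≤ (ε i)⁻¹ * S x := by
        rw [inv_mul_eq_div, le_div_iff₀ hεi]; linarith
      calc Φ x * Φ x + f (e i) x ≤ 1 * (Φ x * Φ x) + (ε i)⁻¹ * S x := by linarith
        _ ≤ max 1 (ε i)⁻¹ * (Φ x * Φ x) + max 1 (ε i)⁻¹ * S x := by
          gcongr
          · exact le_max_left _ _
          · exact le_max_right _ _
        _ = _ := by ring

theorem main_thm
    {n : ℕ} (M : ℕ → ℝ) (hM : IsDCSeq M)
    (U : Set (Fin n → ℝ)) (hU : IsOpen U)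
    (X : Set (Fin n → ℝ)) (hX : IsQMClosed M U X)
    (Φ : (Fin n → ℝ) → ℝ) (hΦ : MemDC M U Φ)
    (F : (Fin n → ℝ) → ℝ) (hF : ContDiffOn ℝ (⊤ : ℕ∞) F U)
    (hflat : ∀ x ∈ X, Φ x = 0 → FlatAt F x) :
    ∃ V : Set (Fin n → ℝ), IsOpen V ∧ X ⊆ V ∧ V ⊆ U ∧
      ∃ G : (Fin n → ℝ) → ℝ, ContDiffOn ℝ (⊤ : ℕ∞) G V ∧
        (∀ x ∈ X, Φ x ≠ 0 → G x = F x / Φ x) ∧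
        (∀ x ∈ X, Φ x = 0 → FlatAt G x) := by
  obtain ⟨V, H, hXV, hVU, D, hH⟩ := main_aux hM hU hX hΦ
  have hFl : Fl V {x ∈ X | Φ x = 0} F :=
    ⟨hF.mono hVU, fun z hz => (flat_ifd hU hF (hX.1 hz.1)).1 (hflat z hz.1 hz.2)⟩
  have hG := D.main (Fl.smul D.op D.sub (hΦ.1.mono hVU) hFl) 0
  refine ⟨V, D.op, hXV, hVU, _, hG.1, fun x hx h0 => ?_, fun x hx h0 => ?_⟩
  · simp only [qq, hH x hx, smul_eq_mul, zero_add, pow_one]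
    field_simp
  · exact (flat_ifd D.op hG.1 (hXV hx)).2 (hG.2 x ⟨hx, h0⟩)

end
end QDC

namespace QDC

/-- **Multiplier lemma.** If `F` is `C^∞` on `U` and flat on `X ∩ {Φ = 0}`, where
`Φ` is of class `Q_M` and `X` is a closed `Q_M`-subset of `U`, then `F/Φ` on `X` is the
restriction of a `C^∞` function flat on `X ∩ {Φ = 0}`. -/
theorem multiplier_lemma
    {n : ℕ} (M : ℕ → ℝ) (hM : IsDCSeq M)
    (U : Set (Fin n → ℝ)) (hU : IsOpen U)
    (X : Set (Fin n → ℝ)) (hX : IsQMClosed M U X)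
    (Φ : (Fin n → ℝ) → ℝ) (hΦ : MemDC M U Φ)
    (F : (Fin n → ℝ) → ℝ) (hF : ContDiffOn ℝ (⊤ : ℕ∞) F U)
    (hflat : ∀ x ∈ X, Φ x = 0 → FlatAt F x) :
    ∃ V : Set (Fin n → ℝ), IsOpen V ∧ X ⊆ V ∧ V ⊆ U ∧
      ∃ G : (Fin n → ℝ) → ℝ, ContDiffOn ℝ (⊤ : ℕ∞) G V ∧
        (∀ x ∈ X, Φ x ≠ 0 → G x = F x / Φ x) ∧
        (∀ x ∈ X, Φ x = 0 → FlatAt G x) := by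
  exact main_thm M hM U hU X hX Φ hΦ F hF hflat

end QDC
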